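/- arXiv:2106.01524 — 2 statements merged into one kernel-verified Lean document; each statement's English description precedes it below -/
import Mathlib

section
/- Let K be a Euclidean cubical complex in ℝⁿ with a minimum vertex w. The following two statements are equivalent: (1) for every vertex v of K, the dipath space P(K, w, v) is contractible; (2) for every vertex v of K with v ≠ w, the geometric realization of pastlk(K, v) is contractible. -/
open Set

namespace DCC

/-- The real point corresponding to an integer point of `ℤⁿ`. -/
def toR {n : ℕ} (v : Fin n → ℤ) : Fin n → ℝ := fun i => (v i : ℝ)

/-- `j ∈ {0,1}ⁿ`: every coordinate of `j` is `0` or `1`. -/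
def IsBinary {n : ℕ} (j : Fin n → ℤ) : Prop := ∀ i, j i = 0 ∨ j i = 1

/-- The elementary cube `[v - j, v] = {x : v - j ⪯ x ⪯ v}` in `ℝⁿ`. -/
def cube {n : ℕ} (v j : Fin n → ℤ) : Set (Fin n → ℝ) := Set.Icc (toR (v - j)) (toR v)

/-- A subset of `ℝⁿ` which is an elementary cube. -/
def IsElemCube {n : ℕ} (σ : Set (Fin n → ℝ)) : Prop := ∃ v j, IsBinary j ∧ σ = cube v j

/-- A Euclidean cubical complex: a finite union of elementary cubes. -/
def IsComplex {n : ℕ} (K : Set (Fin n → ℝ)) : Prop :=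
  ∃ C : Finset ((Fin n → ℤ) × (Fin n → ℤ)),
    (∀ c ∈ C, IsBinary c.2) ∧ K = ⋃ c ∈ C, cube c.1 c.2

/-- The past link of `v` in `K`: all nonzero binary `j` with `[v - j, v] ⊆ K`. -/
def pastlk {n : ℕ} (K : Set (Fin n → ℝ)) (v : Fin n → ℤ) : Set (Fin n → ℤ) :=
  {j | IsBinary j ∧ j ≠ 0 ∧ cube v j ⊆ K}

/-- A maximal cube of `K`: a cube of `K` not properly contained in another cube of `K`. -/
def IsMaximalCube {n : ℕ} (K σ : Set (Fin n → ℝ)) : Prop :=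
  IsElemCube σ ∧ σ ⊆ K ∧ ∀ γ, IsElemCube γ → γ ⊆ K → σ ⊆ γ → γ = σ

/-- `τ` is a free face of the maximal cube `σ` in `K`: `τ` is a proper face of `σ` and
`σ` is the unique maximal cube of `K` containing `τ`. -/
def IsFreeFace {n : ℕ} (K τ σ : Set (Fin n → ℝ)) : Prop :=
  IsElemCube τ ∧ τ ⊂ σ ∧ IsMaximalCube K σ ∧
    ∀ γ, IsMaximalCube K γ → τ ⊆ γ → γ = σ

/-- The `(τ, σ)`-collapse of `K`: the union of all cubes of `K` that do not contain `τ`. -/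
def collapse {n : ℕ} (K τ : Set (Fin n → ℝ)) : Set (Fin n → ℝ) :=
  ⋃₀ {γ | IsElemCube γ ∧ γ ⊆ K ∧ ¬ τ ⊆ γ}

/-- The restriction `K|_σ` where `σ` has minimum vertex `a` and maximum vertex `b`:
the union of all cubes `γ` of `K` with `a ⪯ min γ` and `max γ ⪯ b`. -/
def restrict {n : ℕ} (K : Set (Fin n → ℝ)) (a b : Fin n → ℤ) : Set (Fin n → ℝ) :=
  ⋃₀ {γ | ∃ v j, IsBinary j ∧ γ = cube v j ∧ cube v j ⊆ K ∧ a ≤ v - j ∧ v ≤ b}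

/-- The geometric realization of the past link of `v` in `K`, as a subset of `ℝⁿ`:
the union over `j ∈ pastlk K v` of the convex hulls of `{v - eᵢ : jᵢ = 1}`. -/
def geomReal {n : ℕ} (K : Set (Fin n → ℝ)) (v : Fin n → ℤ) : Set (Fin n → ℝ) :=
  ⋃ j ∈ pastlk K v, convexHull ℝ ((fun i => toR v - Pi.single i (1 : ℝ)) '' {i | j i = 1})

/-- The space of dipaths in `K` from `p` to `q`, as a subspace of
`C([0,1], ℝⁿ)` with the compact-open topology. -/
def DipathSpace {n : ℕ} (K : Set (Fin n → ℝ)) (p q : Fin n → ℝ) :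
    Set C(unitInterval, Fin n → ℝ) :=
  {γ | (∀ t, γ t ∈ K) ∧ γ 0 = p ∧ γ 1 = q ∧ Monotone ⇑γ}

/-- The reachable complex `R(K, p)`: points of `K` reachable from `p` by a dipath in `K`. -/
def reach {n : ℕ} (K : Set (Fin n → ℝ)) (p : Fin n → ℝ) : Set (Fin n → ℝ) :=
  {q ∈ K | (DipathSpace K p q).Nonempty}

/-- `(τ, σ)` is an LPDC pair in `K` (where `K'` is the `(τ,σ)`-collapse of `K`):
for every vertex `v` of `K'`, the geometric realizations of the past links of `v`
in `K` and in `K'` are homotopy equivalent. -/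
def IsLPDCPair {n : ℕ} (K τ : Set (Fin n → ℝ)) : Prop :=
  ∀ v : Fin n → ℤ, toR v ∈ collapse K τ →
    Nonempty (ContinuousMap.HomotopyEquiv ↥(geomReal K v) ↥(geomReal (collapse K τ) v))


section
variable {ι E S Y : Type*} [TopologicalSpace E] [TopologicalSpace S] [TopologicalSpace Y]
open Classical in
/-- One step. -/
noncomputable def stepPt (H : ι → unitInterval → E → E) (p : ι → E) (a : ι) (s : unitInterval) (e : E) : E :=
  if s = 1 then p a else if s = 0 then e else H a s e

noncomputable def runPt (H : ι → unitInterval → E → E) (p : ι → E) :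
    List ι → (ι → unitInterval) → E → E
  | [], _, e => e
  | a :: l, s, e => runPt H p l s (stepPt H p a (s a) e)

theorem runPt_zero (H : ι → unitInterval → E → E) (p : ι → E) (l : List ι) (s : ι → unitInterval)
    (e : E) (h : ∀ a ∈ l, s a = 0) : runPt H p l s e = e := by
  induction l generalizing e with
  | nil => rfl
  | cons a l ih =>
    have h0 : s a = 0 := h a (by simp)
    simp only [runPt]
    rw [ih _ (fun b hb => h b (by simp [hb]))]
    simp [stepPt, h0]

theorem runPt_one (H : ι → unitInterval → E → E) (p : ι → E) (l : List ι) (s : ι → unitInterval)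
    (e e' : E) (h : ∃ a ∈ l, s a = 1) : runPt H p l s e = runPt H p l s e' := by
  induction l generalizing e e' with
  | nil => simp at h
  | cons a l ih =>
    simp only [runPt]
    by_cases h1 : s a = 1
    · simp [stepPt, h1]
    · apply ih
      obtain ⟨b, hb, hb1⟩ := h
      rcases List.mem_cons.1 hb with rfl | hb
      · exact absurd hb1 h1
      · exact ⟨b, hb, hb1⟩

theorem runPt_main (H : ι → unitInterval → E → E) (p : ι → E) (V : ι → Set E) (C : ι → Set S)
    (hC : ∀ a, IsClosed (C a))
    (hHc : ∀ a, ContinuousOn (fun x : unitInterval × E => H a x.1 x.2) (univ ×ˢ V a))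
    (hHV : ∀ a s e, e ∈ V a → H a s e ∈ V a)
    (hpV : ∀ a, p a ∈ V a)
    (hH0 : ∀ a e, e ∈ V a → H a 0 e = e) (hH1 : ∀ a e, e ∈ V a → H a 1 e = p a)
    (q : Y → S) (hq : Continuous q) (wt : ι → Y → unitInterval) (hwt : ∀ a, Continuous (wt a))
    (hwC : ∀ a y, wt a y ≠ 0 → q y ∈ C a)
    (Q : Y → E → Prop) (hQp : ∀ a y, q y ∈ C a → Q y (p a))
    (hQH : ∀ a y s e, q y ∈ C a → e ∈ V a → Q y e → Q y (H a s e))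
    (l : List ι) (hl : l.Pairwise (fun a b => (C a ∩ C b).Nonempty → V a ⊆ V b))
    (D : Set Y) (hD : IsClosed D) (f : Y → E) (hf : ContinuousOn f D)
    (hfV : ∀ y ∈ D, ∀ b ∈ l, q y ∈ C b → f y ∈ V b) (hfQ : ∀ y ∈ D, Q y (f y)) :
    ContinuousOn (fun y => runPt H p l (fun a => wt a y) (f y)) (D ∪ {y | ∃ a ∈ l, wt a y = 1}) ∧
    ∀ y ∈ (D ∪ {y | ∃ a ∈ l, wt a y = 1}), Q y (runPt H p l (fun a => wt a y) (f y)) := by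
  induction l generalizing D f with
  | nil => simpa [runPt] using ⟨hf, hfQ⟩
  | cons a l ih =>
    rw [List.pairwise_cons] at hl
    have hne : (1 : unitInterval) ≠ 0 := one_ne_zero
    have hcl1 : IsClosed {y | wt a y = 1} := isClosed_eq (hwt a) continuous_const
    have hcl0 : IsClosed {y | wt a y = 0} := isClosed_eq (hwt a) continuous_const
    have hclC : IsClosed (q ⁻¹' C a) := (hC a).preimage hq
    have key := ih hl.2 (D ∪ {y | wt a y = 1}) (hD.union hcl1)
      (fun y => stepPt H p a (wt a y) (f y)) ?_ ?_ ?_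
    · have hs : (D ∪ {y | wt a y = 1}) ∪ {y | ∃ b ∈ l, wt b y = 1}
          = D ∪ {y | ∃ b ∈ a :: l, wt b y = 1} := by
        ext y; simp [or_assoc]
      rw [hs] at key
      exact key
    · have hsub : D ∪ {y | wt a y = 1} ⊆
          ((D ∩ {y | wt a y = 0}) ∪ (D ∩ q ⁻¹' C a)) ∪ {y | wt a y = 1} := by
        rintro y (hy | hy)
        · left
          by_cases h0 : wt a y = 0
          · exact Or.inl ⟨hy, h0⟩
          · exact Or.inr ⟨hy, hwC a y h0⟩
        · exact Or.inr hy
      refine ContinuousOn.mono ?_ hsub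
      refine ContinuousOn.union_of_isClosed (ContinuousOn.union_of_isClosed ?_ ?_
        (hD.inter hcl0) (hD.inter hclC)) ?_ ((hD.inter hcl0).union (hD.inter hclC)) hcl1
      · refine (hf.mono inter_subset_left).congr ?_
        rintro y ⟨_, hy⟩
        have hy : wt a y = 0 := hy
        simp [stepPt, hy]
      · have h2 : ContinuousOn (fun y => H a (wt a y) (f y)) (D ∩ q ⁻¹' C a) := by
          refine (hHc a).comp (f := fun y => (wt a y, f y))
            ((hwt a).continuousOn.prodMk (hf.mono inter_subset_left)) ?_
          rintro y ⟨hy, hyC⟩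
          exact ⟨mem_univ _, hfV y hy a (by simp) hyC⟩
        refine h2.congr ?_
        rintro y ⟨hy, hyC⟩
        have hv := hfV y hy a (by simp) hyC
        by_cases h1 : wt a y = 1
        · simp [stepPt, h1, hH1 a _ hv]
        · by_cases h0 : wt a y = 0
          · simp [stepPt, h0, hH0 a _ hv]
          · simp [stepPt, h0, h1]
      · refine (continuousOn_const (c := p a)).congr ?_
        intro y hy
        have hy : wt a y = 1 := hy
        simp [stepPt, hy]
    · intro y hy b hb hyb
      by_cases h1 : wt a y = 1
      · simp only [stepPt, h1, if_true]
        exact hl.1 b hb ⟨q y, hwC a y (by rw [h1]; exact hne), hyb⟩ (hpV a)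
      · have hyD : y ∈ D := hy.resolve_right h1
        by_cases h0 : wt a y = 0
        · simpa [stepPt, h0] using hfV y hyD b (by simp [hb]) hyb
        · simp only [stepPt, h1, h0, if_false]
          exact hl.1 b hb ⟨q y, hwC a y h0, hyb⟩
            (hHV a _ _ (hfV y hyD a (by simp) (hwC a y h0)))
    · intro y hy
      by_cases h1 : wt a y = 1
      · simp only [stepPt, h1, if_true]
        exact hQp a y (hwC a y (by rw [h1]; exact hne))
      · have hyD : y ∈ D := hy.resolve_right h1
        by_cases h0 : wt a y = 0
        · simpa [stepPt, h0] using hfQ y hyD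
        · simp only [stepPt, h1, h0, if_false]
          exact hQH a y _ _ (hwC a y h0) (hfV y hyD a (by simp) (hwC a y h0)) (hfQ y hyD)
end

theorem contractible_of_dominated {X Y : Type*} [TopologicalSpace X] [TopologicalSpace Y]
    (f : C(X, Y)) (g : C(Y, X)) (h : (g.comp f).Homotopic (ContinuousMap.id X))
    [ContractibleSpace Y] : ContractibleSpace X := by
  rw [contractible_iff_id_nullhomotopic]
  obtain ⟨y, hy⟩ := id_nullhomotopic Y
  refine ⟨g y, h.symm.trans ?_⟩
  have h2 := (ContinuousMap.Homotopic.refl g).comp (hy.comp (ContinuousMap.Homotopic.refl f))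
  exact h2

theorem glue {ι E S : Type*} [TopologicalSpace E] [TopologicalSpace S] [Nonempty E]
    (π : C(E, S))
    (H : ι → unitInterval → E → E) (p : ι → E) (V : ι → Set E) (C : ι → Set S)
    (hC : ∀ a, IsClosed (C a))
    (hHc : ∀ a, ContinuousOn (fun x : unitInterval × E => H a x.1 x.2) (univ ×ˢ V a))
    (hHV : ∀ a s e, e ∈ V a → H a s e ∈ V a)
    (hpV : ∀ a, p a ∈ V a)
    (hH0 : ∀ a e, e ∈ V a → H a 0 e = e) (hH1 : ∀ a e, e ∈ V a → H a 1 e = p a)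
    (hCV : ∀ a e, π e ∈ C a → e ∈ V a)
    (s : ι → S → unitInterval) (hs : ∀ a, Continuous (s a))
    (hsC : ∀ a z, s a z ≠ 0 → z ∈ C a)
    (l : List ι) (hl : l.Pairwise (fun a b => (C a ∩ C b).Nonempty → V a ⊆ V b))
    (hs1 : ∀ z, ∃ a ∈ l, s a z = 1)
    (Q : S → E → Prop) (hQp : ∀ a z, z ∈ C a → Q z (p a))
    (hQH : ∀ a z s e, z ∈ C a → e ∈ V a → Q z e → Q z (H a s e)) :
    ∃ r : C(S, E), (r.comp π).Homotopic (ContinuousMap.id E) ∧ ∀ z, Q z (r z) := by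
  obtain ⟨e0⟩ := ‹Nonempty E›
  have hr := runPt_main H p V C hC hHc hHV hpV hH0 hH1 (id : S → S) continuous_id s hs hsC
    Q hQp hQH l hl ∅ isClosed_empty (fun _ => e0) (continuousOn_empty _) (by simp) (by simp)
  have hF := runPt_main H p V C hC hHc hHV hpV hH0 hH1 (fun y : unitInterval × E => π y.2)
    (by fun_prop) (fun a y => y.1 * s a (π y.2))
    (fun a => continuous_fst.mul ((hs a).comp (by fun_prop)))
    (fun a y h => hsC a _ (fun h0 => h (by rw [h0, mul_zero])))
    (fun _ _ => True) (by simp) (by simp) l hl univ isClosed_univ (fun y => y.2)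
    continuous_snd.continuousOn (fun y _ b _ h => hCV b _ h) (by simp)
  have hall : (∅ ∪ {y | ∃ a ∈ l, s a y = 1}) = univ := by
    rw [empty_union]; exact eq_univ_of_forall hs1
  rw [hall] at hr
  rw [univ_union, continuousOn_univ] at hF
  refine ⟨⟨_, continuousOn_univ.1 hr.1⟩, ?_, fun z => hr.2 z (mem_univ _)⟩
  refine ContinuousMap.Homotopic.symm ⟨⟨⟨_, hF.1⟩, ?_, ?_⟩⟩
  · intro e
    exact runPt_zero H p l _ _ (by simp)
  · intro e
    simp only [one_mul]
    exact runPt_one H p l _ _ _ (hs1 _)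

theorem exists_total {E : Type*} [TopologicalSpace E] (V : Set E) (p : V)
    (h : ContinuousMap.Homotopy (ContinuousMap.id V) (ContinuousMap.const V p)) :
    ∃ H : unitInterval → E → E,
      ContinuousOn (fun x : unitInterval × E => H x.1 x.2) (univ ×ˢ V) ∧
      (∀ s (e : V), H s e = h (s, e)) := by
  classical
  refine ⟨fun s e => if he : e ∈ V then (h (s, ⟨e, he⟩) : V) else e, ?_, ?_⟩
  · rw [continuousOn_iff_continuous_domRestrict]
    have : Continuous (fun x : ↥((univ : Set unitInterval) ×ˢ V) =>
        ((h (x.1.1, ⟨x.1.2, x.2.2⟩) : V) : E)) := by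
      refine continuous_subtype_val.comp (h.continuous.comp ?_)
      exact (continuous_fst.comp continuous_subtype_val).prodMk
        ((continuous_snd.comp continuous_subtype_val).subtype_mk _)
    refine this.congr ?_
    intro x
    have := x.2.2
    simp [this]
  · intro s e
    simp

/-- Transport of a path to a new end point. -/
noncomputable def tr {n : ℕ} (x : Fin n → ℝ) (γ : C(unitInterval, Fin n → ℝ)) :
    C(unitInterval, Fin n → ℝ) :=
  ⟨fun t => fun i => min (x i) (γ (projIcc 0 1 zero_le_one ((1 + dist (γ 1) x) * (t : ℝ))) i +
    max 0 ((1 + dist (γ 1) x) * (t : ℝ) - 1)), by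
      have : Continuous (projIcc (0:ℝ) 1 zero_le_one) := continuous_projIcc
      fun_prop⟩

theorem tr_apply {n : ℕ} (x : Fin n → ℝ) (γ : C(unitInterval, Fin n → ℝ)) (t : unitInterval)
    (i : Fin n) : tr x γ t i =
    min (x i) (γ (projIcc 0 1 zero_le_one ((1 + dist (γ 1) x) * (t : ℝ))) i +
    max 0 ((1 + dist (γ 1) x) * (t : ℝ) - 1)) := rfl

theorem tr_continuous {n : ℕ} :
    Continuous (fun y : (Fin n → ℝ) × C(unitInterval, Fin n → ℝ) => tr y.1 y.2) := by
  apply ContinuousMap.continuous_of_continuous_uncurry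
  have : Continuous (projIcc (0:ℝ) 1 zero_le_one) := continuous_projIcc
  refine continuous_pi fun i => ?_
  change Continuous (fun y : ((Fin n → ℝ) × C(unitInterval, Fin n → ℝ)) × unitInterval =>
    min (y.1.1 i) (y.1.2 (projIcc 0 1 zero_le_one ((1 + dist (y.1.2 1) y.1.1) * (y.2 : ℝ))) i +
    max 0 ((1 + dist (y.1.2 1) y.1.1) * (y.2 : ℝ) - 1)))
  fun_prop

theorem tr_self {n : ℕ} (γ : C(unitInterval, Fin n → ℝ)) (hm : Monotone γ) : tr (γ 1) γ = γ := by
  ext t i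
  rw [tr_apply]
  have h1 : (t : ℝ) ≤ 1 := t.2.2
  have h2 : γ t i ≤ γ 1 i := hm (show t ≤ 1 from t.2.2) i
  simp [projIcc_val, h1, h2]

/-- Membership criterion. -/
theorem mem_of_face {n : ℕ} {K : Set (Fin n → ℝ)} (hK : IsComplex K) (v : Fin n → ℤ)
    {x y : Fin n → ℝ} (hx : x ∈ K) (hxv : ∀ i, x i ≤ v i) (hx1 : ∀ i, (v i : ℝ) - 1 < x i)
    (hyv : ∀ i, y i ≤ v i) (hy1 : ∀ i, (v i : ℝ) - 1 ≤ y i) (hs : ∀ i, y i < v i → x i < v i) :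
    y ∈ K := by
  obtain ⟨C, hC, rfl⟩ := hK
  simp only [mem_iUnion, exists_prop] at hx ⊢
  obtain ⟨c, hc, hxc⟩ := hx
  refine ⟨c, hc, ?_⟩
  have hl : ∀ i, (c.1 i : ℝ) - c.2 i ≤ x i := fun i => by
    have := hxc.1 i; simpa [toR] using this
  have hu : ∀ i, x i ≤ c.1 i := fun i => hxc.2 i
  refine ⟨fun i => ?_, fun i => ?_⟩
  · simp only [toR, Pi.sub_apply, Int.cast_sub]
    by_cases h : y i < v i
    · have : c.1 i - c.2 i < v i := by
        have := (hl i).trans_lt (hs i h)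
        exact_mod_cast this
      have h2 : c.1 i - c.2 i ≤ v i - 1 := by omega
      have h3 : (c.1 i : ℝ) - c.2 i ≤ v i - 1 := by exact_mod_cast h2
      linarith [hy1 i]
    · linarith [hl i, hxv i]
  · simp only [toR]
    have h1 : v i - 1 < c.1 i := by
      have := (hx1 i).trans_le (hu i)
      exact_mod_cast this
    have h2 : v i ≤ c.1 i := by omega
    have h3 : (v i : ℝ) ≤ c.1 i := by exact_mod_cast h2
    linarith [hyv i]

theorem mem_of_lower {n : ℕ} {K : Set (Fin n → ℝ)} (hK : IsComplex K) (v : Fin n → ℤ)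
    {x y : Fin n → ℝ} (hx : x ∈ K)
    (h : ∀ i, y i = x i ∨ ((v i : ℝ) - 1 ≤ y i ∧ y i ≤ x i ∧ x i < v i)) :
    y ∈ K := by
  obtain ⟨C, hC, rfl⟩ := hK
  simp only [mem_iUnion, exists_prop] at hx ⊢
  obtain ⟨c, hc, hxc⟩ := hx
  refine ⟨c, hc, ?_⟩
  have hl : ∀ i, (c.1 i : ℝ) - c.2 i ≤ x i := fun i => by
    have := hxc.1 i; simpa [toR] using this
  have hu : ∀ i, x i ≤ c.1 i := fun i => hxc.2 i
  refine ⟨fun i => ?_, fun i => ?_⟩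
  · simp only [toR, Pi.sub_apply, Int.cast_sub]
    rcases h i with h | ⟨h1, h2, h3⟩
    · rw [h]; exact hl i
    · have : c.1 i - c.2 i < v i := by
        have := (hl i).trans_lt h3
        exact_mod_cast this
      have h2 : c.1 i - c.2 i ≤ v i - 1 := by omega
      have h3 : (c.1 i : ℝ) - c.2 i ≤ v i - 1 := by exact_mod_cast h2
      linarith
  · simp only [toR]
    rcases h i with h | ⟨h1, h2, h3⟩
    · rw [h]; exact hu i
    · linarith [hu i]

theorem tr_mem {n : ℕ} {K : Set (Fin n → ℝ)} (hK : IsComplex K) (w v : Fin n → ℤ)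
    (hmin : ∀ q ∈ K, toR w ≤ q) {x0 x x' : Fin n → ℝ} (hx0 : x0 ∈ K) (hx0v : ∀ i, x0 i ≤ v i)
    (hx01 : ∀ i, (v i : ℝ) - 1 < x0 i) {γ : C(unitInterval, Fin n → ℝ)}
    (hγ : γ ∈ DipathSpace K (toR w) x) (hxv : ∀ i, x i ≤ v i) (hx1 : ∀ i, (v i : ℝ) - 1 ≤ x i)
    (hxs : ∀ i, x i < v i → x0 i < v i) (hxv' : ∀ i, x' i ≤ v i)
    (hx1' : ∀ i, (v i : ℝ) - 1 ≤ x' i) (hs : ∀ i, x' i < v i → x i < v i) :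
    tr x' γ ∈ DipathSpace K (toR w) x' := by
  obtain ⟨hγK, hγ0, hγ1, hm⟩ := hγ
  have hx'K : x' ∈ K := mem_of_face hK v hx0 hx0v hx01 hxv' hx1' (fun i h => hxs i (hs i h))
  have hwx := hmin x' hx'K
  have hd : 0 ≤ dist (γ 1) x' := dist_nonneg
  refine ⟨fun t => ?_, ?_, ?_, ?_⟩
  · by_cases hle : (1 + dist (γ 1) x') * (t : ℝ) ≤ 1
    · refine mem_of_lower hK v (hγK (projIcc 0 1 zero_le_one ((1 + dist (γ 1) x') * (t : ℝ)))) ?_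
      intro i
      rw [tr_apply, max_eq_left (by linarith), add_zero]
      set g := γ (projIcc 0 1 zero_le_one ((1 + dist (γ 1) x') * (t : ℝ))) i
      have hg : g ≤ x i := by
        rw [← hγ1]; exact hm (unitInterval.le_one (projIcc 0 1 zero_le_one ((1 + dist (γ 1) x') * (t : ℝ)))) i
      by_cases h : g ≤ x' i
      · left; exact min_eq_right h
      · right
        push Not at h
        rw [min_eq_left h.le]
        exact ⟨hx1' i, h.le, hg.trans_lt (hs i (by linarith [hxv i]))⟩
    · push Not at hle
      have hp : projIcc (0:ℝ) 1 zero_le_one ((1 + dist (γ 1) x') * (t : ℝ)) = 1 :=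
        projIcc_of_right_le _ hle.le
      refine mem_of_face hK v hx0 hx0v hx01 ?_ ?_ ?_ <;> intro i <;>
        rw [tr_apply, hp, hγ1, max_eq_right (by rw [hγ1] at hle; linarith)]
      · exact (min_le_left _ _).trans (hxv' i)
      · refine le_min (hx1' i) ?_
        rw [hγ1] at hle
        linarith [hx1 i]
      · intro h
        apply hxs
        rcases min_lt_iff.1 h with h | h
        · exact hs i h
        · rw [hγ1] at hle
          linarith
  · ext i
    rw [tr_apply]
    simp [hγ0, hwx i]
  · ext i
    have hp : projIcc (0:ℝ) 1 zero_le_one ((1 + dist (γ 1) x') * ((1 : unitInterval) : ℝ)) = 1 :=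
        projIcc_of_right_le _ (by simp)
    rw [tr_apply, hp]
    apply min_eq_left
    have := dist_le_pi_dist (γ 1) x' i
    rw [Real.dist_eq] at this
    have h2 := neg_abs_le (γ 1 i - x' i)
    have h3 := le_max_right 0 ((1 + dist (γ 1) x') * ((1 : unitInterval) : ℝ) - 1)
    simp only [Icc.coe_one] at h3 ⊢
    linarith
  · intro t t' htt i
    rw [tr_apply, tr_apply]
    have hmul : (1 + dist (γ 1) x') * (t : ℝ) ≤ (1 + dist (γ 1) x') * (t' : ℝ) :=
      mul_le_mul_of_nonneg_left htt (by linarith)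
    have := hm (monotone_projIcc (zero_le_one (α := ℝ)) hmul) i
    gcongr

theorem tr_cont_right {n : ℕ} (x : Fin n → ℝ) :
    Continuous (fun γ : C(unitInterval, Fin n → ℝ) => tr x γ) :=
  tr_continuous.comp (f := fun γ => (x, γ)) (by fun_prop)

/-- The slice. -/
def Sl {n : ℕ} (K : Set (Fin n → ℝ)) (v : Fin n → ℤ) : Set (Fin n → ℝ) :=
  {x | x ∈ K ∧ (∀ i, x i ≤ v i) ∧ ∑ i, ((v i : ℝ) - x i) = 1 / 2}

theorem gt_of_sum {n : ℕ} {v : Fin n → ℤ} {x : Fin n → ℝ} (hx : ∀ i, x i ≤ v i) {c : ℝ}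
    (hc : c < 1) (hs : ∑ i, ((v i : ℝ) - x i) = c) (i : Fin n) : (v i : ℝ) - 1 < x i := by
  have := Finset.single_le_sum (f := fun i => (v i : ℝ) - x i)
    (fun i _ => sub_nonneg.2 (hx i)) (Finset.mem_univ i)
  simp only [hs] at this
  linarith

theorem Sl_gt {n : ℕ} {K : Set (Fin n → ℝ)} {v : Fin n → ℤ} {x : Fin n → ℝ} (hx : x ∈ Sl K v)
    (i : Fin n) : (v i : ℝ) - 1 < x i := gt_of_sum hx.2.1 (by norm_num) hx.2.2 i

/-- Straight segment. -/
def seg {n : ℕ} (τ : ℝ) (x y : Fin n → ℝ) : Fin n → ℝ := fun i => (1 - τ) * x i + τ * y i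

theorem seg_zero {n : ℕ} (x y : Fin n → ℝ) : seg 0 x y = x := by ext i; simp [seg]
theorem seg_one {n : ℕ} (x y : Fin n → ℝ) : seg 1 x y = y := by ext i; simp [seg]

theorem seg_le {n : ℕ} {v : Fin n → ℤ} {x y : Fin n → ℝ} (hx : ∀ i, x i ≤ v i)
    (hy : ∀ i, y i ≤ v i) (τ : unitInterval) (i : Fin n) : seg τ x y i ≤ v i := by
  have h0 := τ.2.1
  have h1 := τ.2.2
  simp only [seg]
  nlinarith [hx i, hy i, mul_nonneg h0 (sub_nonneg.2 (hy i)),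
    mul_nonneg (sub_nonneg.2 h1) (sub_nonneg.2 (hx i))]

theorem seg_lower {n : ℕ} {v : Fin n → ℤ} {x y : Fin n → ℝ} (hx : ∀ i, (v i : ℝ) - 1 ≤ x i)
    (hy : ∀ i, (v i : ℝ) - 1 ≤ y i) (τ : unitInterval) (i : Fin n) :
    (v i : ℝ) - 1 ≤ seg τ x y i := by
  have h0 := τ.2.1
  have h1 := τ.2.2
  simp only [seg]
  nlinarith [hx i, hy i, mul_nonneg h0 (sub_nonneg.2 (hy i)),
    mul_nonneg (sub_nonneg.2 h1) (sub_nonneg.2 (hx i))]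

theorem seg_lt {n : ℕ} {v : Fin n → ℤ} {x y : Fin n → ℝ} (hx : ∀ i, x i ≤ v i)
    (hy : ∀ i, y i < v i → x i < v i) (τ : ℝ) (i : Fin n)
    (h : seg τ x y i < v i) (hy' : ∀ i, y i ≤ v i) : x i < v i := by
  rcases (hx i).lt_or_eq with h1 | h1
  · exact h1
  rcases (hy' i).lt_or_eq with h2 | h2
  · exact hy i h2
  simp only [seg, h1, h2] at h
  exact absurd h (by linarith)

theorem seg_lt_of {n : ℕ} {v : Fin n → ℤ} {x y : Fin n → ℝ} (τ : unitInterval) (i : Fin n)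
    (hx : x i < v i) (hy : y i < v i) : seg τ x y i < v i := by
  have h0 := τ.2.1
  have h1 := τ.2.2
  simp only [seg]
  rcases h0.eq_or_lt with h | h
  · rw [← h]; linarith
  · nlinarith [mul_pos h (sub_pos.2 hy), mul_nonneg (sub_nonneg.2 h1) (sub_nonneg.2 hx.le)]

theorem seg_mem {n : ℕ} {K : Set (Fin n → ℝ)} (hK : IsComplex K) {v : Fin n → ℤ}
    {x y : Fin n → ℝ} (hx : x ∈ Sl K v) (hy : ∀ i, y i ≤ v i)
    (hys : ∑ i, ((v i : ℝ) - y i) = 1 / 2) (hxy : ∀ i, y i < v i → x i < v i)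
    (τ : unitInterval) : seg τ x y ∈ Sl K v := by
  refine ⟨mem_of_face hK v hx.1 hx.2.1 (Sl_gt hx) (seg_le hx.2.1 hy τ)
    (seg_lower (fun i => (Sl_gt hx i).le) (fun i => (gt_of_sum hy (by norm_num) hys i).le) τ)
    (fun i h => seg_lt hx.2.1 hxy τ i h hy), seg_le hx.2.1 hy τ, ?_⟩
  have : ∀ i, (v i : ℝ) - seg τ x y i = (1 - τ) * ((v i : ℝ) - x i) + τ * ((v i : ℝ) - y i) := by
    intro i; simp only [seg]; ring
  simp only [this, Finset.sum_add_distrib, ← Finset.mul_sum, hys, hx.2.2]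
  ring

theorem seg_continuous {n : ℕ} :
    Continuous (fun y : ℝ × (Fin n → ℝ) × (Fin n → ℝ) => seg y.1 y.2.1 y.2.2) := by
  unfold seg; fun_prop

/-- Barycentre. -/
noncomputable def bpt {n : ℕ} (v : Fin n → ℤ) (a : Finset (Fin n)) : Fin n → ℝ :=
  fun i => v i - if i ∈ a then 1 / (2 * (a.card : ℝ)) else 0

theorem bpt_le {n : ℕ} (v : Fin n → ℤ) (a : Finset (Fin n)) (i : Fin n) : bpt v a i ≤ v i := by
  simp only [bpt]
  have : 0 ≤ if i ∈ a then 1 / (2 * (a.card : ℝ)) else 0 := by split_ifs <;> positivity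
  linarith

theorem bpt_lt {n : ℕ} (v : Fin n → ℤ) (a : Finset (Fin n)) (i : Fin n) :
    bpt v a i < v i ↔ i ∈ a := by
  simp only [bpt]
  constructor
  · intro h
    by_contra h2
    simp [h2] at h
  · intro h
    have : 0 < a.card := Finset.card_pos.2 ⟨i, h⟩
    simp [h, this]

theorem bpt_sum {n : ℕ} (v : Fin n → ℤ) (a : Finset (Fin n)) (ha : a.Nonempty) :
    ∑ i, ((v i : ℝ) - bpt v a i) = 1 / 2 := by
  have : 0 < a.card := Finset.card_pos.2 ha
  have h2 : (a.card : ℝ) ≠ 0 := by positivity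
  simp only [bpt, sub_sub_cancel, Finset.sum_ite_mem, Finset.univ_inter, Finset.sum_const,
    nsmul_eq_mul]
  field_simp

/-- Lower vertex of a face. -/
def lv {n : ℕ} (v : Fin n → ℤ) (a : Finset (Fin n)) : Fin n → ℤ :=
  fun i => v i - if i ∈ a then 1 else 0

theorem lv_facts {n : ℕ} (v : Fin n → ℤ) (a : Finset (Fin n)) :
    (∀ i, toR (lv v a) i ≤ v i) ∧ (∀ i, (v i : ℝ) - 1 ≤ toR (lv v a) i) ∧
    (∀ i, toR (lv v a) i < v i ↔ i ∈ a) := by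
  refine ⟨fun i => ?_, fun i => ?_, fun i => ?_⟩ <;> by_cases h : i ∈ a <;> simp [toR, lv, h]

theorem lv_mem {n : ℕ} {K : Set (Fin n → ℝ)} (hK : IsComplex K) {v : Fin n → ℤ}
    {a : Finset (Fin n)} (hb : bpt v a ∈ Sl K v) : toR (lv v a) ∈ K := by
  obtain ⟨h1, h2, h3⟩ := lv_facts v a
  exact mem_of_face hK v hb.1 hb.2.1 (Sl_gt hb) h1 h2 (fun i h => (bpt_lt v a i).2 ((h3 i).1 h))

theorem contractible_bpt {n : ℕ} {K : Set (Fin n → ℝ)} (hK : IsComplex K) (w v : Fin n → ℤ)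
    (hmin : ∀ q ∈ K, toR w ≤ q) {a : Finset (Fin n)} (hb : bpt v a ∈ Sl K v)
    (hc : ContractibleSpace ↥(DipathSpace K (toR w) (toR (lv v a)))) :
    ContractibleSpace ↥(DipathSpace K (toR w) (bpt v a)) := by
  obtain ⟨h1, h2, h3⟩ := lv_facts v a
  have hbl : ∀ i, (v i : ℝ) - 1 ≤ bpt v a i := fun i => (Sl_gt hb i).le
  have hto : ∀ (τ : unitInterval) (γ : ↥(DipathSpace K (toR w) (bpt v a))),
      tr (seg τ (toR (lv v a)) (bpt v a)) γ.1 ∈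
        DipathSpace K (toR w) (seg τ (toR (lv v a)) (bpt v a)) := by
    intro τ γ
    refine tr_mem hK w v hmin hb.1 hb.2.1 (Sl_gt hb) γ.2 hb.2.1 hbl (fun i h => h)
      (seg_le h1 hb.2.1 τ) (seg_lower h2 hbl τ) (fun i h => ?_)
    have := seg_lt h1 (fun i h => (h3 i).2 ((bpt_lt v a i).1 h)) τ i h hb.2.1
    exact (bpt_lt v a i).2 ((h3 i).1 this)
  have hback : ∀ (τ : unitInterval) (γ : C(unitInterval, Fin n → ℝ)),
      γ ∈ DipathSpace K (toR w) (seg τ (toR (lv v a)) (bpt v a)) →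
      tr (bpt v a) γ ∈ DipathSpace K (toR w) (bpt v a) := by
    intro τ γ hγ
    refine tr_mem hK w v hmin hb.1 hb.2.1 (Sl_gt hb) hγ (seg_le h1 hb.2.1 τ) (seg_lower h2 hbl τ)
      (fun i h => ?_) hb.2.1 hbl (fun i h => ?_)
    · have := seg_lt h1 (fun i h => (h3 i).2 ((bpt_lt v a i).1 h)) τ i h hb.2.1
      exact (bpt_lt v a i).2 ((h3 i).1 this)
    · exact seg_lt_of τ i ((h3 i).2 ((bpt_lt v a i).1 h)) h
  have hc0 : Continuous (fun y : unitInterval × ↥(DipathSpace K (toR w) (bpt v a)) =>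
      tr (seg y.1 (toR (lv v a)) (bpt v a)) y.2.1) := by
    have hseg : Continuous (fun y : unitInterval × ↥(DipathSpace K (toR w) (bpt v a)) =>
        seg (y.1 : ℝ) (toR (lv v a)) (bpt v a)) :=
      seg_continuous.comp (f := fun y : unitInterval × ↥(DipathSpace K (toR w) (bpt v a)) =>
        ((y.1 : ℝ), toR (lv v a), bpt v a)) (by fun_prop)
    exact tr_continuous.comp (hseg.prodMk (by fun_prop))
  have hf0 : ∀ γ : ↥(DipathSpace K (toR w) (bpt v a)),
      tr (toR (lv v a)) γ.1 ∈ DipathSpace K (toR w) (toR (lv v a)) := fun γ => by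
    have := hto 0 γ
    rwa [Icc.coe_zero, seg_zero] at this
  have hg0 : ∀ γ : ↥(DipathSpace K (toR w) (toR (lv v a))),
      tr (bpt v a) γ.1 ∈ DipathSpace K (toR w) (bpt v a) := fun γ =>
    hback 0 γ.1 (by rw [Icc.coe_zero, seg_zero]; exact γ.2)
  let f : C(↥(DipathSpace K (toR w) (bpt v a)), ↥(DipathSpace K (toR w) (toR (lv v a)))) :=
    ⟨fun γ => ⟨tr (toR (lv v a)) γ.1, hf0 γ⟩,
      ((tr_cont_right _).comp continuous_subtype_val).subtype_mk hf0⟩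
  let g : C(↥(DipathSpace K (toR w) (toR (lv v a))), ↥(DipathSpace K (toR w) (bpt v a))) :=
    ⟨fun γ => ⟨tr (bpt v a) γ.1, hg0 γ⟩,
      ((tr_cont_right _).comp continuous_subtype_val).subtype_mk hg0⟩
  refine contractible_of_dominated f g ⟨⟨⟨fun y => ⟨tr (bpt v a)
    (tr (seg y.1 (toR (lv v a)) (bpt v a)) y.2.1), hback y.1 _ (hto y.1 y.2)⟩,
    ((tr_cont_right _).comp hc0).subtype_mk _⟩, ?_, ?_⟩⟩
  · intro γ
    apply Subtype.ext
    simp only [Icc.coe_zero, seg_zero]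
    rfl
  · intro γ
    apply Subtype.ext
    simp only [Icc.coe_one, seg_one]
    have h1 : tr (bpt v a) γ.1 = γ.1 := by
      have := tr_self γ.1 γ.2.2.2.2
      rwa [γ.2.2.2.1] at this
    rw [h1, h1]
    rfl

/-- Paths ending in the slice. -/
def Es {n : ℕ} (K : Set (Fin n → ℝ)) (w v : Fin n → ℤ) : Set C(unitInterval, Fin n → ℝ) :=
  {γ | γ ∈ DipathSpace K (toR w) (γ 1) ∧ γ 1 ∈ Sl K v}

theorem exists_H {n : ℕ} {K : Set (Fin n → ℝ)} (hK : IsComplex K) (w v : Fin n → ℤ)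
    (hmin : ∀ q ∈ K, toR w ≤ q) {a : Finset (Fin n)} (hb : bpt v a ∈ Sl K v)
    (hc : ContractibleSpace ↥(DipathSpace K (toR w) (toR (lv v a))))
    (V : Set ↥(Es K w v)) (hV : ∀ e, e ∈ V ↔ ∀ i ∈ a, e.1 1 i < (v i : ℝ)) :
    ∃ (H : unitInterval → ↥(Es K w v) → ↥(Es K w v)) (p : ↥(Es K w v)),
      ContinuousOn (fun x : unitInterval × ↥(Es K w v) => H x.1 x.2) (univ ×ˢ V) ∧
      (∀ s e, e ∈ V → H s e ∈ V) ∧ p ∈ V ∧ (∀ e, e ∈ V → H 0 e = e) ∧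
      (∀ e, e ∈ V → H 1 e = p) ∧ (∀ i, p.1 1 i < v i → i ∈ a) ∧
      (∀ s e, e ∈ V → ∀ i, (H s e).1 1 i < v i → e.1 1 i < v i) := by
  have hcb := contractible_bpt hK w v hmin hb hc
  have hcond : ∀ e : ↥(Es K w v), e ∈ V → ∀ i, bpt v a i < v i → e.1 1 i < v i := by
    intro e he i hi
    exact (hV e).1 he i ((bpt_lt v a i).1 hi)
  have hsegS : ∀ (τ : unitInterval) (e : V), seg τ (e.1.1 1) (bpt v a) ∈ Sl K v := fun τ e =>
    seg_mem hK e.1.2.2 hb.2.1 hb.2.2 (hcond e.1 e.2) τ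
  have htr : ∀ (τ : unitInterval) (e : V), tr (seg τ (e.1.1 1) (bpt v a)) e.1.1 ∈
      DipathSpace K (toR w) (seg τ (e.1.1 1) (bpt v a)) := by
    intro τ e
    exact tr_mem hK w v hmin e.1.2.2.1 e.1.2.2.2.1 (Sl_gt e.1.2.2) e.1.2.1 e.1.2.2.2.1
      (fun i => (Sl_gt e.1.2.2 i).le) (fun i h => h) (hsegS τ e).2.1
      (fun i => (Sl_gt (hsegS τ e) i).le)
      (fun i h => seg_lt e.1.2.2.2.1 (hcond e.1 e.2) τ i h hb.2.1)
  have htr1 : ∀ (τ : unitInterval) (e : V), tr (seg τ (e.1.1 1) (bpt v a)) e.1.1 1 =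
      seg τ (e.1.1 1) (bpt v a) := fun τ e => (htr τ e).2.2.1
  have htrE : ∀ (τ : unitInterval) (e : V), tr (seg τ (e.1.1 1) (bpt v a)) e.1.1 ∈ Es K w v := by
    intro τ e
    refine ⟨?_, ?_⟩
    · rw [htr1]; exact htr τ e
    · rw [htr1]; exact hsegS τ e
  have htrV : ∀ (τ : unitInterval) (e : V),
      (⟨tr (seg τ (e.1.1 1) (bpt v a)) e.1.1, htrE τ e⟩ : ↥(Es K w v)) ∈ V := by
    intro τ e
    have he := (hV _).1 e.2
    rw [hV]
    intro i hi
    change tr (seg τ (e.1.1 1) (bpt v a)) e.1.1 1 i < v i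
    rw [htr1]
    exact seg_lt_of τ i (he i hi) ((bpt_lt v a i).2 hi)
  have hPE : ∀ γ : ↥(DipathSpace K (toR w) (bpt v a)), γ.1 ∈ Es K w v := by
    intro γ
    have h1 := γ.2.2.2.1
    refine ⟨?_, ?_⟩
    · rw [h1]; exact γ.2
    · rw [h1]; exact hb
  have hPV : ∀ γ : ↥(DipathSpace K (toR w) (bpt v a)), (⟨γ.1, hPE γ⟩ : ↥(Es K w v)) ∈ V := by
    intro γ
    have h1 := γ.2.2.2.1
    rw [hV]
    intro i hi
    change γ.1 1 i < v i
    rw [h1]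
    exact (bpt_lt v a i).2 hi
  have hcseg : Continuous (fun y : unitInterval × V => tr (seg y.1 (y.2.1.1 1) (bpt v a)) y.2.1.1) := by
    have hseg : Continuous (fun y : unitInterval × V => seg (y.1 : ℝ) (y.2.1.1 1) (bpt v a)) :=
      seg_continuous.comp (f := fun y : unitInterval × V => ((y.1 : ℝ), y.2.1.1 1, bpt v a))
        (by fun_prop)
    exact tr_continuous.comp (hseg.prodMk (by fun_prop))
  let inc : C(↥(DipathSpace K (toR w) (bpt v a)), V) :=
    ⟨fun γ => ⟨⟨γ.1, hPE γ⟩, hPV γ⟩, by fun_prop⟩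
  have hT0 : ∀ e : V, tr (bpt v a) e.1.1 ∈ DipathSpace K (toR w) (bpt v a) := fun e => by
    have := htr 1 e
    rwa [Icc.coe_one, seg_one] at this
  let T : C(V, ↥(DipathSpace K (toR w) (bpt v a))) :=
    ⟨fun e => ⟨tr (bpt v a) e.1.1, hT0 e⟩,
      ((tr_cont_right _).comp
        (continuous_subtype_val.comp continuous_subtype_val)).subtype_mk hT0⟩
  obtain ⟨p, ⟨hp⟩⟩ := id_nullhomotopic ↥(DipathSpace K (toR w) (bpt v a))
  let h1 : ContinuousMap.Homotopy (ContinuousMap.id V) (inc.comp T) :=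
    ⟨⟨fun y => ⟨⟨tr (seg y.1 (y.2.1.1 1) (bpt v a)) y.2.1.1, htrE y.1 y.2⟩, htrV y.1 y.2⟩,
      (hcseg.subtype_mk _).subtype_mk _⟩, by
        intro e
        apply Subtype.ext
        apply Subtype.ext
        simp only [Icc.coe_zero, seg_zero]
        exact tr_self e.1.1 e.1.2.1.2.2.2, by
        intro e
        apply Subtype.ext
        apply Subtype.ext
        simp only [Icc.coe_one, seg_one]
        rfl⟩
  let h2 : ContinuousMap.Homotopy (inc.comp T) (ContinuousMap.const V (inc p)) :=
    ⟨⟨fun y => inc (hp (y.1, T y.2)), by fun_prop⟩, by intro e; simp, by intro e; simp⟩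
  obtain ⟨H, hHc, hH⟩ := exists_total V (inc p) (h1.trans h2)
  refine ⟨H, (inc p).1, hHc, ?_, (inc p).2, ?_, ?_, ?_, ?_⟩
  · intro s e he
    have := hH s ⟨e, he⟩
    simp only at this
    rw [this]
    exact Subtype.property _
  · intro e he
    have := hH 0 ⟨e, he⟩
    simp only at this
    rw [this]
    simp
  · intro e he
    have := hH 1 ⟨e, he⟩
    simp only at this
    rw [this]
    simp
  · intro i hi
    change p.1 1 i < v i at hi
    rw [p.2.2.2.1] at hi
    exact (bpt_lt v a i).1 hi
  · intro s e he i hi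
    have := hH s ⟨e, he⟩
    simp only at this
    rw [this, ContinuousMap.Homotopy.trans_apply] at hi
    split_ifs at hi with hs
    · have hi2 : seg (2 * (s : ℝ)) (e.1 1) (bpt v a) i < v i := by
        have h3 := htr1 ⟨2 * s, (unitInterval.mul_pos_mem_iff zero_lt_two).2 ⟨s.2.1, hs⟩⟩ ⟨e, he⟩
        simp only at h3
        rw [← h3]
        exact hi
      exact seg_lt e.2.2.2.1 (hcond e he) _ i hi2 hb.2.1
    · have hi2 : bpt v a i < v i := by
        have h3 := (hp (⟨2 * s - 1, unitInterval.two_mul_sub_one_mem_iff.2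
          ⟨(not_le.1 hs).le, s.2.2⟩⟩, T ⟨e, he⟩)).2.2.2.1
        rw [← h3]
        exact hi
      exact hcond e he i hi2

/-- Rescaled coordinate function on the slice. -/
def yy {n : ℕ} (v : Fin n → ℤ) (x : Fin n → ℝ) (i : Fin n) : ℝ :=
  2 * n * (n + 1) * ((v i : ℝ) - x i)

theorem yy_cont {n : ℕ} (v : Fin n → ℤ) (i : Fin n) : Continuous (fun x => yy v x i) := by
  unfold yy; fun_prop

theorem exists_gap {n : ℕ} (hn : 0 < n) {K : Set (Fin n → ℝ)} (hK : IsComplex K) (v : Fin n → ℤ)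
    {x : Fin n → ℝ} (hx : x ∈ Sl K v) : ∃ a : Finset (Fin n), bpt v a ∈ Sl K v ∧
      (∀ i ∈ a, 1 ≤ yy v x i) ∧ ∀ i ∈ a, ∀ k ∉ a, 1 ≤ yy v x i - yy v x k := by
  classical
  have hnn : (0 : ℝ) < n := by exact_mod_cast hn
  have hy0 : ∀ i, 0 ≤ yy v x i := fun i => by
    have := sub_nonneg.2 (hx.2.1 i)
    unfold yy; positivity
  have hsum : ∑ i, yy v x i = n * (n + 1) := by
    unfold yy
    rw [← Finset.mul_sum, hx.2.2]; ring
  obtain ⟨m, hm, hm2⟩ : ∃ m ∈ Finset.range (n + 1),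
      m ∉ Finset.univ.image (fun i => ⌊yy v x i⌋₊) := by
    by_contra! h
    have h1 := Finset.card_le_card (show Finset.range (n + 1) ⊆ _ from h)
    have h2 := Finset.card_image_le (s := (Finset.univ : Finset (Fin n)))
      (f := fun i => ⌊yy v x i⌋₊)
    simp at h1 h2
    omega
  have hmn : (m : ℝ) ≤ n := by
    have := Finset.mem_range.1 hm
    exact_mod_cast Nat.lt_succ_iff.1 this
  have hsplit : ∀ i, ¬ ((m : ℝ) + 1 ≤ yy v x i) → yy v x i < m := by
    intro i hi
    by_contra! h
    apply hm2
    rw [Finset.mem_image]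
    refine ⟨i, Finset.mem_univ i, ?_⟩
    rw [Nat.floor_eq_iff (hy0 i)]
    exact ⟨h, not_le.1 hi⟩
  have hm0 : (0 : ℝ) ≤ m := Nat.cast_nonneg m
  have hmem : ∀ i, i ∈ Finset.univ.filter (fun i => (m : ℝ) + 1 ≤ yy v x i) ↔
      (m : ℝ) + 1 ≤ yy v x i := by simp
  set a := Finset.univ.filter (fun i => (m : ℝ) + 1 ≤ yy v x i)
  have hane : a.Nonempty := by
    by_contra h
    rw [Finset.not_nonempty_iff_eq_empty] at h
    have h1 : ∑ i, yy v x i ≤ ∑ _i : Fin n, (n : ℝ) := by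
      refine Finset.sum_le_sum fun i _ => ?_
      have : ¬ ((m : ℝ) + 1 ≤ yy v x i) := by
        rw [← hmem, h]; simp
      linarith [hsplit i this]
    rw [hsum] at h1
    simp at h1
    nlinarith
  refine ⟨a, ⟨?_, bpt_le v a, bpt_sum v a hane⟩, ?_, ?_⟩
  · refine mem_of_face hK v hx.1 hx.2.1 (Sl_gt hx) (bpt_le v a)
      (fun i => (gt_of_sum (bpt_le v a) (by norm_num) (bpt_sum v a hane) i).le) ?_
    intro i hi
    have h1 := (hmem i).1 ((bpt_lt v a i).1 hi)
    rcases (hx.2.1 i).lt_or_eq with h | h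
    · exact h
    · unfold yy at h1
      rw [h, sub_self, mul_zero] at h1
      linarith
  · intro i hi
    linarith [(hmem i).1 hi]
  · intro i hi k hk
    rw [hmem] at hi hk
    linarith [hsplit k hk]

theorem exists_r {n : ℕ} (hn : 0 < n) {K : Set (Fin n → ℝ)} (hK : IsComplex K)
    (w v : Fin n → ℤ) (hmin : ∀ q ∈ K, toR w ≤ q)
    (hc : ∀ a : Finset (Fin n), bpt v a ∈ Sl K v →
      ContractibleSpace ↥(DipathSpace K (toR w) (toR (lv v a)))) [Nonempty ↥(Es K w v)]
    (π : C(↥(Es K w v), ↥(Sl K v))) (hπ : ∀ e, (π e).1 = e.1 1) :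
    ∃ r : C(↥(Sl K v), ↥(Es K w v)), (r.comp π).Homotopic (ContinuousMap.id _) ∧
      ∀ z : ↥(Sl K v), ∀ i, (r z).1 1 i < v i → z.1 i < v i := by
  classical
  let ι := {a : Finset (Fin n) // bpt v a ∈ Sl K v}
  let V : ι → Set ↥(Es K w v) := fun a => {e | ∀ i ∈ a.1, e.1 1 i < (v i : ℝ)}
  choose H p hHc hHV hpV hH0 hH1 hpa hHa using fun a : ι =>
    exists_H hK w v hmin a.2 (hc a.1 a.2) (V a) (fun e => Iff.rfl)
  let C : ι → Set ↥(Sl K v) := fun a => {z | (∀ i ∈ a.1, 1 ≤ 2 * yy v z.1 i) ∧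
    ∀ i ∈ a.1, ∀ k ∉ a.1, 1 ≤ 2 * (yy v z.1 i - yy v z.1 k)}
  have hyc : ∀ i, Continuous (fun z : ↥(Sl K v) => yy v z.1 i) := fun i =>
    (yy_cont v i).comp continuous_subtype_val
  have hlt : ∀ a z, z ∈ C a → ∀ i ∈ a.1, z.1 i < v i := by
    intro a z hz i hi
    have h1 := hz.1 i hi
    rcases (z.2.2.1 i).lt_or_eq with h | h
    · exact h
    · unfold yy at h1
      rw [h, sub_self, mul_zero] at h1
      linarith
  let P : ℝ → unitInterval := projIcc 0 1 zero_le_one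
  have hPc : Continuous P := continuous_projIcc
  have hP0 : ∀ y, P y ≠ 0 → 0 ≤ y := by
    intro y h
    by_contra! h2
    exact h (projIcc_of_le_left _ h2.le)
  have hP1 : ∀ y, 1 ≤ y → P y = 1 := fun y h => projIcc_of_right_le _ h
  let s : ι → ↥(Sl K v) → unitInterval := fun a z =>
    (∏ i ∈ a.1, P (2 * yy v z.1 i - 1)) *
      ∏ i ∈ a.1, ∏ k ∈ a.1ᶜ, P (2 * (yy v z.1 i - yy v z.1 k) - 1)
  refine glue π H p V C ?_ hHc hHV hpV hH0 hH1 ?_ s ?_ ?_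
    ((Finset.univ : Finset ι).toList.insertionSort (fun a b => b.1.card ≤ a.1.card)) ?_ ?_
    (fun z e => ∀ i, e.1 1 i < v i → z.1 i < v i) ?_ ?_
  · intro a
    have : C a = (⋂ i ∈ a.1, {z | 1 ≤ 2 * yy v z.1 i}) ∩
        ⋂ i ∈ a.1, ⋂ k ∈ a.1ᶜ, {z | 1 ≤ 2 * (yy v z.1 i - yy v z.1 k)} := by
      ext z; simp [C]
    rw [this]
    refine IsClosed.inter ?_ ?_
    · refine isClosed_biInter fun i _ => isClosed_le continuous_const ?_
      exact continuous_const.mul (hyc i)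
    · refine isClosed_biInter fun i _ => isClosed_biInter fun k _ =>
        isClosed_le continuous_const ?_
      exact continuous_const.mul ((hyc i).sub (hyc k))
  · intro a e he i hi
    have := hlt a _ he i hi
    rwa [hπ] at this
  · intro a
    refine Continuous.mul ?_ ?_
    · refine continuous_finset_prod _ fun i _ => hPc.comp ?_
      exact (continuous_const.mul (hyc i)).sub continuous_const
    · refine continuous_finset_prod _ fun i _ => continuous_finset_prod _ fun k _ => hPc.comp ?_
      exact (continuous_const.mul ((hyc i).sub (hyc k))).sub continuous_const
  · intro a z h
    refine ⟨fun i hi => ?_, fun i hi k hk => ?_⟩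
    · have : P (2 * yy v z.1 i - 1) ≠ 0 := by
        intro h0
        apply h
        simp only [s]
        rw [Finset.prod_eq_zero hi h0, zero_mul]
      linarith [hP0 _ this]
    · have : P (2 * (yy v z.1 i - yy v z.1 k) - 1) ≠ 0 := by
        intro h0
        apply h
        simp only [s]
        refine mul_eq_zero_of_right _ (Finset.prod_eq_zero hi ?_)
        exact Finset.prod_eq_zero (Finset.mem_compl.2 hk) h0
      linarith [hP0 _ this]
  · haveI : Std.Total (fun a b : ι => b.1.card ≤ a.1.card) := ⟨fun a b => le_total _ _⟩
    haveI : IsTrans ι (fun a b : ι => b.1.card ≤ a.1.card) := ⟨fun a b c h1 h2 => h2.trans h1⟩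
    refine (List.pairwise_insertionSort (fun a b : ι => b.1.card ≤ a.1.card) _).imp ?_
    rintro a b hab ⟨z, hza, hzb⟩
    have hsub : b.1 ⊆ a.1 := by
      intro i hi
      by_contra hia
      obtain ⟨k, hk, hkb⟩ : ∃ k ∈ a.1, k ∉ b.1 := by
        by_contra! hcon
        have : a.1 = b.1 := Finset.eq_of_subset_of_card_le hcon hab
        exact hia (this ▸ hi)
      linarith [hza.2 k hk i hia, hzb.2 i hi k hkb]
    intro e he i hi
    exact he i (hsub hi)
  · intro z
    obtain ⟨a, ha, h1, h2⟩ := exists_gap hn hK v z.2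
    refine ⟨⟨a, ha⟩, by simp, ?_⟩
    simp only [s]
    rw [Finset.prod_eq_one, Finset.prod_eq_one, mul_one]
    · intro i hi
      refine Finset.prod_eq_one fun k hk => hP1 _ ?_
      linarith [h2 i hi k (Finset.mem_compl.1 hk)]
    · intro i hi
      exact hP1 _ (by linarith [h1 i hi])
  · intro a z hz i hi
    exact hlt a z hz i (hpa a i hi)
  · intro a z t e hz he hQ i hi
    exact hQ i (hHa a t e he i hi)

theorem lip_aux {n : ℕ} (v : Fin n → ℤ) (γ γ' : C(unitInterval, Fin n → ℝ)) (hm' : Monotone γ')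
    {t t' : unitInterval} (htt : t ≤ t') {c c' : ℝ} (hc : ∑ i, ((v i : ℝ) - γ t i) = c)
    (hc' : ∑ i, ((v i : ℝ) - γ' t' i) = c') :
    dist (γ t) (γ' t') ≤ (n + 1) * dist γ γ' + |c - c'| := by
  have hη : 0 ≤ dist γ γ' := dist_nonneg
  have h1 : ∀ i, 0 ≤ γ' t' i - γ t i + dist γ γ' := by
    intro i
    have h2 := hm' htt i
    have h3 := (dist_le_pi_dist (γ t) (γ' t) i).trans (ContinuousMap.dist_apply_le_dist t)
    rw [Real.dist_eq] at h3
    linarith [le_abs_self (γ t i - γ' t i)]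
  have h2 : ∑ i, (γ' t' i - γ t i + dist γ γ') = c - c' + n * dist γ γ' := by
    rw [← hc, ← hc', ← Finset.sum_sub_distrib, Finset.sum_add_distrib]
    simp
  have hn0 : (0 : ℝ) ≤ n := Nat.cast_nonneg n
  rw [dist_pi_le_iff (by positivity)]
  intro i
  have h3 := Finset.single_le_sum (f := fun i => γ' t' i - γ t i + dist γ γ')
    (fun i _ => h1 i) (Finset.mem_univ i)
  simp only [h2] at h3
  have h4 := h1 i
  have h5 := le_abs_self (c - c')
  have h6 := abs_nonneg (c - c')
  have h7 := mul_nonneg hn0 hη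
  rw [Real.dist_eq, abs_le]
  constructor <;> linarith

theorem lip {n : ℕ} (v : Fin n → ℤ) (γ γ' : C(unitInterval, Fin n → ℝ)) (hm : Monotone γ)
    (hm' : Monotone γ')
    {t t' : unitInterval} {c c' : ℝ} (hc : ∑ i, ((v i : ℝ) - γ t i) = c)
    (hc' : ∑ i, ((v i : ℝ) - γ' t' i) = c') :
    dist (γ t) (γ' t') ≤ (n + 1) * dist γ γ' + |c - c'| := by
  rcases le_total t t' with h | h
  · exact lip_aux v γ γ' hm' h hc hc'
  · rw [dist_comm (γ t), dist_comm γ, abs_sub_comm]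
    exact lip_aux v γ' γ hm h hc' hc

theorem slice_unique {n : ℕ} (v : Fin n → ℤ) (γ : C(unitInterval, Fin n → ℝ)) (hm : Monotone γ)
    {t t' : unitInterval} (h : ∑ i, ((v i : ℝ) - γ t i) = ∑ i, ((v i : ℝ) - γ t' i)) :
    γ t = γ t' := by
  have := lip (t' := t') v γ γ hm hm h rfl
  simp only [dist_self, mul_zero, sub_self, abs_zero, add_zero] at this
  exact dist_le_zero.1 this

theorem exists_sl {n : ℕ} {K : Set (Fin n → ℝ)} (w v : Fin n → ℤ)
    (hwv : 1 ≤ ∑ i, ((v i : ℝ) - w i)) :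
    ∃ sl : unitInterval × ↥(DipathSpace K (toR w) (toR v)) → (Fin n → ℝ), Continuous sl ∧
      (∀ y, ∃ t, sl y = y.2.1 t) ∧ ∀ y, ∑ i, ((v i : ℝ) - sl y i) = y.1 / 2 := by
  have hex : ∀ y : unitInterval × ↥(DipathSpace K (toR w) (toR v)),
      ∃ t, ∑ i, ((v i : ℝ) - y.2.1 t i) = y.1 / 2 := by
    intro y
    have hcont : Continuous (fun t => ∑ i, ((v i : ℝ) - y.2.1 t i)) := by fun_prop
    have h0 := y.1.2.1
    have h1 := y.1.2.2
    refine mem_range_of_exists_le_of_exists_ge hcont ⟨1, ?_⟩ ⟨0, ?_⟩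
    · simp only [y.2.2.2.2.1, toR, sub_self, Finset.sum_const_zero]
      linarith
    · simp only [y.2.2.2.1, toR]
      linarith
  choose t ht using hex
  refine ⟨fun y => y.2.1 (t y), ?_, fun y => ⟨t y, rfl⟩, ht⟩
  have : LipschitzWith (n + 2) (fun y : unitInterval × ↥(DipathSpace K (toR w) (toR v)) =>
      y.2.1 (t y)) := by
    refine LipschitzWith.of_dist_le_mul fun y y' => ?_
    have h := lip v y.2.1 y'.2.1 y.2.2.2.2.2 y'.2.2.2.2.2 (ht y) (ht y')
    have h1 : dist y.2.1 y'.2.1 ≤ dist y y' := by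
      rw [Prod.dist_eq]; exact le_max_right _ _
    have h2 : |(y.1 : ℝ) - y'.1| ≤ dist y y' := by
      rw [Prod.dist_eq]; exact le_max_left _ _
    have h3 : |(y.1 : ℝ) / 2 - y'.1 / 2| ≤ dist y y' := by
      rw [← sub_div, abs_div, abs_two]
      linarith [abs_nonneg ((y.1 : ℝ) - y'.1)]
    have hn0 : (0 : ℝ) ≤ n + 1 := by positivity
    push_cast
    linarith [mul_le_mul_of_nonneg_left h1 hn0]
  exact this.continuous

/-- Truncation of a path. -/
def cut {n : ℕ} (γ : C(unitInterval, Fin n → ℝ)) (x : Fin n → ℝ) : C(unitInterval, Fin n → ℝ) :=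
  ⟨fun t i => min (γ t i) (x i), by fun_prop⟩

theorem cut_continuous {n : ℕ} :
    Continuous (fun y : C(unitInterval, Fin n → ℝ) × (Fin n → ℝ) => cut y.1 y.2) := by
  apply ContinuousMap.continuous_of_continuous_uncurry
  refine continuous_pi fun i => ?_
  change Continuous (fun y : (C(unitInterval, Fin n → ℝ) × (Fin n → ℝ)) × unitInterval =>
    min (y.1.1 y.2 i) (y.1.2 i))
  fun_prop

theorem cut_mem {n : ℕ} {K : Set (Fin n → ℝ)} {p q : Fin n → ℝ} {γ : C(unitInterval, Fin n → ℝ)}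
    (hγ : γ ∈ DipathSpace K p q) (t0 : unitInterval) :
    cut γ (γ t0) ∈ DipathSpace K p (γ t0) := by
  obtain ⟨h1, h2, h3, hm⟩ := hγ
  have hcut : ∀ t, cut γ (γ t0) t = γ (min t t0) := by
    intro t
    ext i
    change min (γ t i) (γ t0 i) = _
    rcases le_total t t0 with h | h
    · rw [min_eq_left h, min_eq_left (hm h i)]
    · rw [min_eq_right h, min_eq_right (hm h i)]
  refine ⟨fun t => ?_, ?_, ?_, ?_⟩
  · rw [hcut]; exact h1 _
  · rw [hcut, min_eq_left (show (0 : unitInterval) ≤ t0 from t0.2.1)]; exact h2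
  · rw [hcut, min_eq_right (show t0 ≤ (1 : unitInterval) from t0.2.2)]
  · intro t t' h
    rw [hcut, hcut]
    exact hm (min_le_min_right _ h)

theorem tr_hit {n : ℕ} (x : Fin n → ℝ) (γ : C(unitInterval, Fin n → ℝ)) (h : ∀ i, γ 1 i ≤ x i) :
    ∃ t, tr x γ t = γ 1 := by
  have hd : 0 ≤ dist (γ 1) x := dist_nonneg
  refine ⟨⟨1 / (1 + dist (γ 1) x), by positivity, ?_⟩, ?_⟩
  · rw [div_le_one (by positivity)]; linarith
  · ext i
    rw [tr_apply]
    have : (1 + dist (γ 1) x) * (1 / (1 + dist (γ 1) x)) = 1 := by field_simp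
    simp only [this]
    rw [projIcc_of_right_le _ le_rfl]
    simp only [sub_self, max_self, add_zero]
    exact min_eq_right (h i)

theorem core {n : ℕ} (hn : 0 < n) {K : Set (Fin n → ℝ)} (hK : IsComplex K)
    (w v : Fin n → ℤ) (hmin : ∀ q ∈ K, toR w ≤ q) (hwv : 1 ≤ ∑ i, ((v i : ℝ) - w i))
    (hc : ∀ a : Finset (Fin n), bpt v a ∈ Sl K v →
      ContractibleSpace ↥(DipathSpace K (toR w) (toR (lv v a)))) :
    ContractibleSpace ↥(DipathSpace K (toR w) (toR v)) ↔ ContractibleSpace ↥(Sl K v) := by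
  obtain ⟨sl, hslc, hslt, hsls⟩ := exists_sl (K := K) w v hwv
  have hsl_le : ∀ y i, sl y i ≤ v i := by
    intro y i
    obtain ⟨t, ht⟩ := hslt y
    rw [ht]
    have h := y.2.2.2.2.2 (show t ≤ 1 from t.2.2) i
    rwa [y.2.2.2.2.1] at h
  have hsl_K : ∀ y, sl y ∈ K := by
    intro y
    obtain ⟨t, ht⟩ := hslt y
    rw [ht]
    exact y.2.2.1 t
  have hsl_gt : ∀ y i, (v i : ℝ) - 1 < sl y i := fun y i =>
    gt_of_sum (hsl_le y) (by linarith [y.1.2.2]) (hsls y) i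
  have hcutm : ∀ y, cut y.2.1 (sl y) ∈ DipathSpace K (toR w) (sl y) := by
    intro y
    obtain ⟨t, ht⟩ := hslt y
    rw [ht]
    exact cut_mem y.2.2 t
  have htrv : ∀ {x : Fin n → ℝ} {γ : C(unitInterval, Fin n → ℝ)}, x ∈ K → (∀ i, x i ≤ v i) →
      (∀ i, (v i : ℝ) - 1 < x i) → γ ∈ DipathSpace K (toR w) x →
      tr (toR v) γ ∈ DipathSpace K (toR w) (toR v) := by
    intro x γ hxK hxv hx1 hγ
    exact tr_mem hK w v hmin hxK hxv hx1 hγ hxv (fun i => (hx1 i).le) (fun i h => h)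
      (fun i => le_rfl) (fun i => by simp only [toR]; linarith)
      (fun i h => absurd h (lt_irrefl _))
  have hSl1 : ∀ γ, sl (1, γ) ∈ Sl K v := fun γ =>
    ⟨hsl_K _, hsl_le _, by rw [hsls]; simp⟩
  have hβ : ∀ γ : ↥(DipathSpace K (toR w) (toR v)), cut γ.1 (sl (1, γ)) ∈ Es K w v := by
    intro γ
    have h := hcutm (1, γ)
    refine ⟨?_, ?_⟩
    · have h1 := h.2.2.1
      simp only at h1
      rw [h1]; exact h
    · have h1 := h.2.2.1
      simp only at h1
      rw [h1]; exact hSl1 γ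
  have hcc : Continuous (fun y : unitInterval × ↥(DipathSpace K (toR w) (toR v)) =>
      cut y.2.1 (sl y)) :=
    cut_continuous.comp (Continuous.prodMk (by fun_prop) hslc)
  have hcβ : Continuous (fun γ : ↥(DipathSpace K (toR w) (toR v)) => cut γ.1 (sl (1, γ))) :=
    hcc.comp (f := fun γ => ((1 : unitInterval), γ)) (by fun_prop)
  let β : C(↥(DipathSpace K (toR w) (toR v)), ↥(Es K w v)) :=
    ⟨fun γ => ⟨cut γ.1 (sl (1, γ)), hβ γ⟩, hcβ.subtype_mk hβ⟩
  have hα : ∀ e : ↥(Es K w v), tr (toR v) e.1 ∈ DipathSpace K (toR w) (toR v) := fun e =>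
    htrv e.2.2.1 e.2.2.2.1 (Sl_gt e.2.2) e.2.1
  let α : C(↥(Es K w v), ↥(DipathSpace K (toR w) (toR v))) :=
    ⟨fun e => ⟨tr (toR v) e.1, hα e⟩,
      ((tr_cont_right _).comp continuous_subtype_val).subtype_mk hα⟩
  let π : C(↥(Es K w v), ↥(Sl K v)) := ⟨fun e => ⟨e.1 1, e.2.2⟩, by fun_prop⟩
  have hπβ : ∀ γ, (π (β γ)).1 = sl (1, γ) := fun γ => (hcutm (1, γ)).2.2.1
  have hαβ : (α.comp β).Homotopic (ContinuousMap.id _) := by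
    have hm : ∀ y : unitInterval × ↥(DipathSpace K (toR w) (toR v)),
        tr (toR v) (cut y.2.1 (sl y)) ∈ DipathSpace K (toR w) (toR v) := fun y =>
      htrv (hsl_K y) (hsl_le y) (hsl_gt y) (hcutm y)
    refine ContinuousMap.Homotopic.symm ⟨⟨⟨fun y => ⟨tr (toR v) (cut y.2.1 (sl y)), hm y⟩,
      ((tr_cont_right _).comp hcc).subtype_mk hm⟩, ?_, ?_⟩⟩
    · intro γ
      apply Subtype.ext
      change tr (toR v) (cut γ.1 (sl (0, γ))) = γ.1
      have h0 : sl (0, γ) = toR v := by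
        obtain ⟨t, ht⟩ := hslt (0, γ)
        rw [ht]
        refine Eq.trans ?_ γ.2.2.2.1
        apply slice_unique v γ.1 γ.2.2.2.2
        rw [γ.2.2.2.1]
        have := hsls (0, γ)
        rw [ht] at this
        simpa [toR] using this
      have h1 : cut γ.1 (toR v) = γ.1 := by
        ext t i
        have h := γ.2.2.2.2 (show t ≤ 1 from t.2.2) i
        rw [γ.2.2.2.1] at h
        exact min_eq_left h
      rw [h0, h1]
      have := tr_self γ.1 γ.2.2.2.2
      rwa [γ.2.2.2.1] at this
    · intro γ
      rfl
  constructor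
  · intro hX
    obtain ⟨γ0⟩ : Nonempty ↥(DipathSpace K (toR w) (toR v)) := inferInstance
    haveI : Nonempty ↥(Es K w v) := ⟨β γ0⟩
    obtain ⟨r, -, hQ⟩ := exists_r hn hK w v hmin hc π (fun e => rfl)
    refine contractible_of_dominated (α.comp r) (π.comp β) ?_
    have hval : ∀ z, (π (β (α (r z)))).1 = (r z).1 1 := by
      intro z
      rw [hπβ]
      obtain ⟨t', ht'⟩ := tr_hit (toR v) (r z).1 (r z).2.2.2.1
      obtain ⟨t, ht⟩ := hslt (1, α (r z))
      rw [ht, ← ht']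
      change (α (r z)).1 t = (α (r z)).1 t'
      apply slice_unique v _ (α (r z)).2.2.2.2
      have h1 := hsls (1, α (r z))
      rw [ht] at h1
      simp only at h1
      rw [h1]
      change _ = ∑ i, ((v i : ℝ) - tr (toR v) (r z).1 t' i)
      rw [ht', (r z).2.2.2.2]
      simp
    have hm : ∀ y : unitInterval × ↥(Sl K v), seg y.1 y.2.1 ((r y.2).1 1) ∈ Sl K v := fun y =>
      seg_mem hK y.2.2 (r y.2).2.2.2.1 (r y.2).2.2.2.2 (hQ y.2) y.1
    have hcont : Continuous (fun y : unitInterval × ↥(Sl K v) =>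
        seg (y.1 : ℝ) y.2.1 ((r y.2).1 1)) :=
      seg_continuous.comp (f := fun y : unitInterval × ↥(Sl K v) =>
        ((y.1 : ℝ), y.2.1, (r y.2).1 1)) (by fun_prop)
    refine ContinuousMap.Homotopic.symm ⟨⟨⟨fun y => ⟨_, hm y⟩, hcont.subtype_mk hm⟩, ?_, ?_⟩⟩
    · intro z
      apply Subtype.ext
      simp only [Icc.coe_zero, seg_zero]
      rfl
    · intro z
      apply Subtype.ext
      simp only [Icc.coe_one, seg_one]
      exact (hval z).symm
  · intro hS
    obtain ⟨z0⟩ : Nonempty ↥(Sl K v) := inferInstance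
    obtain ⟨a, ha, -, -⟩ := exists_gap hn hK v z0.2
    have hcb := contractible_bpt hK w v hmin ha (hc a ha)
    obtain ⟨γ0⟩ : Nonempty ↥(DipathSpace K (toR w) (bpt v a)) := inferInstance
    haveI : Nonempty ↥(Es K w v) := by
      refine ⟨⟨γ0.1, ?_, ?_⟩⟩
      · rw [γ0.2.2.2.1]; exact γ0.2
      · rw [γ0.2.2.2.1]; exact ha
    obtain ⟨r, hr, -⟩ := exists_r hn hK w v hmin hc π (fun e => rfl)
    refine contractible_of_dominated (π.comp β) (α.comp r) ?_
    have h2 := (ContinuousMap.Homotopic.refl α).comp (hr.comp (ContinuousMap.Homotopic.refl β))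
    exact h2.trans hαβ

theorem Sl_iff_geomReal {n : ℕ} {K : Set (Fin n → ℝ)} (hK : IsComplex K) (v : Fin n → ℤ)
    (x : Fin n → ℝ) : x ∈ Sl K v ↔ (fun i => 2 * x i - (v i : ℝ)) ∈ geomReal K v := by
  classical
  simp only [geomReal, mem_iUnion, exists_prop]
  constructor
  · intro hx
    refine ⟨fun i => if x i < v i then 1 else 0, ⟨?_, ?_, ?_⟩, ?_⟩
    · intro i
      by_cases h : x i < v i <;> simp [h]
    · intro h0
      have h1 : ∀ i, (v i : ℝ) - x i = 0 := by
        intro i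
        have h2 := congrFun h0 i
        by_contra h3
        have h4 : x i < v i := lt_of_le_of_ne (hx.2.1 i) (fun h => h3 (by rw [h, sub_self]))
        simp [h4] at h2
      have h2 := hx.2.2
      simp [h1] at h2
    · intro y hy
      refine mem_of_face hK v hx.1 hx.2.1 (Sl_gt hx) (fun i => hy.2 i) (fun i => ?_) (fun i h => ?_)
      · have := hy.1 i
        by_cases h : x i < v i <;> simp [toR, h] at this <;> linarith
      · by_contra h2
        have := hy.1 i
        simp [toR, h2] at this
        linarith
    · have hsum : ∑ i ∈ Finset.univ.filter (fun i => x i < v i), 2 * ((v i : ℝ) - x i) = 1 := by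
        rw [Finset.sum_filter_of_ne, ← Finset.mul_sum, hx.2.2]
        · norm_num
        · intro i _ h
          exact lt_of_le_of_ne (hx.2.1 i) (fun h2 => h (by rw [h2]; ring))
      have key := (convex_convexHull ℝ ((fun i => toR v - Pi.single i (1 : ℝ)) ''
        {i | (if x i < v i then (1 : ℤ) else 0) = 1})).sum_mem
        (t := Finset.univ.filter (fun i => x i < v i)) (w := fun i => 2 * ((v i : ℝ) - x i))
        (z := fun i => toR v - Pi.single i (1 : ℝ))
        (fun i _ => by linarith [hx.2.1 i]) hsum (fun i hi => by
          apply subset_convexHull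
          refine ⟨i, ?_, rfl⟩
          have := (Finset.mem_filter.1 hi).2
          simp [this])
      convert key using 1
      simp only [smul_sub, Finset.sum_sub_distrib, ← Finset.sum_smul, hsum, one_smul]
      rw [Finset.sum_filter_of_ne]
      · ext k
        simp only [Pi.sub_apply, Finset.sum_apply, Pi.smul_apply, smul_eq_mul, toR, Pi.single_apply]
        simp
        ring
      · intro i _ h
        exact lt_of_le_of_ne (hx.2.1 i) (fun h2 => h (by rw [h2]; simp))
  · rintro ⟨j, ⟨hj, hj0, hjK⟩, hy⟩
    have hD : convexHull ℝ ((fun i => toR v - Pi.single i (1 : ℝ)) '' {i | j i = 1}) ⊆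
        {y : Fin n → ℝ | (∀ i, y i ≤ v i) ∧ ∑ i, ((v i : ℝ) - y i) = 1 ∧ ∀ i, j i = 0 → y i = v i} := by
      refine convexHull_min ?_ ?_
      · rintro _ ⟨i, hi, rfl⟩
        refine ⟨fun k => ?_, ?_, fun k hk => ?_⟩
        · simp only [Pi.sub_apply, toR, Pi.single_apply]
          split_ifs <;> linarith
        · simp [toR, Pi.single_apply]
        · have : k ≠ i := by
            rintro rfl
            rw [mem_setOf_eq, hk] at hi
            exact absurd hi (by norm_num)
          simp [toR, this]
      · intro y hy z hz a b ha hb hab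
        refine ⟨fun i => ?_, ?_, fun i hi => ?_⟩
        · simp only [Pi.add_apply, Pi.smul_apply, smul_eq_mul]
          calc a * y i + b * z i ≤ a * v i + b * v i :=
                add_le_add (mul_le_mul_of_nonneg_left (hy.1 i) ha)
                  (mul_le_mul_of_nonneg_left (hz.1 i) hb)
            _ = v i := by rw [← add_mul, hab, one_mul]
        · have : ∀ i, (v i : ℝ) - (a • y + b • z) i = a * (v i - y i) + b * (v i - z i) := by
            intro i
            simp only [Pi.add_apply, Pi.smul_apply, smul_eq_mul]
            linear_combination (-(v i : ℝ)) * hab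
          simp only [this]
          rw [Finset.sum_add_distrib, ← Finset.mul_sum, ← Finset.mul_sum, hy.2.1, hz.2.1]
          linarith
        · simp only [Pi.add_apply, Pi.smul_apply, smul_eq_mul, hy.2.2 i hi, hz.2.2 i hi]
          rw [← add_mul, hab, one_mul]
    obtain ⟨h1, h2, h3⟩ := hD hy
    simp only at h1 h2 h3
    have hle : ∀ i, x i ≤ v i := fun i => by linarith [h1 i]
    have hs : ∑ i, ((v i : ℝ) - x i) = 1 / 2 := by
      have : ∀ i, (v i : ℝ) - (2 * x i - v i) = 2 * (v i - x i) := fun i => by ring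
      simp only [this] at h2
      rw [← Finset.mul_sum] at h2
      linarith
    refine ⟨hjK ⟨fun i => ?_, hle⟩, hle, hs⟩
    simp only [toR, Pi.sub_apply]
    rcases hj i with h | h
    · have := h3 i h
      rw [h]; push_cast; linarith
    · have := gt_of_sum hle (by norm_num) hs i
      rw [h]; push_cast; linarith

/-- The dilation taking the slice to the realization of the past link. -/
noncomputable def dil {n : ℕ} (v : Fin n → ℤ) : (Fin n → ℝ) ≃ₜ (Fin n → ℝ) where
  toFun := fun x i => 2 * x i - (v i : ℝ)
  invFun := fun x i => (x i + (v i : ℝ)) / 2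
  left_inv := fun x => by ext i; simp
  right_inv := fun x => by ext i; simp; ring
  continuous_toFun := by fun_prop
  continuous_invFun := by fun_prop

theorem Sl_contr_iff {n : ℕ} {K : Set (Fin n → ℝ)} (hK : IsComplex K) (v : Fin n → ℤ) :
    ContractibleSpace ↥(Sl K v) ↔ ContractibleSpace ↥(geomReal K v) :=
  ((dil v).subtype (p := fun x => x ∈ Sl K v) (q := fun x => x ∈ geomReal K v)
    (Sl_iff_geomReal hK v)).contractibleSpace_iff

theorem sum_ge_one {n : ℕ} {w v : Fin n → ℤ} (h : toR w ≤ toR v) (hne : v ≠ w) :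
    1 ≤ ∑ i, ((v i : ℝ) - w i) := by
  obtain ⟨i, hi⟩ := Function.ne_iff.1 hne
  have h0 : ∀ i, (w i : ℝ) ≤ v i := fun i => h i
  have h1 : w i ≤ v i := by exact_mod_cast h0 i
  have h2 : w i + 1 ≤ v i := by omega
  have h3 : (w i : ℝ) + 1 ≤ v i := by exact_mod_cast h2
  have := Finset.single_le_sum (f := fun i => (v i : ℝ) - w i)
    (fun i _ => sub_nonneg.2 (h0 i)) (Finset.mem_univ i)
  linarith

theorem contr_self {n : ℕ} {K : Set (Fin n → ℝ)} {p : Fin n → ℝ} (hp : p ∈ K) :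
    ContractibleSpace ↥(DipathSpace K p p) := by
  haveI : Nonempty ↥(DipathSpace K p p) :=
    ⟨⟨ContinuousMap.const _ p, fun _ => hp, rfl, rfl, fun _ _ _ => le_rfl⟩⟩
  haveI : Subsingleton ↥(DipathSpace K p p) := by
    have : ∀ γ : ↥(DipathSpace K p p), ∀ t, γ.1 t = p := by
      intro γ t
      apply le_antisymm
      · have := γ.2.2.2.2 (show t ≤ 1 from t.2.2)
        rwa [γ.2.2.2.1] at this
      · have := γ.2.2.2.2 (show 0 ≤ t from t.2.1)
        rwa [γ.2.2.1] at this
    refine ⟨fun γ γ' => Subtype.ext (ContinuousMap.ext fun t => ?_)⟩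
    rw [this γ t, this γ' t]
  infer_instance

theorem induct {n : ℕ} (hn : 0 < n) {K : Set (Fin n → ℝ)} (hK : IsComplex K)
    (w : Fin n → ℤ) (hw : toR w ∈ K) (hmin : ∀ q ∈ K, toR w ≤ q)
    (h : ∀ v : Fin n → ℤ, toR v ∈ K → v ≠ w → ContractibleSpace ↥(geomReal K v)) (m : ℕ) :
    ∀ v : Fin n → ℤ, toR v ∈ K → (∑ i, (v i - w i)).toNat = m →
        ContractibleSpace ↥(DipathSpace K (toR w) (toR v)) := by
  induction m using Nat.strong_induction_on with
  | _ m ih =>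
    intro v hv hm
    by_cases hvw : v = w
    · subst hvw; exact contr_self hw
    rw [core hn hK w v hmin (sum_ge_one (hmin _ hv) hvw), Sl_contr_iff hK]
    · exact h v hv hvw
    · intro a ha
      have hane : a.Nonempty := by
        by_contra hne
        rw [Finset.not_nonempty_iff_eq_empty] at hne
        have := ha.2.2
        simp [bpt, hne] at this
      have hlvK := lv_mem hK ha
      refine ih _ ?_ (lv v a) hlvK rfl
      rw [← hm]
      have h1 : ∑ i, (lv v a i - w i) = ∑ i, (v i - w i) - a.card := by
        simp [lv, Finset.sum_sub_distrib, sub_right_comm]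
      have h2 : 0 ≤ ∑ i, (lv v a i - w i) := by
        refine Finset.sum_nonneg fun i _ => ?_
        have h3 : (w i : ℝ) ≤ lv v a i := hmin _ hlvK i
        have : w i ≤ lv v a i := by exact_mod_cast h3
        omega
      have := Finset.card_pos.2 hane
      omega

theorem statement16 (n : ℕ) (hn : 0 < n) (K : Set (Fin n → ℝ)) (hK : IsComplex K)
    (w : Fin n → ℤ) (hw : toR w ∈ K) (hmin : ∀ q ∈ K, toR w ≤ q) :
    (∀ v : Fin n → ℤ, toR v ∈ K →
        ContractibleSpace ↥(DipathSpace K (toR w) (toR v))) ↔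
    (∀ v : Fin n → ℤ, toR v ∈ K → v ≠ w → ContractibleSpace ↥(geomReal K v)) := by
  constructor
  · intro h v hv hvw
    rw [← Sl_contr_iff hK, ← core hn hK w v hmin (sum_ge_one (hmin _ hv) hvw)
      (fun a ha => h _ (lv_mem hK ha))]
    exact h v hv
  · intro h v hv
    exact induct hn hK w hw hmin h _ v hv rfl

end DCC
end

section
/- Let K be a Euclidean cubical complex in ℝⁿ with a minimum vertex w, let τ, σ be cubes of K with τ a free face of σ, let K' be the (τ, σ)-collapse of K, and suppose (τ, σ) is an LPDC pair. Then the dipath space P(K, w, v) is contractible for every vertex v of K if and only if the dipath space P(K', w, k) is contractible for every vertex k of K'. -/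
open Set

namespace DCC

/-! ### Heights -/

/-- Height of a point: the sum of its coordinates. -/
noncomputable def ht {n : ℕ} (x : Fin n → ℝ) : ℝ := ∑ i, x i

lemma ht_mono {n : ℕ} {x y : Fin n → ℝ} (h : x ≤ y) : ht x ≤ ht y :=
  Finset.sum_le_sum fun i _ => h i

lemma ht_continuous {n : ℕ} : Continuous (ht : (Fin n → ℝ) → ℝ) := by
  unfold ht; fun_prop

lemma dist_le_ht {n : ℕ} {x y : Fin n → ℝ} (h : x ≤ y) : dist x y ≤ ht y - ht x := by
  have h0 : 0 ≤ ht y - ht x := sub_nonneg.2 (ht_mono h)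
  rw [dist_pi_le_iff h0]
  intro i
  have : ht y - ht x = ∑ i, (y i - x i) := by simp [ht, Finset.sum_sub_distrib]
  rw [this, dist_comm, Real.dist_eq, abs_of_nonneg (sub_nonneg.2 (h i))]
  exact Finset.single_le_sum (f := fun i => y i - x i)
    (fun i _ => sub_nonneg.2 (h i)) (Finset.mem_univ i)

lemma dist_le_abs_ht {n : ℕ} {x y : Fin n → ℝ} (h : x ≤ y ∨ y ≤ x) :
    dist x y ≤ |ht x - ht y| := by
  rcases h with h | h
  · rw [abs_sub_comm]; exact (dist_le_ht h).trans (le_abs_self _)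
  · rw [dist_comm]; exact (dist_le_ht h).trans (le_abs_self _)

lemma eq_of_ht {n : ℕ} {x y : Fin n → ℝ} (h : x ≤ y ∨ y ≤ x) (e : ht x = ht y) : x = y := by
  have := dist_le_abs_ht h
  rw [e, sub_self, abs_zero] at this
  exact dist_le_zero.1 this

lemma ht_lip {n : ℕ} (x y : Fin n → ℝ) : |ht x - ht y| ≤ n * dist x y := by
  have : ht x - ht y = ∑ i, (x i - y i) := by simp [ht, Finset.sum_sub_distrib]
  rw [this]
  refine (Finset.abs_sum_le_sum_abs _ _).trans ?_
  have : ∀ i ∈ Finset.univ, |x i - y i| ≤ dist x y := fun i _ => by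
    rw [← Real.dist_eq]; exact dist_le_pi_dist x y i
  simpa using Finset.sum_le_card_nsmul _ _ _ this

/-! ### Height-parametrized dipaths -/

/-- Dipaths parametrized by height, as functions on all of `ℝ` with the pointwise topology. -/
def NPath {n : ℕ} (K : Set (Fin n → ℝ)) (a b : Fin n → ℝ) : Set (ℝ → Fin n → ℝ) :=
  {γ | (∀ t, γ t ∈ K) ∧ Monotone γ ∧ γ (ht a) = a ∧ γ (ht b) = b ∧
    ∀ t, ht (γ t) = max (ht a) (min t (ht b))}

section NP
variable {n : ℕ} {K : Set (Fin n → ℝ)} {a b m : Fin n → ℝ} {γ β : ℝ → Fin n → ℝ}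

lemma NPath.tot (h : γ ∈ NPath K a b) (s t : ℝ) : γ s ≤ γ t ∨ γ t ≤ γ s :=
  (le_total s t).imp (fun e => h.2.1 e) (fun e => h.2.1 e)

lemma NPath.ht_le (h : γ ∈ NPath K a b) : ht a ≤ ht b := by
  have := h.2.2.2.2 (ht b)
  rw [h.2.2.2.1, min_self] at this
  rw [this]; exact le_max_left _ _

lemma NPath.le (h : γ ∈ NPath K a b) : a ≤ b := by
  have := h.2.1 (NPath.ht_le h)
  rwa [h.2.2.1, h.2.2.2.1] at this

lemma NPath.of_le (h : γ ∈ NPath K a b) {t : ℝ} (ht' : t ≤ ht a) : γ t = a := by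
  have h1 := h.2.2.2.2 t
  have h2 := (NPath.ht_le h)
  rw [← h.2.2.1]
  refine eq_of_ht (NPath.tot h _ _) ?_
  rw [h1, h.2.2.1, max_eq_left ((min_le_left _ _).trans ht')]

lemma NPath.of_ge (h : γ ∈ NPath K a b) {t : ℝ} (ht' : ht b ≤ t) : γ t = b := by
  have h1 := h.2.2.2.2 t
  have h2 := (NPath.ht_le h)
  rw [← h.2.2.2.1]
  refine eq_of_ht (NPath.tot h _ _) ?_
  rw [h1, h.2.2.2.1, min_eq_right ht', max_eq_right h2]

lemma NPath.le_end (h : γ ∈ NPath K a b) (t : ℝ) : γ t ≤ b := by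
  rw [← (NPath.of_ge h) (le_max_right t (ht b))]
  exact h.2.1 (le_max_left _ _)

lemma NPath.start_le (h : γ ∈ NPath K a b) (t : ℝ) : a ≤ γ t := by
  rw [← (NPath.of_le h) (min_le_right t (ht a))]
  exact h.2.1 (min_le_left _ _)

lemma NPath.ht_eq (h : γ ∈ NPath K a b) {t : ℝ} (h1 : ht a ≤ t) (h2 : t ≤ ht b) :
    ht (γ t) = t := by
  rw [h.2.2.2.2, min_eq_left h2, max_eq_right h1]

lemma NPath.lip (h : γ ∈ NPath K a b) (s t : ℝ) : dist (γ s) (γ t) ≤ |s - t| := by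
  refine (dist_le_abs_ht ((NPath.tot h) s t)).trans ?_
  rw [h.2.2.2.2, h.2.2.2.2]
  have h1 := abs_max_sub_max_le_max (ht a) (min s (ht b)) (ht a) (min t (ht b))
  have h2 := abs_min_sub_min_le_max s (ht b) t (ht b)
  simp only [sub_self, abs_zero] at h1 h2
  have h3 := abs_nonneg (s - t)
  rw [max_eq_left h3] at h2
  exact h1.trans (max_le h3 h2)

lemma NPath.eval_continuous :
    Continuous (fun p : NPath K a b × ℝ => p.1.1 p.2) := by
  rw [continuous_iff_continuousAt]
  rintro ⟨γ, t⟩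
  rw [ContinuousAt, tendsto_iff_dist_tendsto_zero]
  refine squeeze_zero (g := fun p : NPath K a b × ℝ => |p.2 - t| + dist (p.1.1 t) (γ.1 t))
    (fun _ => dist_nonneg) (fun p => ?_) ?_
  · exact (dist_triangle _ (p.1.1 t) _).trans (add_le_add_left (NPath.lip p.1.2 _ _) _)
  · have : Continuous (fun p : NPath K a b × ℝ => |p.2 - t| + dist (p.1.1 t) (γ.1 t)) := by
      have : Continuous (fun p : NPath K a b × ℝ => p.1.1 t) :=
        (continuous_apply t).comp (continuous_subtype_val.comp continuous_fst)
      fun_prop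
    simpa using this.tendsto (γ, t)

lemma NPath.eval_comp {Y : Type*} [TopologicalSpace Y] {f : Y → NPath K a b} {g : Y → ℝ}
    (hf : Continuous f) (hg : Continuous g) : Continuous (fun y => (f y).1 (g y)) :=
  NPath.eval_continuous.comp (hf.prodMk hg)

/-- Glue an initial part `β` to a final part `γ` at height `ht m`. -/
noncomputable def glue_s17 (m : Fin n → ℝ) (β γ : ℝ → Fin n → ℝ) : ℝ → Fin n → ℝ :=
  fun t => if t < ht m then β t else γ t

/-- Restrict a height path to heights below `ht m`. -/
noncomputable def restr (m : Fin n → ℝ) (γ : ℝ → Fin n → ℝ) : ℝ → Fin n → ℝ :=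
  fun t => γ (min t (ht m))

lemma glue_of_ge {t : ℝ} (h : ht m ≤ t) : glue_s17 m β γ t = γ t := by
  simp [glue_s17, not_lt.2 h]

lemma NPath.mid (hγ : γ ∈ NPath K a b) (hm : γ (ht m) = m) : ht a ≤ ht m ∧ ht m ≤ ht b := by
  constructor
  · have := hγ.2.2.2.2 (ht m)
    rw [hm] at this
    rw [this]; exact le_max_left _ _
  · have := (NPath.le_end hγ) (ht m)
    rw [hm] at this
    exact ht_mono this

lemma glue_mem {w : Fin n → ℝ} (hβ : β ∈ NPath K w m) (hγ : γ ∈ NPath K a b)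
    (hm : γ (ht m) = m) : glue_s17 m β γ ∈ NPath K w b := by
  obtain ⟨h1, h2⟩ := (NPath.mid hγ) hm
  have h3 := (NPath.ht_le hβ)
  refine ⟨fun t => ?_, fun s t hst => ?_, ?_, ?_, fun t => ?_⟩
  · unfold glue_s17; split_ifs
    · exact hβ.1 _
    · exact hγ.1 _
  · unfold glue_s17; split_ifs with p q q
    · exact hβ.2.1 hst
    · refine (NPath.le_end hβ s).trans ?_
      rw [← hm]; exact hγ.2.1 (not_lt.1 q)
    · exact absurd (hst.trans_lt q) p
    · exact hγ.2.1 hst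
  · unfold glue_s17; split_ifs with p
    · exact hβ.2.2.1
    · have e : ht w = ht m := le_antisymm h3 (not_lt.1 p)
      have := hβ.2.2.1
      rw [e, hβ.2.2.2.1] at this
      rw [e, hm, this]
  · rw [glue_of_ge h2, hγ.2.2.2.1]
  · unfold glue_s17; split_ifs with p
    · rw [hβ.2.2.2.2, min_eq_left p.le, min_eq_left (p.le.trans h2)]
    · rw [hγ.2.2.2.2]
      have p := not_lt.1 p
      have : ht m ≤ min t (ht b) := le_min p h2
      rw [max_eq_right (h1.trans this), max_eq_right (h3.trans this)]

lemma restr_mem (hγ : γ ∈ NPath K a b) (hm : γ (ht m) = m) : restr m γ ∈ NPath K a m := by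
  obtain ⟨h1, h2⟩ := (NPath.mid hγ) hm
  refine ⟨fun t => hγ.1 _, fun s t hst => hγ.2.1 (min_le_min_right _ hst), ?_, ?_, fun t => ?_⟩
  · simp only [restr]; rw [min_eq_left h1, hγ.2.2.1]
  · simp only [restr]; rw [min_self, hm]
  · simp only [restr]; rw [hγ.2.2.2.2, min_assoc, min_eq_left h2]

lemma glue_restr : glue_s17 m (restr m γ) γ = γ := by
  funext t
  unfold glue_s17 restr
  split_ifs with h
  · rw [min_eq_left h.le]
  · rfl

end NP

/-! ### Reparametrization by height -/

section NAT
variable {n : ℕ} {K : Set (Fin n → ℝ)} {a b : Fin n → ℝ}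

open Classical in
/-- The height parametrization of a monotone path. -/
noncomputable def nat (γ : C(unitInterval, Fin n → ℝ)) (t : ℝ) : Fin n → ℝ :=
  if h : ∃ τ, ht (γ τ) = max (ht (γ 0)) (min t (ht (γ 1))) then γ h.choose else 0

variable {γ : C(unitInterval, Fin n → ℝ)}

lemma mono_tot (hγ : Monotone γ) (s t) : γ s ≤ γ t ∨ γ t ≤ γ s :=
  (le_total s t).imp (fun e => hγ e) (fun e => hγ e)

lemma nat_exists (hγ : Monotone γ) (t : ℝ) :
    ∃ τ, ht (γ τ) = max (ht (γ 0)) (min t (ht (γ 1))) := by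
  have h01 : ht (γ 0) ≤ ht (γ 1) := ht_mono (hγ zero_le_one)
  have hc : Continuous (fun τ => ht (γ τ)) := ht_continuous.comp γ.continuous
  have := intermediate_value_univ (0 : unitInterval) 1 hc
  exact this ⟨le_max_left _ _, max_le h01 (min_le_right _ _)⟩

lemma nat_eq (hγ : Monotone γ) {t : ℝ} {τ : unitInterval}
    (h : ht (γ τ) = max (ht (γ 0)) (min t (ht (γ 1)))) : nat γ t = γ τ := by
  have h' : ∃ τ, ht (γ τ) = max (ht (γ 0)) (min t (ht (γ 1))) := ⟨τ, h⟩
  unfold nat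
  rw [dif_pos h']
  exact eq_of_ht (mono_tot hγ _ _) (h'.choose_spec.trans h.symm)

lemma nat_ht (hγ : Monotone γ) (τ : unitInterval) : nat γ (ht (γ τ)) = γ τ := by
  apply nat_eq hγ
  rw [min_eq_left (ht_mono (hγ unitInterval.le_one')),
    max_eq_right (ht_mono (hγ unitInterval.nonneg'))]

lemma nat_get (hγ : Monotone γ) (t : ℝ) :
    ∃ τ, nat γ t = γ τ ∧ ht (γ τ) = max (ht (γ 0)) (min t (ht (γ 1))) := by
  obtain ⟨τ, h⟩ := nat_exists hγ t
  exact ⟨τ, nat_eq hγ h, h⟩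

lemma nat_mem (hγ : γ ∈ DipathSpace K a b) : nat γ ∈ NPath K a b := by
  obtain ⟨h1, h2, h3, h4⟩ := hγ
  have key := nat_get h4
  refine ⟨fun t => ?_, fun s t hst => ?_, ?_, ?_, fun t => ?_⟩
  · obtain ⟨τ, e, _⟩ := key t
    rw [e]; exact h1 τ
  · obtain ⟨τ, e, f⟩ := key t
    obtain ⟨σ, e', f'⟩ := key s
    rw [e, e']
    rcases mono_tot h4 σ τ with h | h
    · exact h
    · have : ht (γ σ) ≤ ht (γ τ) := by
        rw [f, f']; exact max_le_max le_rfl (min_le_min_right _ hst)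
      exact (eq_of_ht (Or.inr h) (le_antisymm this (ht_mono h))).le
  · rw [← h2, nat_ht h4]
  · rw [← h3, nat_ht h4]
  · obtain ⟨τ, e, f⟩ := key t
    rw [e, f, h2, h3]

lemma nat_lip {γ γ' : C(unitInterval, Fin n → ℝ)} (hγ : Monotone γ) (hγ' : Monotone γ') (t : ℝ) :
    dist (nat γ t) (nat γ' t) ≤ (2 * n + 1) * dist γ γ' := by
  obtain ⟨τ, e, f⟩ := nat_get hγ t
  obtain ⟨σ, e', f'⟩ := nat_get hγ' t
  rw [e, e']
  have d : ∀ τ, |ht (γ τ) - ht (γ' τ)| ≤ n * dist γ γ' := fun τ =>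
    (ht_lip _ _).trans (mul_le_mul_of_nonneg_left (ContinuousMap.dist_apply_le_dist τ)
      (Nat.cast_nonneg _))
  have h1 : dist (γ τ) (γ σ) ≤ |ht (γ τ) - ht (γ σ)| := dist_le_abs_ht (mono_tot hγ _ _)
  have h2 : dist (γ σ) (γ' σ) ≤ dist γ γ' := ContinuousMap.dist_apply_le_dist σ
  have h3 : |ht (γ τ) - ht (γ' σ)| ≤ n * dist γ γ' := by
    rw [f, f']
    refine (abs_max_sub_max_le_max _ _ _ _).trans (max_le (d 0) ?_)
    refine (abs_min_sub_min_le_max _ _ _ _).trans (max_le ?_ (d 1))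
    simp only [sub_self, abs_zero]
    positivity
  have h4 := abs_sub_le (ht (γ τ)) (ht (γ' σ)) (ht (γ σ))
  have h5 := d σ
  rw [abs_sub_comm] at h5
  linarith [dist_triangle (γ τ) (γ σ) (γ' σ)]

lemma nat_continuous {Y : Type*} [TopologicalSpace Y] {f : Y → C(unitInterval, Fin n → ℝ)}
    (hf : Continuous f) (hm : ∀ y, Monotone (f y)) : Continuous (fun y => nat (f y)) := by
  refine continuous_pi fun t => ?_
  rw [continuous_iff_continuousAt]
  intro y
  rw [ContinuousAt, tendsto_iff_dist_tendsto_zero]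
  refine squeeze_zero (g := fun z => (2 * n + 1) * dist (f z) (f y))
    (fun _ => dist_nonneg) (fun z => nat_lip (hm _) (hm _) t) ?_
  have : Continuous (fun z => (2 * n + 1) * dist (f z) (f y)) := by fun_prop
  simpa using this.tendsto y

/-- Affine parametrization of `[ht a, ht b]`. -/
noncomputable def aff (a b : Fin n → ℝ) (τ : unitInterval) : ℝ :=
  (1 - (τ : ℝ)) * ht a + τ * ht b

lemma aff_continuous : Continuous (aff a b) := by unfold aff; fun_prop

lemma aff_mono (h : ht a ≤ ht b) : Monotone (aff a b) := by
  intro s t hst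
  have : (s : ℝ) ≤ t := hst
  unfold aff
  nlinarith

lemma aff_zero : aff a b 0 = ht a := by simp [aff]
lemma aff_one : aff a b 1 = ht b := by simp [aff]

lemma aff_surj {t : ℝ} (h1 : ht a ≤ t) (h2 : t ≤ ht b) :
    ∃ τ, aff a b τ = t := by
  have := intermediate_value_univ (0 : unitInterval) 1 (aff_continuous (a := a) (b := b))
  rw [aff_zero, aff_one] at this
  exact this ⟨h1, h2⟩

lemma curry_continuous {Y : Type*} [TopologicalSpace Y] {f : Y → unitInterval → Fin n → ℝ}
    (hf : Continuous (fun p : Y × unitInterval => f p.1 p.2)) (hy : ∀ y, Continuous (f y)) :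
    Continuous (fun y => (⟨f y, hy y⟩ : C(unitInterval, Fin n → ℝ))) :=
  ContinuousMap.continuous_of_continuous_uncurry _ hf

/-- A height path as a path on the unit interval. -/
noncomputable def iota (γ : NPath K a b) : DipathSpace K a b :=
  ⟨⟨fun τ => γ.1 (aff a b τ),
    NPath.eval_comp (f := fun _ => γ) continuous_const aff_continuous⟩,
    fun _ => γ.2.1 _, by simp [aff_zero, γ.2.2.2.1], by simp [aff_one, γ.2.2.2.2.1],
    fun _ _ h => γ.2.2.1 (aff_mono (NPath.ht_le γ.2) h)⟩

lemma iota_continuous : Continuous (iota : NPath K a b → DipathSpace K a b) := by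
  refine Continuous.subtype_mk ?_ _
  exact curry_continuous
    (NPath.eval_comp continuous_fst (aff_continuous.comp continuous_snd)) _

lemma nat_iota (γ : NPath K a b) : nat (iota γ).1 = γ.1 := by
  funext t
  have hm := (iota γ).2.2.2.2
  obtain ⟨τ, e, f⟩ := nat_get hm t
  rw [e]
  refine eq_of_ht (NPath.tot γ.2 (aff a b τ) t) (f.trans ?_)
  rw [γ.2.2.2.2.2 t, (iota γ).2.2.1, (iota γ).2.2.2.1]

/-- Height reparametrization as a map of subtypes. -/
noncomputable def natS (γ : DipathSpace K a b) : NPath K a b := ⟨nat γ.1, nat_mem γ.2⟩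

lemma natS_continuous : Continuous (natS : DipathSpace K a b → NPath K a b) :=
  Continuous.subtype_mk (nat_continuous continuous_subtype_val fun γ => γ.2.2.2.2) _

/-- The dipath space is homotopy equivalent to the space of height-parametrized dipaths. -/
noncomputable def equivNP (K : Set (Fin n → ℝ)) (a b : Fin n → ℝ) :
    ContinuousMap.HomotopyEquiv (DipathSpace K a b) (NPath K a b) where
  toFun := ⟨natS, natS_continuous⟩
  invFun := ⟨iota, iota_continuous⟩
  left_inv := by
    have hF : Continuous (fun p : (unitInterval × DipathSpace K a b) × unitInterval =>
        (natS p.1.2).1 ((1 - (p.1.1 : ℝ)) * ht (p.1.2.1 p.2) + p.1.1 * aff a b p.2)) := by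
      refine NPath.eval_comp (natS_continuous.comp (continuous_snd.comp continuous_fst)) ?_
      have h1 : Continuous (fun p : (unitInterval × DipathSpace K a b) × unitInterval =>
        ht (p.1.2.1 p.2)) := by
        refine ht_continuous.comp ?_
        have : Continuous (fun p : (unitInterval × DipathSpace K a b) × unitInterval =>
          (p.1.2.1 : C(unitInterval, Fin n → ℝ))) :=
          continuous_subtype_val.comp (continuous_snd.comp continuous_fst)
        fun_prop
      have h2 : Continuous (fun p : (unitInterval × DipathSpace K a b) × unitInterval =>
        aff a b p.2) := aff_continuous.comp continuous_snd
      fun_prop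
    have hmem : ∀ p : unitInterval × DipathSpace K a b,
        (⟨fun τ => (natS p.2).1 ((1 - (p.1 : ℝ)) * ht (p.2.1 τ) + p.1 * aff a b τ),
          hF.comp (Continuous.prodMk continuous_const continuous_id)⟩ :
          C(unitInterval, Fin n → ℝ)) ∈ DipathSpace K a b := by
      rintro ⟨s, γ⟩
      have hs0 : 0 ≤ (s : ℝ) := s.2.1
      have hs1 : 0 ≤ 1 - (s : ℝ) := sub_nonneg.2 s.2.2
      refine ⟨fun τ => (natS γ).2.1 _, ?_, ?_, fun σ τ h => (natS γ).2.2.1 ?_⟩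
      · simp only [ContinuousMap.coe_mk]
        rw [aff_zero, γ.2.2.1]
        convert (natS γ).2.2.2.1 using 2
        ring
      · simp only [ContinuousMap.coe_mk]
        rw [aff_one, γ.2.2.2.1]
        convert (natS γ).2.2.2.2.1 using 2
        ring
      · have h1 := ht_mono (γ.2.2.2.2 h)
        have h2 := aff_mono (NPath.ht_le (natS γ).2) h
        exact add_le_add (mul_le_mul_of_nonneg_left h1 hs1) (mul_le_mul_of_nonneg_left h2 hs0)
    refine ContinuousMap.Homotopic.symm ⟨{
      toFun := fun p => ⟨_, hmem p⟩
      continuous_toFun := Continuous.subtype_mk (curry_continuous hF _) _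
      map_zero_left := ?_
      map_one_left := ?_ }⟩
    · intro γ
      ext τ : 2
      simp only [ContinuousMap.coe_mk, Set.Icc.coe_zero, sub_zero, one_mul, zero_mul,
        add_zero, ContinuousMap.id_apply]
      exact nat_ht γ.2.2.2.2 τ
    · intro γ
      ext τ : 2
      simp [iota]
  right_inv := by
    have : (ContinuousMap.mk natS natS_continuous).comp ⟨iota, iota_continuous⟩
      = ContinuousMap.id (NPath K a b) := by
      ext γ : 1
      exact Subtype.ext (nat_iota γ)
    rw [this]

end NAT

/-! ### Cubical closure and the past link -/

section GEOM
variable {n : ℕ} {K : Set (Fin n → ℝ)}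

/-- `K` contains the smallest elementary cube around each of its points. -/
def CubeClosed (K : Set (Fin n → ℝ)) : Prop :=
  ∀ x ∈ K, ∀ z : Fin n → ℝ, (∀ i, (⌊x i⌋ : ℝ) ≤ z i ∧ z i ≤ ⌈x i⌉) → z ∈ K

lemma cubeClosed_of (h : ∀ x ∈ K, ∃ v j, x ∈ cube v j ∧ cube v j ⊆ K) : CubeClosed K := by
  intro x hx z hz
  obtain ⟨v, j, ⟨h1, h2⟩, hs⟩ := h x hx
  refine hs ⟨fun i => ?_, fun i => ?_⟩
  · have : (v - j) i ≤ ⌊x i⌋ := Int.le_floor.2 (h1 i)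
    exact le_trans (by simp only [toR]; exact_mod_cast this) (hz i).1
  · have : ⌈x i⌉ ≤ v i := Int.ceil_le.2 (h2 i)
    exact (hz i).2.trans (by simp only [toR]; exact_mod_cast this)

/-- Indicator vector of a set of coordinates. -/
def ind (j : Finset (Fin n)) : Fin n → ℤ := fun i => if i ∈ j then 1 else 0

lemma ind_binary (j : Finset (Fin n)) : IsBinary (ind j) := by
  intro i; unfold ind; split_ifs <;> simp

lemma exists_ind {j : Fin n → ℤ} (h : IsBinary j) : ∃ J, j = ind J := by
  refine ⟨Finset.univ.filter (fun i => j i = 1), ?_⟩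
  funext i
  rcases h i with h | h <;> simp [ind, h]

/-- The vertex `v - j`. -/
def vt (v : Fin n → ℤ) (j : Finset (Fin n)) : Fin n → ℝ := toR (v - ind j)

lemma vt_apply (v : Fin n → ℤ) (j : Finset (Fin n)) (i : Fin n) :
    vt v j i = v i - if i ∈ j then 1 else 0 := by
  simp only [vt, toR, ind, Pi.sub_apply]
  split_ifs <;> simp

lemma ht_vt (v : Fin n → ℤ) (j : Finset (Fin n)) : ht (vt v j) = ht (toR v) - j.card := by
  simp only [ht, vt_apply, Finset.sum_sub_distrib, toR]
  simp

lemma mem_cube_ind {v : Fin n → ℤ} {j : Finset (Fin n)} {z : Fin n → ℝ} :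
    z ∈ cube v (ind j) ↔ vt v j ≤ z ∧ z ≤ toR v := Iff.rfl

lemma vt_anti (v : Fin n → ℤ) {j j' : Finset (Fin n)} (h : j ⊆ j') : vt v j' ≤ vt v j := by
  intro i
  rw [vt_apply, vt_apply]
  by_cases hi : i ∈ j
  · simp [hi, h hi]
  · simp only [hi, if_false]
    split_ifs <;> linarith

lemma cube_ind_mono (v : Fin n → ℤ) {j j' : Finset (Fin n)} (h : j ⊆ j') :
    cube v (ind j) ⊆ cube v (ind j') := fun _ hz =>
  ⟨(vt_anti v h).trans hz.1, hz.2⟩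

lemma mem_geom {v : Fin n → ℤ} {x : Fin n → ℝ} :
    x ∈ geomReal K v ↔ x ≤ toR v ∧ ht x = ht (toR v) - 1 ∧
      ∃ j : Finset (Fin n), (∀ i, i ∉ j → x i = v i) ∧ cube v (ind j) ⊆ K := by
  simp only [geomReal, Set.mem_iUnion]
  constructor
  · rintro ⟨j, ⟨hb, -, hK⟩, hx⟩
    obtain ⟨J, rfl⟩ := exists_ind hb
    have : convexHull ℝ ((fun i => toR v - Pi.single i (1 : ℝ)) '' {i | ind J i = 1}) ⊆
        {x | x ≤ toR v ∧ ht x = ht (toR v) - 1 ∧ ∀ i, i ∉ J → x i = v i} := by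
      refine convexHull_min ?_ ?_
      · rintro _ ⟨i, hi, rfl⟩
        refine ⟨?_, ?_, ?_⟩
        · simp
        · simp [ht, Finset.sum_sub_distrib]
        · intro k hk
          have : k ≠ i := by
            rintro rfl
            simp [ind, hk] at hi
          simp [this, toR]
      · rintro x ⟨h1, h2, h3⟩ y ⟨h4, h5, h6⟩ a b ha hb hab
        refine ⟨?_, ?_, ?_⟩
        · intro i
          have := h1 i
          have := h4 i
          simp only [Pi.add_apply, Pi.smul_apply, smul_eq_mul]
          have : toR v i = a * toR v i + b * toR v i := by rw [← add_mul, hab, one_mul]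
          rw [this]
          gcongr
        · have : ht (a • x + b • y) = a * ht x + b * ht y := by
            simp [ht, Finset.sum_add_distrib, Finset.mul_sum]
          rw [this, h2, h5, ← add_mul, hab, one_mul]
        · intro i hi
          simp only [Pi.add_apply, Pi.smul_apply, smul_eq_mul]
          rw [h3 i hi, h6 i hi, ← add_mul, hab, one_mul]
    obtain ⟨h1, h2, h3⟩ := this hx
    exact ⟨h1, h2, J, h3, hK⟩
  · rintro ⟨h1, h2, J, h3, hK⟩
    have hsum : ∑ i ∈ J, ((v i : ℝ) - x i) = 1 := by
      have : ∑ i, ((v i : ℝ) - x i) = 1 := by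
        rw [Finset.sum_sub_distrib]
        simp only [ht, toR] at h2
        linarith
      rw [← this]
      refine Finset.sum_subset (Finset.subset_univ _) ?_
      intro i _ hi
      rw [h3 i hi, sub_self]
    refine ⟨ind J, ⟨ind_binary J, ?_, hK⟩, ?_⟩
    · intro h0
      have : J = ∅ := by
        ext i
        have := congrFun h0 i
        by_cases hi : i ∈ J <;> simp [ind, hi] at this ⊢
      rw [this] at hsum
      simp at hsum
    · have hx : x = ∑ i ∈ J, ((v i : ℝ) - x i) • (toR v - Pi.single i (1 : ℝ)) := by
        funext k
        rw [Finset.sum_apply]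
        simp only [Pi.smul_apply, Pi.sub_apply, smul_eq_mul, mul_sub, Finset.sum_sub_distrib]
        rw [← Finset.sum_mul, hsum]
        simp only [Pi.single_apply, toR, mul_ite, mul_one, mul_zero, Finset.sum_ite_eq]
        split_ifs with hk
        · ring
        · rw [h3 k hk]; simp
      rw [hx]
      refine (convex_convexHull ℝ _).sum_mem (fun i _ => sub_nonneg.2 (h1 i)) hsum ?_
      intro i hi
      refine subset_convexHull ℝ _ ⟨i, ?_, rfl⟩
      simp [ind, hi]

lemma geom_ge {v : Fin n → ℤ} {x : Fin n → ℝ} (h1 : x ≤ toR v) (h2 : ht x = ht (toR v) - 1)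
    (i : Fin n) : (v i : ℝ) - x i ≤ 1 := by
  have : ∑ i, ((v i : ℝ) - x i) = 1 := by
    rw [Finset.sum_sub_distrib]
    simp only [ht, toR] at h2
    linarith
  rw [← this]
  exact Finset.single_le_sum (f := fun i => (v i : ℝ) - x i)
    (fun i _ => sub_nonneg.2 (h1 i)) (Finset.mem_univ i)

lemma cube_supp (hK : CubeClosed K) {v : Fin n → ℤ} {x : Fin n → ℝ} (hx : x ∈ K)
    (h1 : x ≤ toR v) (h2 : ∀ i, (v i : ℝ) - x i < 1) :
    cube v (ind (Finset.univ.filter fun i => x i ≠ v i)) ⊆ K := by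
  intro z hz
  rw [mem_cube_ind] at hz
  refine hK x hx z fun i => ?_
  have a := hz.1 i
  have b : z i ≤ v i := hz.2 i
  have c : x i ≤ v i := h1 i
  have d := h2 i
  rw [vt_apply] at a
  by_cases hi : x i = v i
  · simp only [hi, ne_eq, Finset.mem_filter, Finset.mem_univ, not_true_eq_false, and_false,
      if_false, sub_zero] at a
    rw [hi, Int.floor_intCast, Int.ceil_intCast]
    exact ⟨a, b⟩
  · have lt : x i < v i := lt_of_le_of_ne c hi
    simp only [hi, ne_eq, Finset.mem_filter, Finset.mem_univ, not_false_eq_true, and_true,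
      if_true] at a
    have e1 : ⌊x i⌋ = v i - 1 := by
      rw [Int.floor_eq_iff]; push_cast; constructor <;> linarith
    have e2 : ⌈x i⌉ = v i := by
      rw [Int.ceil_eq_iff]; constructor <;> linarith
    rw [e1, e2]
    push_cast
    exact ⟨a, b⟩

lemma ht_gap {w v : Fin n → ℤ} (h : toR w ≤ toR v) (hne : w ≠ v) :
    ht (toR w) ≤ ht (toR v) - 1 := by
  have e : ∀ u : Fin n → ℤ, ht (toR u) = ((∑ i, u i : ℤ) : ℝ) := fun u => by simp [ht, toR]
  have lt : ht (toR w) < ht (toR v) := by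
    refine lt_of_le_of_ne (ht_mono h) fun he => hne ?_
    have := eq_of_ht (Or.inl h) he
    funext i
    have := congrFun this i
    simpa [toR] using this
  rw [e, e] at lt ⊢
  have : (∑ i, w i) < ∑ i, v i := by exact_mod_cast lt
  have : (∑ i, w i) ≤ (∑ i, v i) - 1 := by omega
  exact_mod_cast this

lemma end_mem_geom (hK : CubeClosed K) {w v : Fin n → ℤ} (hne : w ≠ v) {γ : ℝ → Fin n → ℝ}
    (hγ : γ ∈ NPath K (toR w) (toR v)) : γ (ht (toR v) - 1) ∈ geomReal K v := by
  have hg := ht_gap (NPath.le hγ) hne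
  have h1 := NPath.le_end hγ (ht (toR v) - 1)
  have h2 := NPath.ht_eq hγ hg (by linarith)
  set x := γ (ht (toR v) - 1) with hx
  rw [mem_geom]
  refine ⟨h1, h2, Finset.univ.filter fun i => x i ≠ v i, by simp, ?_⟩
  by_cases hlt : ∀ i, (v i : ℝ) - x i < 1
  · exact cube_supp hK (hγ.1 _) h1 hlt
  · push Not at hlt
    obtain ⟨i, hi⟩ := hlt
    have h3 := NPath.ht_eq hγ (t := ht (toR v) - 1 / 2) (by linarith) (by linarith)
    have h4 := NPath.le_end hγ (ht (toR v) - 1 / 2)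
    have h5 : x ≤ γ (ht (toR v) - 1 / 2) := hγ.2.1 (by linarith)
    set z := γ (ht (toR v) - 1 / 2) with hz
    have hs : ∀ u : Fin n → ℝ, ht (toR v) - ht u = ∑ k, ((v k : ℝ) - u k) := fun u => by
      rw [Finset.sum_sub_distrib]; rfl
    have hk : ∀ k, k ≠ i → x k = v k := by
      intro k hk
      have s1 := hs x
      rw [← Finset.add_sum_erase _ _ (Finset.mem_univ i)] at s1
      have s2 := Finset.single_le_sum (f := fun k => (v k : ℝ) - x k)
        (s := Finset.univ.erase i)
        (fun k _ => sub_nonneg.2 (h1 k)) (Finset.mem_erase.2 ⟨hk, Finset.mem_univ k⟩)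
      have := h1 k
      simp only [toR] at this s2
      linarith
    have hzk : ∀ k, k ≠ i → z k = v k := fun k hk' =>
      le_antisymm (h4 k) (by rw [← hk k hk']; exact h5 k)
    have hzi : (v i : ℝ) - z i = 1 / 2 := by
      have s1 := hs z
      rw [Finset.sum_eq_single i (fun k _ hk' => by rw [hzk k hk', sub_self])
        (fun h => absurd (Finset.mem_univ i) h)] at s1
      linarith
    have hsup : (Finset.univ.filter fun i => x i ≠ v i)
        = Finset.univ.filter fun i => z i ≠ v i := by
      ext k
      simp only [Finset.mem_filter, Finset.mem_univ, true_and]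
      by_cases hk' : k = i
      · subst hk'
        constructor <;> intro _ h0
        · rw [h0] at hzi; norm_num at hzi
        · rw [h0] at hi; norm_num at hi
      · rw [hk k hk', hzk k hk']
    rw [hsup]
    refine cube_supp hK (hγ.1 _) h4 fun k => ?_
    by_cases hk' : k = i
    · subst hk'; rw [hzi]; norm_num
    · rw [hzk k hk']; norm_num

end GEOM

/-! ### The pushing map -/

section PUSH
variable {n : ℕ} {K : Set (Fin n → ℝ)}

/-- One-dimensional push: depths at least `δ` are pushed to depth `1`. -/
noncomputable def psi (δ d : ℝ) : ℝ := max d (min 1 (d / δ))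

lemma psi_mono {δ : ℝ} (h : 0 < δ) : Monotone (psi δ) := fun a b hab => by
  unfold psi; gcongr

lemma psi_continuous {δ : ℝ} : Continuous (psi δ) := by unfold psi; fun_prop

lemma psi_of_nonpos {δ d : ℝ} (h : 0 < δ) (h1 : δ < 1) (hd : d ≤ 0) : psi δ d = d := by
  unfold psi
  apply max_eq_left
  refine (min_le_right _ _).trans ?_
  rw [div_le_iff₀ h]
  nlinarith

lemma psi_of_one_le {δ d : ℝ} (hd : 1 ≤ d) : psi δ d = d := by
  unfold psi
  exact max_eq_left ((min_le_left _ _).trans hd)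

lemma le_psi {δ d : ℝ} : d ≤ psi δ d := le_max_left _ _

lemma psi_le_one {δ d : ℝ} (hd : d ≤ 1) : psi δ d ≤ 1 := max_le hd (min_le_left _ _)

lemma psi_eq_one {δ d : ℝ} (h : 0 < δ) (h1 : δ ≤ d) (hd : d ≤ 1) : psi δ d = 1 := by
  refine le_antisymm (psi_le_one hd) ?_
  unfold psi
  refine le_max_of_le_right (le_min le_rfl ?_)
  rwa [le_div_iff₀ h, one_mul]

/-- Follow the standard path from `x` to `v` for time `r`, then push. -/
noncomputable def eP (v : Fin n → ℤ) (δ : ℝ) (x : Fin n → ℝ) (r : ℝ) : Fin n → ℝ :=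
  fun i => v i - psi δ (max 0 (v i - x i - r))

variable {v : Fin n → ℤ} {δ : ℝ}

lemma eP_continuous : Continuous (fun p : (Fin n → ℝ) × ℝ => eP v δ p.1 p.2) := by
  refine continuous_pi fun i => ?_
  unfold eP
  have := psi_continuous (δ := δ)
  fun_prop

lemma eP_mono (h : 0 < δ) {x x' : Fin n → ℝ} {r r' : ℝ} (hx : x ≤ x') (hr : r ≤ r') :
    eP v δ x r ≤ eP v δ x' r' := by
  intro i
  have := hx i
  unfold eP
  apply sub_le_sub_left
  exact psi_mono h (max_le_max le_rfl (by linarith))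

lemma eP_cube (h : 0 < δ) (h1 : δ < 1) {x : Fin n → ℝ} {r : ℝ} {j : Finset (Fin n)}
    (hx : vt v j ≤ x) (hxv : x ≤ toR v) (hr : 0 ≤ r) :
    eP v δ x r ∈ cube v (ind j) := by
  rw [mem_cube_ind]
  constructor
  · intro i
    have a := hx i
    have b : x i ≤ v i := hxv i
    rw [vt_apply] at a ⊢
    unfold eP
    apply sub_le_sub_left
    split_ifs at a ⊢ with hi
    · exact psi_le_one (max_le zero_le_one (by linarith))
    · rw [max_eq_left (by linarith), psi_of_nonpos h h1 le_rfl]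
  · intro i
    have : 0 ≤ psi δ (max 0 (v i - x i - r)) := (le_max_left _ _).trans le_psi
    simp only [eP, toR]
    linarith

lemma eP_end (h : 0 < δ) (h1 : δ < 1) {x : Fin n → ℝ} {r : ℝ}
    (hx : ∀ i, (v i : ℝ) - x i ≤ r) : eP v δ x r = toR v := by
  funext i
  have := hx i
  simp only [eP, toR]
  rw [max_eq_left (by linarith), psi_of_nonpos h h1 le_rfl, sub_zero]

lemma eP_vt (h : 0 < δ) (h1 : δ < 1) {x : Fin n → ℝ} {r : ℝ} {j : Finset (Fin n)}
    (hj : ∀ i ∈ j, δ ≤ v i - x i - r) (hj1 : ∀ i ∈ j, v i - x i - r ≤ 1)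
    (hn : ∀ i, i ∉ j → v i - x i ≤ r) : eP v δ x r = vt v j := by
  funext i
  rw [vt_apply]
  simp only [eP]
  by_cases hi : i ∈ j
  · have := hj i hi
    have := hj1 i hi
    rw [max_eq_right (by linarith), psi_eq_one h (by linarith) (by linarith), if_pos hi]
  · have := hn i hi
    rw [max_eq_left (by linarith), psi_of_nonpos h h1 le_rfl, if_neg hi]

/-- The interpolation from a height path to its pushed version. -/
noncomputable def gP (v : Fin n → ℤ) (δ : ℝ) (γ : ℝ → Fin n → ℝ) (s t : ℝ) : Fin n → ℝ :=
  (1 - s) • γ t + s • eP v δ (γ (min t (ht (toR v) - 1))) (max 0 (t - (ht (toR v) - 1)))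

lemma gP_mem_K (hK : CubeClosed K) (h : 0 < δ) (h1 : δ < 1) {w : Fin n → ℤ} (hne : w ≠ v)
    {γ : ℝ → Fin n → ℝ} (hγ : γ ∈ NPath K (toR w) (toR v)) {s : ℝ} (hs0 : 0 ≤ s) (hs1 : s ≤ 1)
    (t : ℝ) : gP v δ γ s t ∈ K := by
  rcases le_total t (ht (toR v) - 1) with hle | hle
  · refine hK (γ t) (hγ.1 t) _ fun i => ?_
    simp only [gP]
    rw [min_eq_left hle, max_eq_left (by linarith)]
    simp only [Pi.add_apply, Pi.smul_apply, smul_eq_mul, eP, sub_zero]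
    have hv : γ t i ≤ v i := NPath.le_end hγ t i
    have f1 := Int.floor_le (γ t i)
    have f2 := Int.le_ceil (γ t i)
    rw [max_eq_right (by linarith)]
    rcases le_or_gt 1 ((v i : ℝ) - γ t i) with hd | hd
    · rw [psi_of_one_le hd]
      constructor <;> linarith
    · rcases hv.eq_or_lt with he | hl
      · rw [he, sub_self, psi_of_nonpos h h1 le_rfl]
        simp only [Int.floor_intCast, Int.ceil_intCast]
        constructor <;> linarith
      · have e1 : ⌊γ t i⌋ = v i - 1 := by
          rw [Int.floor_eq_iff]; push_cast; constructor <;> linarith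
        have p1 : (v i : ℝ) - γ t i ≤ psi δ ((v i : ℝ) - γ t i) := le_psi
        have p2 : psi δ ((v i : ℝ) - γ t i) ≤ 1 := psi_le_one hd.le
        rw [e1] at f1 ⊢
        push_cast at f1 ⊢
        constructor
        · nlinarith
        · nlinarith
  · obtain ⟨g1, g2, J, g3, g4⟩ := mem_geom.1 (end_mem_geom hK hne hγ)
    apply g4
    simp only [gP]
    rw [min_eq_right hle]
    have hvt : vt v J ≤ γ (ht (toR v) - 1) := by
      intro i
      rw [vt_apply]
      split_ifs with hi
      · have := geom_ge g1 g2 i; linarith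
      · rw [g3 i hi]; simp
    refine convex_Icc _ _ ?_ (eP_cube h h1 hvt g1 (le_max_left _ _)) (sub_nonneg.2 hs1) hs0
      (by ring)
    exact ⟨hvt.trans (hγ.2.1 hle), NPath.le_end hγ t⟩

lemma gP_mono (h : 0 < δ) {w : Fin n → ℤ}
    {γ : ℝ → Fin n → ℝ} (hγ : γ ∈ NPath K (toR w) (toR v)) {s : ℝ} (hs0 : 0 ≤ s) (hs1 : s ≤ 1) :
    Monotone (gP v δ γ s) := by
  intro t t' htt
  have a := hγ.2.1 htt
  have b : eP v δ (γ (min t (ht (toR v) - 1))) (max 0 (t - (ht (toR v) - 1))) ≤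
    eP v δ (γ (min t' (ht (toR v) - 1))) (max 0 (t' - (ht (toR v) - 1))) :=
    eP_mono h (hγ.2.1 (min_le_min_right _ htt)) (max_le_max le_rfl (by linarith))
  intro i
  have a := a i
  have b := b i
  simp only [gP, Pi.add_apply, Pi.smul_apply, smul_eq_mul]
  have : 0 ≤ 1 - s := sub_nonneg.2 hs1
  gcongr

lemma gP_start (h : 0 < δ) (h1 : δ < 1) {w : Fin n → ℤ} (hne : w ≠ v)
    {γ : ℝ → Fin n → ℝ} (hγ : γ ∈ NPath K (toR w) (toR v)) (s : ℝ) :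
    gP v δ γ s (ht (toR w)) = toR w := by
  have hle := NPath.le hγ
  have hg := ht_gap hle hne
  simp only [gP]
  rw [min_eq_left hg, max_eq_left (by linarith), hγ.2.2.1]
  funext i
  have hi : toR w i ≤ toR v i := hle i
  have e : eP v δ (toR w) 0 i = toR w i := by
    simp only [eP, toR, sub_zero] at hi ⊢
    rw [max_eq_right (by linarith)]
    have : psi δ ((v i : ℝ) - w i) = (v i : ℝ) - w i := by
      rcases le_or_gt (v i - w i) 0 with h0 | h0
      · exact psi_of_nonpos h h1 (by exact_mod_cast h0)
      · exact psi_of_one_le (by exact_mod_cast h0)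
    rw [this]; ring
  simp only [Pi.add_apply, Pi.smul_apply, smul_eq_mul]
  rw [e]; ring

lemma gP_end (h : 0 < δ) (h1 : δ < 1) {w : Fin n → ℤ} (hne : w ≠ v)
    {γ : ℝ → Fin n → ℝ} (hγ : γ ∈ NPath K (toR w) (toR v)) (s : ℝ) :
    gP v δ γ s (ht (toR v)) = toR v := by
  have hle := NPath.le hγ
  have hg := ht_gap hle hne
  simp only [gP]
  rw [min_eq_right (by linarith), sub_sub_cancel, max_eq_right zero_le_one, hγ.2.2.2.1,
    eP_end h h1 (geom_ge (NPath.le_end hγ _) (NPath.ht_eq hγ hg (by linarith)))]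
  rw [← add_smul]; simp

/-- The standard path from `x` to `v`, pushed. -/
noncomputable def eC (v : Fin n → ℤ) (δ : ℝ) (x : Fin n → ℝ) : C(unitInterval, Fin n → ℝ) :=
  ⟨fun r => eP v δ x r, eP_continuous.comp (Continuous.prodMk continuous_const
    continuous_subtype_val)⟩

/-- Its height parametrization. -/
noncomputable def std (v : Fin n → ℤ) (δ : ℝ) (x : Fin n → ℝ) : ℝ → Fin n → ℝ := nat (eC v δ x)

lemma eC_mono (h : 0 < δ) (x : Fin n → ℝ) : Monotone (eC v δ x) := fun _ _ hr =>
  eP_mono h le_rfl hr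

lemma std_continuous (h : 0 < δ) : Continuous (std v δ) := by
  refine nat_continuous ?_ (eC_mono h)
  refine curry_continuous (f := fun x r => eP v δ x r) ?_ _
  exact eP_continuous.comp (continuous_fst.prodMk (continuous_subtype_val.comp continuous_snd))

lemma geom_vt_le {x : Fin n → ℝ} (g1 : x ≤ toR v) (g2 : ht x = ht (toR v) - 1)
    {J : Finset (Fin n)} (g3 : ∀ i, i ∉ J → x i = v i) : vt v J ≤ x := by
  intro i
  rw [vt_apply]
  split_ifs with hi
  · have := geom_ge g1 g2 i; linarith
  · rw [g3 i hi]; simp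

lemma eC_mem (h : 0 < δ) (h1 : δ < 1) {x : Fin n → ℝ} (hx : x ∈ geomReal K v) :
    eC v δ x ∈ DipathSpace K (eP v δ x 0) (toR v) := by
  obtain ⟨g1, g2, J, g3, g4⟩ := mem_geom.1 hx
  refine ⟨fun r => g4 ?_, ?_, ?_, eC_mono h x⟩
  · exact eP_cube h h1 (geom_vt_le g1 g2 g3) g1 r.2.1
  · simp [eC]
  · simp only [eC, ContinuousMap.coe_mk, Set.Icc.coe_one]
    exact eP_end h h1 (geom_ge g1 g2)

lemma std_mem (h : 0 < δ) (h1 : δ < 1) {x : Fin n → ℝ} (hx : x ∈ geomReal K v) :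
    std v δ x ∈ NPath K (eP v δ x 0) (toR v) := nat_mem (eC_mem h h1 hx)

end PUSH

/-! ### Gaps of depth coordinates -/

section GAP
variable {n : ℕ} [NeZero n] {K : Set (Fin n → ℝ)} {v : Fin n → ℤ} {δ : ℝ}

/-- How far the depths of the coordinates in `j` exceed those of the other coordinates. -/
noncomputable def gap (v : Fin n → ℤ) (j : Finset (Fin n)) (x : Fin n → ℝ) : ℝ :=
  Finset.univ.inf' Finset.univ_nonempty (fun p : Fin n × Fin n =>
    if p.1 ∈ j then ((v p.1 : ℝ) - x p.1) - (if p.2 ∈ j then 0 else (v p.2 : ℝ) - x p.2) else 1)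

lemma gap_continuous (v : Fin n → ℤ) (j : Finset (Fin n)) : Continuous (gap v j) := by
  unfold gap
  refine Continuous.finset_inf'_apply _ fun p _ => ?_
  split_ifs <;> fun_prop

lemma le_gap {c : ℝ} (hc : c ≤ 1) {j : Finset (Fin n)} {x : Fin n → ℝ} :
    c ≤ gap v j x ↔ ∀ i ∈ j, c ≤ v i - x i ∧ ∀ k, k ∉ j → c ≤ (v i - x i) - (v k - x k) := by
  unfold gap
  rw [Finset.le_inf'_iff]
  constructor
  · intro h i hi
    refine ⟨?_, fun k hk => ?_⟩
    · have := h (i, i) (Finset.mem_univ _)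
      simpa [hi] using this
    · have := h (i, k) (Finset.mem_univ _)
      simpa [hi, hk] using this
  · rintro h ⟨i, k⟩ -
    by_cases hi : i ∈ j
    · by_cases hk : k ∈ j
      · simpa [hi, hk] using (h i hi).1
      · simpa [hi, hk] using (h i hi).2 k hk
    · simpa [hi] using hc

lemma gap_comparable (h0 : 0 < δ) (h1 : δ < 1) {j j' : Finset (Fin n)} {x : Fin n → ℝ}
    (h : δ ≤ gap v j x) (h' : δ ≤ gap v j' x) : j ⊆ j' ∨ j' ⊆ j := by
  by_contra hc
  push Not at hc
  obtain ⟨i, hi, hi'⟩ := Finset.not_subset.1 hc.1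
  obtain ⟨k, hk, hk'⟩ := Finset.not_subset.1 hc.2
  have a := ((le_gap h1.le).1 h i hi).2 k hk'
  have b := ((le_gap h1.le).1 h' k hk).2 i hi'
  linarith

lemma gap_cube (h0 : 0 < δ) (h1 : δ < 1) {j : Finset (Fin n)} {x : Fin n → ℝ}
    (hx : x ∈ geomReal K v) (h : δ ≤ gap v j x) : cube v (ind j) ⊆ K := by
  obtain ⟨g1, g2, J, g3, g4⟩ := mem_geom.1 hx
  refine (cube_ind_mono v ?_).trans g4
  intro i hi
  by_contra hJ
  have := ((le_gap h1.le).1 h i hi).1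
  rw [g3 i hJ] at this
  linarith

lemma std_vt (h0 : 0 < δ) (h1 : δ < 1) {j : Finset (Fin n)} {x : Fin n → ℝ}
    (hx : x ∈ geomReal K v) (h : δ ≤ gap v j x) : std v δ x (ht (vt v j)) = vt v j := by
  obtain ⟨g1, g2, -⟩ := mem_geom.1 hx
  have key := (le_gap h1.le).1 h
  have hy := geom_ge g1 g2
  have hr : ∃ r : unitInterval, (∀ i ∈ j, δ ≤ v i - x i - r) ∧ ∀ i, i ∉ j → v i - x i ≤ r := by
    by_cases hne : (jᶜ : Finset (Fin n)).Nonempty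
    · obtain ⟨k, hk, hmax⟩ := Finset.exists_max_image jᶜ (fun i => (v i : ℝ) - x i) hne
      refine ⟨⟨v k - x k, sub_nonneg.2 (g1 k), hy k⟩, fun i hi => ?_, fun i hi => ?_⟩
      · exact (key i hi).2 k (Finset.mem_compl.1 hk)
      · exact hmax i (Finset.mem_compl.2 hi)
    · refine ⟨0, fun i hi => ?_, fun i hi => ?_⟩
      · simpa using (key i hi).1
      · exact absurd ⟨i, Finset.mem_compl.2 hi⟩ hne
  obtain ⟨r, hr1, hr2⟩ := hr
  have e : eC v δ x r = vt v j := eP_vt h0 h1 hr1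
    (fun i _ => by have := hy i; have := r.2.1; linarith) hr2
  rw [← e]
  exact nat_ht (eC_mono h0 x) r

lemma exists_gap_s17 {x : Fin n → ℝ} (g1 : x ≤ toR v) (g2 : ht x = ht (toR v) - 1) :
    ∃ j : Finset (Fin n), j.Nonempty ∧ 1 / (n : ℝ) ^ 2 ≤ gap v j x := by
  have hn : 0 < (n : ℝ) := by exact_mod_cast Nat.pos_of_ne_zero (NeZero.ne n)
  have hn1 : 1 ≤ (n : ℝ) := by exact_mod_cast Nat.pos_of_ne_zero (NeZero.ne n)
  set g : ℝ := 1 / (n : ℝ) ^ 2 with hg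
  have hg0 : 0 < g := by positivity
  have hg1 : g ≤ 1 := by
    rw [hg, div_le_one (by positivity)]; nlinarith
  have hgn : (n : ℝ) * g = 1 / n := by rw [hg]; field_simp
  let S : Finset (Finset (Fin n)) := Finset.univ.filter fun j => j.Nonempty ∧
    ∀ i ∈ j, 1 / (n : ℝ) - (j.card - 1) * g ≤ v i - x i
  have hS : S.Nonempty := by
    have hsum : ∑ i, ((v i : ℝ) - x i) = 1 := by
      rw [Finset.sum_sub_distrib]
      simp only [ht, toR] at g2
      linarith
    have : ∃ i, 1 / (n : ℝ) ≤ v i - x i := by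
      by_contra hc
      push Not at hc
      have := Finset.sum_lt_sum_of_nonempty (s := (Finset.univ : Finset (Fin n)))
        Finset.univ_nonempty (fun i _ => hc i)
      rw [hsum] at this
      simp [hn.ne'] at this
    obtain ⟨i, hi⟩ := this
    refine ⟨{i}, ?_⟩
    simp only [S, Finset.mem_filter, Finset.mem_univ, true_and, Finset.singleton_nonempty,
      Finset.mem_singleton, forall_eq, Finset.card_singleton]
    simpa using hi
  obtain ⟨j, hj, hmax⟩ := Finset.exists_max_image S Finset.card hS
  simp only [S, Finset.mem_filter, Finset.mem_univ, true_and] at hj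
  refine ⟨j, hj.1, (le_gap hg1).2 fun i hi => ⟨?_, fun k hk => ?_⟩⟩
  · have h1 := hj.2 i hi
    have h2 : (j.card : ℝ) ≤ n := by
      have := Finset.card_le_univ j
      rw [Fintype.card_fin] at this
      exact_mod_cast this
    nlinarith
  · have h1 := hj.2 i hi
    have h2 : (v k : ℝ) - x k < 1 / n - j.card * g := by
      by_contra hc
      push Not at hc
      have : insert k j ∈ S := by
        simp only [S, Finset.mem_filter, Finset.mem_univ, true_and]
        refine ⟨Finset.insert_nonempty _ _, fun l hl => ?_⟩
        rw [Finset.card_insert_of_notMem hk]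
        push_cast
        rw [add_sub_cancel_right]
        rcases Finset.mem_insert.1 hl with rfl | hl
        · exact hc
        · have := hj.2 l hl
          linarith
      have := hmax _ this
      rw [Finset.card_insert_of_notMem hk] at this
      omega
    linarith

end GAP

/-! ### The deformation to pushed paths -/

section DEF
variable {n : ℕ} [NeZero n] {K : Set (Fin n → ℝ)} {w v : Fin n → ℤ} {δ : ℝ}

lemma gP_continuous : Continuous
    (fun p : (unitInterval × NPath K (toR w) (toR v)) × unitInterval =>
      gP v δ p.1.2.1 p.1.1 (aff (toR w) (toR v) p.2)) := by
  unfold gP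
  have hN : Continuous (fun p : (unitInterval × NPath K (toR w) (toR v)) × unitInterval =>
    p.1.2) := by fun_prop
  have ha : Continuous (fun p : (unitInterval × NPath K (toR w) (toR v)) × unitInterval =>
    aff (toR w) (toR v) p.2) := aff_continuous.comp continuous_snd
  have h1 := NPath.eval_comp hN ha
  have h2 := NPath.eval_comp hN (ha.min (continuous_const (y := ht (toR v) - 1)))
  have h3 : Continuous (fun p : (unitInterval × NPath K (toR w) (toR v)) × unitInterval =>
    max 0 (aff (toR w) (toR v) p.2 - (ht (toR v) - 1))) := by fun_prop
  have h4 := (eP_continuous (v := v) (δ := δ)).comp (h2.prodMk h3)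
  simp only [Function.comp_def] at h4
  fun_prop

/-- The deformation of height paths, with values in dipaths. -/
noncomputable def dC (hK : CubeClosed K) (h0 : 0 < δ) (h1 : δ < 1) (hne : w ≠ v)
    (p : unitInterval × NPath K (toR w) (toR v)) : DipathSpace K (toR w) (toR v) :=
  ⟨⟨fun τ => gP v δ p.2.1 p.1 (aff (toR w) (toR v) τ),
    gP_continuous.comp (Continuous.prodMk continuous_const continuous_id)⟩,
    fun _ => gP_mem_K hK h0 h1 hne p.2.2 p.1.2.1 p.1.2.2 _,
    by simp only [ContinuousMap.coe_mk, aff_zero]; exact gP_start h0 h1 hne p.2.2 _,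
    by simp only [ContinuousMap.coe_mk, aff_one]; exact gP_end h0 h1 hne p.2.2 _,
    fun _ _ h => gP_mono h0 p.2.2 p.1.2.1 p.1.2.2 (aff_mono (NPath.ht_le p.2.2) h)⟩

lemma dC_continuous (hK : CubeClosed K) (h0 : 0 < δ) (h1 : δ < 1) (hne : w ≠ v) :
    Continuous (dC hK h0 h1 hne) :=
  Continuous.subtype_mk (curry_continuous gP_continuous _) _

lemma dC_zero (hK : CubeClosed K) (h0 : 0 < δ) (h1 : δ < 1) (hne : w ≠ v)
    (γ : NPath K (toR w) (toR v)) : natS (dC hK h0 h1 hne (0, γ)) = γ := by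
  have : dC hK h0 h1 hne (0, γ) = iota γ := by
    ext τ : 2
    simp [dC, iota, gP]
  rw [this]
  exact Subtype.ext (nat_iota γ)

lemma dC_one (hK : CubeClosed K) (h0 : 0 < δ) (h1 : δ < 1) (hne : w ≠ v)
    (γ : NPath K (toR w) (toR v)) {t : ℝ} (ht' : ht (eP v δ (γ.1 (ht (toR v) - 1)) 0) ≤ t) :
    (natS (dC hK h0 h1 hne (1, γ))).1 t = std v δ (γ.1 (ht (toR v) - 1)) t := by
  have hx := end_mem_geom hK hne γ.2
  have hg := ht_gap (NPath.le γ.2) hne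
  set x := γ.1 (ht (toR v) - 1) with hxd
  obtain ⟨r, e, f⟩ := nat_get (eC_mono (v := v) h0 x) t
  have hE := eC_mem h0 h1 hx
  rw [hE.2.1, hE.2.2.1] at f
  have hr0 := r.2.1
  have hr1 := r.2.2
  obtain ⟨τ, hτ⟩ := aff_surj (a := toR w) (b := toR v) (t := ht (toR v) - 1 + r)
    (by linarith) (by linarith)
  have hD := (dC hK h0 h1 hne (1, γ)).2
  have hval : (dC hK h0 h1 hne (1, γ)).1 τ = eC v δ x r := by
    simp only [dC, ContinuousMap.coe_mk, hτ, gP, eC]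
    rw [min_eq_right (by linarith), add_sub_cancel_left, max_eq_right hr0]
    simp [hxd]
  unfold std
  rw [e, ← hval]
  refine nat_eq hD.2.2.2 ?_
  rw [hD.2.1, hD.2.2.1]
  have hle : ht (toR w) ≤ ht ((dC hK h0 h1 hne (1, γ)).1 τ) := by
    have := ht_mono (hD.2.2.2 (unitInterval.nonneg' (t := τ)))
    rwa [hD.2.1] at this
  rw [hval] at hle ⊢
  have h2 : ht (eP v δ x 0) ≤ min t (ht (toR v)) :=
    le_min ht' (NPath.ht_le (std_mem h0 h1 hx))
  rw [max_eq_right h2] at f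
  rw [f] at hle ⊢
  rw [max_eq_right hle]

end DEF

/-! ### Iterated contraction of initial parts -/

section FOLD
variable {n : ℕ} [NeZero n] {K : Set (Fin n → ℝ)} {w v : Fin n → ℤ} {δ : ℝ}

/-- A contraction of a set of height paths, as raw functions. -/
def ContrData (S : Set (ℝ → Fin n → ℝ))
    (H : unitInterval → (ℝ → Fin n → ℝ) → (ℝ → Fin n → ℝ)) (c : ℝ → Fin n → ℝ) : Prop :=
  c ∈ S ∧ (∀ u, ∀ γ ∈ S, H u γ ∈ S) ∧ (∀ γ ∈ S, H 0 γ = γ) ∧ (∀ γ ∈ S, H 1 γ = c) ∧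
    ContinuousOn (fun p : unitInterval × (ℝ → Fin n → ℝ) => H p.1 p.2) (Set.univ ×ˢ S)

open Classical in
lemma exists_contrData (S : Set (ℝ → Fin n → ℝ)) [ContractibleSpace S] :
    ∃ H c, ContrData S H c := by
  obtain ⟨c, ⟨F⟩⟩ := id_nullhomotopic S
  refine ⟨fun u γ => if h : γ ∈ S then (F (u, ⟨γ, h⟩)).1 else γ, c.1, c.2, ?_, ?_, ?_, ?_⟩
  · intro u γ hγ
    simp only [hγ, dif_pos]
    exact Subtype.coe_prop _
  · intro γ hγ
    simp [hγ]
  · intro γ hγ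
    simp [hγ]
  · rw [continuousOn_iff_continuous_restrict]
    have : Continuous (fun p : ((Set.univ : Set unitInterval) ×ˢ S : Set _) =>
      (F (p.1.1, ⟨p.1.2, p.2.2⟩)).1) := by
      refine continuous_subtype_val.comp (F.continuous.comp ?_)
      exact (continuous_fst.comp continuous_subtype_val).prodMk
        ((continuous_snd.comp continuous_subtype_val).subtype_mk _)
    convert this using 1
    funext p
    simp [Set.restrict, p.2.2]

/-- Contraction parameter attached to `j`. -/
noncomputable def uu (v : Fin n → ℤ) (δ : ℝ) (j : Finset (Fin n)) (x : Fin n → ℝ) : unitInterval :=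
  Set.projIcc 0 1 zero_le_one ((gap v j x - δ) / δ)

lemma uu_continuous (v : Fin n → ℤ) (δ : ℝ) (j : Finset (Fin n)) : Continuous (uu v δ j) := by
  have := gap_continuous v j
  exact continuous_projIcc.comp (by fun_prop)

lemma uu_zero {j : Finset (Fin n)} {x : Fin n → ℝ} (h : gap v j x = δ) : uu v δ j x = 0 := by
  unfold uu
  rw [h, sub_self, zero_div, Set.projIcc_left]
  rfl

lemma uu_one {j : Finset (Fin n)} {x : Fin n → ℝ} (h0 : 0 < δ) (h : 2 * δ ≤ gap v j x) :
    uu v δ j x = 1 := by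
  unfold uu
  refine Set.projIcc_of_right_le _ ?_
  rw [le_div_iff₀ h0]; linarith

/-- States: a height path, a point of the link, a time. -/
abbrev St (n : ℕ) := (ℝ → Fin n → ℝ) × (Fin n → ℝ) × unitInterval

/-- Admissible states for the list `l` of sets still to be processed. -/
def QS (K : Set (Fin n → ℝ)) (w v : Fin n → ℤ) (δ : ℝ) (l : List (Finset (Fin n))) :
    Set (St n) :=
  {s | s.1 ∈ NPath K (toR w) (toR v) ∧ s.2.1 ∈ geomReal K v ∧
    ∀ j ∈ l, δ ≤ gap v j s.2.1 → ∀ t, ht (vt v j) ≤ t → s.1 t = std v δ s.2.1 t}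

/-- Contract the part of the path before `v - j`. -/
noncomputable def step (v : Fin n → ℤ) (δ : ℝ)
    (H : Finset (Fin n) → unitInterval → (ℝ → Fin n → ℝ) → (ℝ → Fin n → ℝ))
    (j : Finset (Fin n)) (s : St n) : St n :=
  (if δ ≤ gap v j s.2.1 then
    glue_s17 (vt v j) (H j (s.2.2 * uu v δ j s.2.1) (restr (vt v j) s.1)) s.1 else s.1, s.2)

/-- Iterated contraction. -/
noncomputable def FF (v : Fin n → ℤ) (δ : ℝ)
    (H : Finset (Fin n) → unitInterval → (ℝ → Fin n → ℝ) → (ℝ → Fin n → ℝ)) :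
    List (Finset (Fin n)) → St n → (ℝ → Fin n → ℝ)
  | [], s => s.1
  | j :: l, s => FF v δ H l (step v δ H j s)

/-- Standing hypothesis: contractions for all the predecessors. -/
def AllContr (K : Set (Fin n → ℝ)) (w v : Fin n → ℤ)
    (H : Finset (Fin n) → unitInterval → (ℝ → Fin n → ℝ) → (ℝ → Fin n → ℝ))
    (c : Finset (Fin n) → ℝ → Fin n → ℝ) : Prop :=
  ∀ j : Finset (Fin n), j.Nonempty → cube v (ind j) ⊆ K →
    ContrData (NPath K (toR w) (vt v j)) (H j) (c j)

variable {H : Finset (Fin n) → unitInterval → (ℝ → Fin n → ℝ) → (ℝ → Fin n → ℝ)}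
  {c : Finset (Fin n) → ℝ → Fin n → ℝ}

lemma QS_vt (h0 : 0 < δ) (h1 : δ < 1) {l : List (Finset (Fin n))} {s : St n}
    (hs : s ∈ QS K w v δ l) {j : Finset (Fin n)} (hj : j ∈ l) (hg : δ ≤ gap v j s.2.1) :
    s.1 (ht (vt v j)) = vt v j := by
  rw [hs.2.2 j hj hg _ le_rfl]
  exact std_vt h0 h1 hs.2.1 hg

lemma step_mapsTo (h0 : 0 < δ) (h1 : δ < 1) (hH : AllContr K w v H c)
    {j : Finset (Fin n)} {l : List (Finset (Fin n))} (hj : j.Nonempty) (hl : ∀ j' ∈ l, ¬ j ⊂ j')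
    {s : St n} (hs : s ∈ QS K w v δ (j :: l)) : step v δ H j s ∈ QS K w v δ l := by
  by_cases hg : δ ≤ gap v j s.2.1
  · have hvt := QS_vt h0 h1 hs List.mem_cons_self hg
    have hC := hH j hj (gap_cube h0 h1 hs.2.1 hg)
    simp only [step, if_pos hg]
    refine ⟨glue_mem (hC.2.1 _ _ (restr_mem hs.1 hvt)) hs.1 hvt, hs.2.1, fun j' hj' hg' t ht' => ?_⟩
    have hsub : j' ⊆ j := by
      rcases gap_comparable h0 h1 hg hg' with h | h
      · by_contra hn
        exact hl j' hj' ⟨h, hn⟩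
      · exact h
    have : ht (vt v j) ≤ t := (ht_mono (vt_anti v hsub)).trans ht'
    dsimp only
    rw [glue_of_ge this]
    exact hs.2.2 j' (List.mem_cons_of_mem _ hj') hg' t ht'
  · simp only [step, if_neg hg]
    exact ⟨hs.1, hs.2.1, fun j' hj' => hs.2.2 j' (List.mem_cons_of_mem _ hj')⟩

lemma step_continuousOn (h0 : 0 < δ) (h1 : δ < 1) (hH : AllContr K w v H c)
    {j : Finset (Fin n)} {l : List (Finset (Fin n))} (hj : j.Nonempty) :
    ContinuousOn (step v δ H j) (QS K w v δ (j :: l)) := by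
  have hgc : Continuous (fun s : St n => gap v j s.2.1) :=
    (gap_continuous v j).comp (continuous_fst.comp continuous_snd)
  have hcl1 : closure {s : St n | δ ≤ gap v j s.2.1} ⊆ {s | δ ≤ gap v j s.2.1} :=
    (isClosed_le continuous_const hgc).closure_subset
  have hcl2 : closure {s : St n | ¬ δ ≤ gap v j s.2.1} ⊆ {s | gap v j s.2.1 ≤ δ} := by
    refine closure_minimal (fun s hs => ?_) (isClosed_le hgc continuous_const)
    exact (not_le.1 hs).le
  unfold step
  refine ContinuousOn.prodMk (ContinuousOn.if ?_ ?_ continuousOn_fst) continuousOn_snd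
  · rintro s ⟨hs, hf⟩
    have e : gap v j s.2.1 = δ := by
      rw [frontier_eq_closure_inter_closure] at hf
      exact le_antisymm (hcl2 hf.2) (hcl1 hf.1)
    have hvt := QS_vt h0 h1 hs List.mem_cons_self e.ge
    have hC := hH j hj (gap_cube h0 h1 hs.2.1 e.ge)
    rw [uu_zero e, mul_zero, hC.2.2.1 _ (restr_mem hs.1 hvt), glue_restr]
  · by_cases hK : cube v (ind j) ⊆ K
    · have hC := (hH j hj hK).2.2.2.2
      have hcont : ContinuousOn (fun s : St n =>
          H j (s.2.2 * uu v δ j s.2.1) (restr (vt v j) s.1))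
          (QS K w v δ (j :: l) ∩ closure {s | δ ≤ gap v j s.2.1}) := by
        refine hC.comp (f := fun s : St n => (s.2.2 * uu v δ j s.2.1, restr (vt v j) s.1)) ?_ ?_
        · refine Continuous.continuousOn ?_
          have hu := uu_continuous v δ j
          have hr : Continuous (fun s : St n => restr (vt v j) s.1) := by
            refine continuous_pi fun t => ?_
            exact (continuous_apply _).comp continuous_fst
          have hu' : Continuous (fun s : St n => s.2.2 * uu v δ j s.2.1) := by fun_prop
          exact hu'.prodMk hr
        · intro s hs
          exact ⟨Set.mem_univ _, restr_mem hs.1.1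
            (QS_vt h0 h1 hs.1 List.mem_cons_self (hcl1 hs.2))⟩
      refine continuousOn_pi.2 fun t => ?_
      unfold glue_s17
      by_cases ht' : t < ht (vt v j)
      · simp only [ht', if_true]
        exact (continuous_apply t).comp_continuousOn hcont
      · simp only [ht', if_false]
        exact ((continuous_apply t).comp continuous_fst).continuousOn
    · convert continuousOn_empty _
      ext s
      simp only [Set.mem_inter_iff, Set.mem_empty_iff_false, iff_false, not_and]
      intro hs hs2
      exact hK (gap_cube h0 h1 hs.2.1 (hcl1 hs2))

/-- Lists with nonempty entries, larger sets first. -/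
def GoodList (l : List (Finset (Fin n))) : Prop :=
  (∀ j ∈ l, j.Nonempty) ∧ l.Pairwise (fun a b => ¬ a ⊂ b)

lemma GoodList.tail {j : Finset (Fin n)} {l : List (Finset (Fin n))} (h : GoodList (j :: l)) :
    j.Nonempty ∧ (∀ j' ∈ l, ¬ j ⊂ j') ∧ GoodList l :=
  ⟨h.1 j List.mem_cons_self, (List.pairwise_cons.1 h.2).1,
    fun i hi => h.1 i (List.mem_cons_of_mem _ hi), (List.pairwise_cons.1 h.2).2⟩

lemma FF_continuousOn (h0 : 0 < δ) (h1 : δ < 1) (hH : AllContr K w v H c) :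
    ∀ {l : List (Finset (Fin n))}, GoodList l → ContinuousOn (FF v δ H l) (QS K w v δ l)
  | [], _ => continuousOn_fst
  | _ :: _, hl =>
    (FF_continuousOn h0 h1 hH hl.tail.2.2).comp (step_continuousOn h0 h1 hH hl.tail.1)
      fun _ hs => step_mapsTo h0 h1 hH hl.tail.1 hl.tail.2.1 hs

lemma FF_mem (h0 : 0 < δ) (h1 : δ < 1) (hH : AllContr K w v H c) :
    ∀ {l : List (Finset (Fin n))}, GoodList l → ∀ {s : St n}, s ∈ QS K w v δ l →
      FF v δ H l s ∈ NPath K (toR w) (toR v)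
  | [], _, _, hs => hs.1
  | _ :: _, hl, _, hs =>
    FF_mem h0 h1 hH hl.tail.2.2 (step_mapsTo h0 h1 hH hl.tail.1 hl.tail.2.1 hs)

lemma FF_zero (h0 : 0 < δ) (h1 : δ < 1) (hH : AllContr K w v H c) :
    ∀ {l : List (Finset (Fin n))}, GoodList l → ∀ {s : St n}, s ∈ QS K w v δ l → s.2.2 = 0 →
      FF v δ H l s = s.1
  | [], _, _, _, _ => rfl
  | j :: l, hl, s, hs, hz => by
    have := FF_zero h0 h1 hH hl.tail.2.2 (step_mapsTo h0 h1 hH hl.tail.1 hl.tail.2.1 hs) hz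
    refine this.trans ?_
    simp only [step]
    split_ifs with hg
    · have hvt := QS_vt h0 h1 hs List.mem_cons_self hg
      have hC := hH j hl.tail.1 (gap_cube h0 h1 hs.2.1 hg)
      rw [hz, zero_mul, hC.2.2.1 _ (restr_mem hs.1 hvt), glue_restr]
    · rfl

lemma FF_end : ∀ {l : List (Finset (Fin n))}, (∀ j ∈ l, j.Nonempty) → ∀ s : St n,
      FF v δ H l s (ht (toR v) - 1) = s.1 (ht (toR v) - 1)
  | [], _, _ => rfl
  | j :: l, hl, s => by
    have := FF_end (l := l) (fun i hi => hl i (List.mem_cons_of_mem _ hi)) (step v δ H j s)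
    refine this.trans ?_
    simp only [step]
    split_ifs with hg
    · rw [glue_of_ge]
      rw [ht_vt]
      have : 1 ≤ j.card := (hl j List.mem_cons_self).card_pos
      have : (1 : ℝ) ≤ j.card := by exact_mod_cast this
      linarith
    · rfl

lemma FF_restart (h0 : 0 < δ) (h1 : δ < 1) (hH : AllContr K w v H c)
    {j : Finset (Fin n)} {l' : List (Finset (Fin n))} :
    ∀ {l : List (Finset (Fin n))}, GoodList (l ++ j :: l') → ∀ {s : St n},
      s ∈ QS K w v δ (l ++ j :: l') → s.2.2 = 1 → 2 * δ ≤ gap v j s.2.1 →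
      FF v δ H (l ++ j :: l') s = FF v δ H l' (glue_s17 (vt v j) (c j) (std v δ s.2.1), s.2.1, 1)
  | [], hl, s, hs, hz, hg => by
    have hg' : δ ≤ gap v j s.2.1 := by linarith
    have hvt := QS_vt h0 h1 hs List.mem_cons_self hg'
    have hC := hH j hl.tail.1 (gap_cube h0 h1 hs.2.1 hg')
    simp only [List.nil_append, FF, step]
    rw [if_pos hg', uu_one h0 hg, hz, mul_one, hC.2.2.2.1 _ (restr_mem hs.1 hvt)]
    congr 1
    refine Prod.ext ?_ (Prod.ext rfl hz)
    funext t
    simp only [glue_s17]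
    split_ifs with ht'
    · rfl
    · exact hs.2.2 j List.mem_cons_self hg' t (not_lt.1 ht')
  | _ :: _, hl, _, hs, hz, hg =>
    FF_restart h0 h1 hH hl.tail.2.2 (step_mapsTo h0 h1 hH hl.tail.1 hl.tail.2.1 hs) hz hg

lemma start_mem (h0 : 0 < δ) (h1 : δ < 1) (hH : AllContr K w v H c)
    {j : Finset (Fin n)} (hj : j.Nonempty) {l : List (Finset (Fin n))} {x : Fin n → ℝ}
    (hx : x ∈ geomReal K v) (hg : δ ≤ gap v j x)
    (hl : ∀ j' ∈ l, δ ≤ gap v j' x → j' ⊆ j) (u : unitInterval) :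
    ((glue_s17 (vt v j) (c j) (std v δ x), x, u) : St n) ∈ QS K w v δ l := by
  have hC := hH j hj (gap_cube h0 h1 hx hg)
  refine ⟨glue_mem hC.1 (std_mem h0 h1 hx) (std_vt h0 h1 hx hg), hx, fun j' hj' hg' t ht' => ?_⟩
  exact glue_of_ge ((ht_mono (vt_anti v (hl j' hj' hg'))).trans ht')

lemma exists_goodList : ∃ l : List (Finset (Fin n)), GoodList l ∧ ∀ j, j.Nonempty → j ∈ l := by
  let r : Finset (Fin n) → Finset (Fin n) → Bool := fun a b => decide (b.card ≤ a.card)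
  refine ⟨((Finset.univ.filter fun j : Finset (Fin n) => j.Nonempty).toList).mergeSort r,
    ⟨fun j hj => ?_, ?_⟩, fun j hj => ?_⟩
  · simpa using hj
  · have := List.pairwise_mergeSort (le := r) (by simp only [r, decide_eq_true_eq]; intros; omega)
      (by simp only [r, Bool.or_eq_true, decide_eq_true_eq]; intros; omega)
      ((Finset.univ.filter fun j : Finset (Fin n) => j.Nonempty).toList)
    refine this.imp fun {a b} hab hlt => ?_
    have := Finset.card_lt_card hlt
    simp only [r, decide_eq_true_eq] at hab
    omega
  · simpa using hj

end FOLD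

/-! ### The homotopy equivalence of dipath spaces with past links -/

section LEMB
variable {n : ℕ} [NeZero n] {K : Set (Fin n → ℝ)} {w v : Fin n → ℤ} {δ : ℝ}
  {H : Finset (Fin n) → unitInterval → (ℝ → Fin n → ℝ) → (ℝ → Fin n → ℝ)}
  {c : Finset (Fin n) → ℝ → Fin n → ℝ}

lemma exists_star (h0 : 0 < δ) (h1 : δ < 1) {x : Fin n → ℝ}
    (hx : ∃ j : Finset (Fin n), j.Nonempty ∧ δ ≤ gap v j x) :
    ∃ j : Finset (Fin n), j.Nonempty ∧ δ ≤ gap v j x ∧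
      ∀ j' : Finset (Fin n), δ ≤ gap v j' x → j' ⊆ j := by
  classical
  let S : Finset (Finset (Fin n)) := Finset.univ.filter fun j => j.Nonempty ∧ δ ≤ gap v j x
  obtain ⟨j0, hj0⟩ := hx
  obtain ⟨j, hj, hmax⟩ := Finset.exists_max_image S Finset.card ⟨j0, by simpa [S] using hj0⟩
  simp only [S, Finset.mem_filter, Finset.mem_univ, true_and] at hj hmax
  refine ⟨j, hj.1, hj.2, fun j' hj' => ?_⟩
  rcases gap_comparable h0 h1 hj.2 hj' with h | h
  · have := hmax j' ⟨hj.1.mono h, hj'⟩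
    exact (Finset.eq_of_subset_of_card_le h this).ge
  · exact h

lemma exists_section (h0 : 0 < δ) (h1 : δ < 1) (h2 : 2 * δ = 1 / (n : ℝ) ^ 2)
    (hH : AllContr K w v H c) {L : List (Finset (Fin n))} (hL : GoodList L)
    (hall : ∀ j : Finset (Fin n), j.Nonempty → j ∈ L) :
    ∃ s : C(geomReal K v, NPath K (toR w) (toR v)),
      (∀ x, (s x).1 (ht (toR v) - 1) = std v δ x.1 (ht (toR v) - 1)) ∧
      ∀ x : geomReal K v, ∀ st ∈ QS K w v δ L, st.2.1 = x.1 → st.2.2 = 1 →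
        FF v δ H L st = (s x).1 := by
  have hgap : ∀ x : geomReal K v, ∃ j : Finset (Fin n), j.Nonempty ∧ 2 * δ ≤ gap v j x.1 := by
    intro x
    obtain ⟨g1, g2, -⟩ := mem_geom.1 x.2
    rw [h2]
    exact exists_gap_s17 g1 g2
  have hstar : ∀ x : geomReal K v, ∃ j : Finset (Fin n), j.Nonempty ∧ δ ≤ gap v j x.1 ∧
      ∀ j' : Finset (Fin n), δ ≤ gap v j' x.1 → j' ⊆ j := by
    intro x
    obtain ⟨j, hj, hg⟩ := hgap x
    exact exists_star h0 h1 ⟨j, hj, by linarith⟩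
  choose J hJ1 hJ2 hJ3 using hstar
  have hst : ∀ x : geomReal K v,
      ((glue_s17 (vt v (J x)) (c (J x)) (std v δ x.1), x.1, 1) : St n) ∈ QS K w v δ L := fun x =>
    start_mem h0 h1 hH (hJ1 x) x.2 (hJ2 x) (fun j' _ h => hJ3 x j' h) 1
  let s : geomReal K v → NPath K (toR w) (toR v) := fun x =>
    ⟨FF v δ H L (glue_s17 (vt v (J x)) (c (J x)) (std v δ x.1), x.1, 1), FF_mem h0 h1 hH hL (hst x)⟩
  have hs : Continuous s := by
    have hlf : LocallyFinite fun j : {j : Finset (Fin n) // j.Nonempty} =>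
      {x : geomReal K v | 2 * δ ≤ gap v j.1 x.1} := locallyFinite_of_finite _
    refine hlf.continuous ?_ ?_ ?_
    · rw [Set.eq_univ_iff_forall]
      intro x
      obtain ⟨j, hj, hg⟩ := hgap x
      exact Set.mem_iUnion.2 ⟨⟨j, hj⟩, hg⟩
    · intro j
      exact isClosed_le continuous_const ((gap_continuous v j.1).comp continuous_subtype_val)
    · rintro ⟨j, hj⟩
      obtain ⟨l, l', e⟩ := List.append_of_mem (hall j hj)
      have hL' := hL
      rw [e] at hL'
      have hl' : GoodList l' ∧ ∀ j' ∈ l', ¬ j ⊂ j' := by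
        have h3 := List.pairwise_append.1 hL'.2
        have h4 := List.pairwise_cons.1 h3.2.1
        exact ⟨⟨fun i hi => hL'.1 i (by simp [hi]), h4.2⟩, h4.1⟩
      rw [Topology.IsInducing.subtypeVal.continuousOn_iff]
      have key : ContinuousOn (fun x : geomReal K v =>
          FF v δ H l' (glue_s17 (vt v j) (c j) (std v δ x.1), x.1, 1))
          {x : geomReal K v | 2 * δ ≤ gap v j x.1} := by
        refine (FF_continuousOn h0 h1 hH hl'.1).comp
          (f := fun x : geomReal K v => ((glue_s17 (vt v j) (c j) (std v δ x.1), x.1, 1) : St n)) ?_ ?_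
        · refine Continuous.continuousOn ?_
          refine Continuous.prodMk ?_ (by fun_prop)
          refine continuous_pi fun t => ?_
          unfold glue_s17
          split_ifs with htt
          · exact continuous_const
          · exact (continuous_apply t).comp ((std_continuous h0).comp continuous_subtype_val)
        · intro x hx
          have hx' : δ ≤ gap v j x.1 := by
            have : 2 * δ ≤ gap v j x.1 := hx
            linarith
          refine start_mem h0 h1 hH hj x.2 hx' (fun j' hj' hg => ?_) 1
          rcases gap_comparable h0 h1 hx' hg with h | h
          · by_contra hn
            exact hl'.2 j' hj' ⟨h, hn⟩
          · exact h
      refine key.congr fun x hx => ?_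
      have := FF_restart h0 h1 hH hL' (s := (glue_s17 (vt v (J x)) (c (J x)) (std v δ x.1), x.1, 1))
        (e ▸ hst x) rfl hx
      simp only [Function.comp, s]
      rw [e, this]
  refine ⟨⟨s, hs⟩, fun x => ?_, fun x st hQ hx hz => ?_⟩
  · simp only [ContinuousMap.coe_mk, s]
    rw [FF_end hL.1]
    dsimp only
    rw [glue_of_ge]
    rw [ht_vt]
    have : 1 ≤ (J x).card := (hJ1 x).card_pos
    have : (1 : ℝ) ≤ (J x).card := by exact_mod_cast this
    linarith
  · obtain ⟨j, hj, hg⟩ := hgap x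
    obtain ⟨l, l', e⟩ := List.append_of_mem (hall j hj)
    have hsx := hst x
    simp only [ContinuousMap.coe_mk, s]
    rw [e] at hL hQ hsx ⊢
    rw [FF_restart h0 h1 hH hL hQ hz (by rw [hx]; exact hg), FF_restart h0 h1 hH hL hsx rfl hg, hx]

lemma geom_conv {x y : Fin n → ℝ} (h0 : 0 < δ) (h1 : δ < 1) (hx : x ∈ geomReal K v)
    (hy : y = std v δ x (ht (toR v) - 1)) (hy2 : ht y = ht (toR v) - 1)
    {r : ℝ} (hr0 : 0 ≤ r) (hr1 : r ≤ 1) : (1 - r) • y + r • x ∈ geomReal K v := by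
  obtain ⟨g1, g2, J, g3, g4⟩ := mem_geom.1 hx
  have hS := std_mem h0 h1 hx
  have hy1 : y ≤ toR v := hy ▸ NPath.le_end hS _
  have hy3 : ∀ i, i ∉ J → y i = v i := by
    intro i hi
    refine le_antisymm (hy1 i) ?_
    have a : vt v J ≤ eP v δ x 0 :=
      (mem_cube_ind.1 (eP_cube h0 h1 (geom_vt_le g1 g2 g3) g1 le_rfl)).1
    have b : eP v δ x 0 ≤ y := hy ▸ NPath.start_le hS _
    have := (a.trans b) i
    rw [vt_apply] at this
    simpa [hi] using this
  refine mem_geom.2 ⟨fun i => ?_, ?_, J, fun i hi => ?_, g4⟩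
  · have a := g1 i
    have b := hy1 i
    simp only [Pi.add_apply, Pi.smul_apply, smul_eq_mul]
    nlinarith
  · have : ht ((1 - r) • y + r • x) = (1 - r) * ht y + r * ht x := by
      simp [ht, Finset.sum_add_distrib, Finset.mul_sum]
    rw [this, hy2, g2]; ring
  · simp only [Pi.add_apply, Pi.smul_apply, smul_eq_mul]
    rw [hy3 i hi, g3 i hi]; ring

lemma lemB_aux (hK : CubeClosed K) (hne : w ≠ v) (hH : AllContr K w v H c) :
    Nonempty (ContinuousMap.HomotopyEquiv (NPath K (toR w) (toR v)) (geomReal K v)) := by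
  have hn1 : 1 ≤ (n : ℝ) := by exact_mod_cast Nat.pos_of_ne_zero (NeZero.ne n)
  obtain ⟨δ, hδ⟩ : ∃ δ : ℝ, δ = 1 / (2 * (n : ℝ) ^ 2) := ⟨_, rfl⟩
  have h0 : 0 < δ := by rw [hδ]; positivity
  have h1 : δ < 1 := by
    rw [hδ, div_lt_one (by positivity)]; nlinarith
  have h2 : 2 * δ = 1 / (n : ℝ) ^ 2 := by rw [hδ]; field_simp
  obtain ⟨L, hL, hall⟩ := exists_goodList (n := n)
  obtain ⟨s, hs1, hs2⟩ := exists_section h0 h1 h2 hH hL hall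
  let p : C(NPath K (toR w) (toR v), geomReal K v) :=
    ⟨fun γ => ⟨γ.1 (ht (toR v) - 1), end_mem_geom hK hne γ.2⟩, by
      refine Continuous.subtype_mk ?_ _
      exact NPath.eval_comp continuous_id continuous_const⟩
  let D : unitInterval × NPath K (toR w) (toR v) → NPath K (toR w) (toR v) :=
    fun q => natS (dC hK h0 h1 hne q)
  have hD : Continuous D := natS_continuous.comp (dC_continuous hK h0 h1 hne)
  have hQ : ∀ (u : unitInterval) (γ : NPath K (toR w) (toR v)),
      (((D (1, γ)).1, (p γ).1, u) : St n) ∈ QS K w v δ L := by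
    intro u γ
    refine ⟨(D (1, γ)).2, (p γ).2, fun j hj hg t htt => ?_⟩
    refine dC_one hK h0 h1 hne γ (le_trans ?_ htt)
    exact (NPath.mid (std_mem h0 h1 (p γ).2) (std_vt h0 h1 (p γ).2 hg)).1
  have A : (ContinuousMap.id _).Homotopic
      (⟨fun γ => D (1, γ), hD.comp (by fun_prop)⟩ : C(NPath K (toR w) (toR v), _)) :=
    ⟨{ toFun := D
       continuous_toFun := hD
       map_zero_left := fun γ => dC_zero hK h0 h1 hne γ
       map_one_left := fun γ => rfl }⟩
  have B : ContinuousMap.Homotopic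
      (⟨fun γ => D (1, γ), hD.comp (by fun_prop)⟩ : C(NPath K (toR w) (toR v), _)) (s.comp p) :=
    ⟨{ toFun := fun q => ⟨FF v δ H L ((D (1, q.2)).1, (p q.2).1, q.1),
          FF_mem h0 h1 hH hL (hQ q.1 q.2)⟩
       continuous_toFun := by
        refine Continuous.subtype_mk ?_ _
        refine (FF_continuousOn h0 h1 hH hL).comp_continuous
          (f := fun q : unitInterval × NPath K (toR w) (toR v) =>
            (((D (1, q.2)).1, (p q.2).1, q.1) : St n)) ?_ (fun q => hQ q.1 q.2)
        have a : Continuous fun q : unitInterval × NPath K (toR w) (toR v) => (D (1, q.2)).1 :=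
          continuous_subtype_val.comp (hD.comp (by fun_prop))
        have b : Continuous fun q : unitInterval × NPath K (toR w) (toR v) => (p q.2).1 :=
          continuous_subtype_val.comp (p.continuous.comp continuous_snd)
        exact a.prodMk (b.prodMk continuous_fst)
       map_zero_left := fun γ => Subtype.ext (FF_zero h0 h1 hH hL (hQ 0 γ) rfl)
       map_one_left := fun γ => Subtype.ext (hs2 (p γ) _ (hQ 1 γ) rfl rfl) }⟩
  have hps : ∀ x, (p (s x)).1 = std v δ x.1 (ht (toR v) - 1) := hs1
  have C : (p.comp s).Homotopic (ContinuousMap.id _) :=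
    ⟨{ toFun := fun q => ⟨(1 - (q.1 : ℝ)) • (p (s q.2)).1 + (q.1 : ℝ) • q.2.1,
          geom_conv h0 h1 q.2.2 (hps q.2) (mem_geom.1 (p (s q.2)).2).2.1 q.1.2.1 q.1.2.2⟩
       continuous_toFun := by
        refine Continuous.subtype_mk ?_ _
        have b : Continuous fun q : unitInterval × geomReal K v => (p (s q.2)).1 :=
          continuous_subtype_val.comp (p.continuous.comp (s.continuous.comp continuous_snd))
        fun_prop
       map_zero_left := fun γ => Subtype.ext (by simp)
       map_one_left := fun γ => Subtype.ext (by simp) }⟩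
  exact ⟨⟨p, s, (A.trans B).symm, C⟩⟩

theorem lemB (hK : CubeClosed K) (hne : w ≠ v)
    (hc : ∀ j ∈ pastlk K v, ContractibleSpace (DipathSpace K (toR w) (toR (v - j)))) :
    Nonempty (ContinuousMap.HomotopyEquiv (DipathSpace K (toR w) (toR v)) (geomReal K v)) := by
  have key : ∀ j : Finset (Fin n), ∃ Hc : (unitInterval → (ℝ → Fin n → ℝ) → (ℝ → Fin n → ℝ)) ×
      (ℝ → Fin n → ℝ), j.Nonempty → cube v (ind j) ⊆ K →
      ContrData (NPath K (toR w) (vt v j)) Hc.1 Hc.2 := by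
    intro j
    by_cases h : j.Nonempty ∧ cube v (ind j) ⊆ K
    · have hj : ind j ∈ pastlk K v := by
        refine ⟨ind_binary j, fun e => ?_, h.2⟩
        obtain ⟨i, hi⟩ := h.1
        have := congrFun e i
        simp [ind, hi] at this
      have : ContractibleSpace (DipathSpace K (toR w) (vt v j)) := hc _ hj
      have : ContractibleSpace (NPath K (toR w) (vt v j)) :=
        (equivNP K (toR w) (vt v j)).symm.contractibleSpace
      obtain ⟨H, c, h⟩ := exists_contrData (NPath K (toR w) (vt v j))
      exact ⟨(H, c), fun _ _ => h⟩
    · exact ⟨(fun _ γ => γ, fun _ => 0), fun a b => absurd ⟨a, b⟩ h⟩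
  choose Hc hHc using key
  obtain ⟨e⟩ := lemB_aux (H := fun j => (Hc j).1) (c := fun j => (Hc j).2) hK hne hHc
  exact ⟨(equivNP K _ _).trans e⟩

end LEMB

/-! ### Contractibility in terms of past links -/

section LEMC
variable {n : ℕ} {K : Set (Fin n → ℝ)} {w v : Fin n → ℤ}

lemma toR_le {a b : Fin n → ℤ} : toR a ≤ toR b ↔ a ≤ b := by
  constructor
  · intro h i
    have := h i
    simpa [toR] using this
  · intro h i
    have := h i
    simpa [toR] using this

lemma contr_self_s17 (hw : toR w ∈ K) : ContractibleSpace (DipathSpace K (toR w) (toR w)) := by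
  have key : ∀ γ ∈ DipathSpace K (toR w) (toR w), γ = ContinuousMap.const _ (toR w) := by
    intro γ hγ
    ext t : 1
    refine le_antisymm ?_ ?_
    · have := hγ.2.2.2 (unitInterval.le_one' (t := t))
      rw [hγ.2.2.1] at this
      exact this
    · have := hγ.2.2.2 (unitInterval.nonneg' (t := t))
      rw [hγ.2.1] at this
      exact this
  have : Unique (DipathSpace K (toR w) (toR w)) :=
    { default := ⟨ContinuousMap.const _ (toR w), fun _ => hw, rfl, rfl, fun _ _ _ => le_rfl⟩
      uniq := fun γ => Subtype.ext (key γ.1 γ.2) }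
  infer_instance

theorem lemC [NeZero n] (hK : CubeClosed K) (hw : toR w ∈ K) (hmin : ∀ q ∈ K, toR w ≤ q) :
    (∀ v : Fin n → ℤ, toR v ∈ K → ContractibleSpace (DipathSpace K (toR w) (toR v))) ↔
    (∀ v : Fin n → ℤ, toR v ∈ K → w ≠ v → ContractibleSpace (geomReal K v)) := by
  have hmem : ∀ v : Fin n → ℤ, ∀ j ∈ pastlk K v, toR (v - j) ∈ K := by
    intro v j hj
    refine hj.2.2 ⟨le_rfl, toR_le.2 ?_⟩
    intro i
    rcases hj.1 i with h | h <;> simp [h]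
  constructor
  · intro h v hv hne
    obtain ⟨e⟩ := lemB hK hne (fun j hj => h _ (hmem v j hj))
    have := h v hv
    exact e.symm.contractibleSpace
  · intro h
    have ind : ∀ m : ℕ, ∀ v : Fin n → ℤ, toR v ∈ K → (∑ i, (v i - w i)).toNat = m →
        ContractibleSpace (DipathSpace K (toR w) (toR v)) := by
      intro m
      induction m using Nat.strong_induction_on with
      | _ m ih =>
        intro v hv hm
        by_cases hne : w = v
        · subst hne
          exact contr_self_s17 hw
        · have : ContractibleSpace (geomReal K v) := h v hv hne
          obtain ⟨e⟩ := lemB (K := K) hK hne (fun j hj => by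
            have hvj := hmem v j hj
            have h0 : 0 ≤ ∑ i, ((v - j) i - w i) := Finset.sum_nonneg fun i _ =>
              sub_nonneg.2 (toR_le.1 (hmin _ hvj) i)
            have h1 : 0 < ∑ i, j i := by
              refine Finset.sum_pos' (fun i _ => ?_) ?_
              · rcases hj.1 i with h | h <;> simp [h]
              · obtain ⟨i, hi⟩ := Function.ne_iff.1 hj.2.1
                refine ⟨i, Finset.mem_univ _, ?_⟩
                rcases hj.1 i with h | h
                · exact absurd h hi
                · simp [h]
            have h2 : ∑ i, ((v - j) i - w i) = ∑ i, (v i - w i) - ∑ i, j i := by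
              rw [← Finset.sum_sub_distrib]
              refine Finset.sum_congr rfl fun i _ => ?_
              simp only [Pi.sub_apply]; ring
            refine ih _ ?_ (v - j) hvj rfl
            omega)
          exact e.contractibleSpace
    exact fun v hv => ind _ v hv rfl

end LEMC

/-! ### Counting maps to a discrete space -/

section DISC

lemma homotopic_bool {X : Type*} [TopologicalSpace X] {f g : C(X, Bool)}
    (h : f.Homotopic g) : f = g := by
  obtain ⟨F⟩ := h
  ext x
  have : Continuous fun t : unitInterval => F (t, x) := by fun_prop
  have := PreconnectedSpace.constant inferInstance this (x := 0) (y := 1)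
  simpa using this

/-- Maps to `Bool` are a homotopy invariant. -/
def boolEquiv {X Y : Type*} [TopologicalSpace X] [TopologicalSpace Y]
    (e : ContinuousMap.HomotopyEquiv X Y) : C(Y, Bool) ≃ C(X, Bool) where
  toFun f := f.comp e.toFun
  invFun f := f.comp e.invFun
  left_inv f := homotopic_bool (by
    have := e.right_inv
    exact (ContinuousMap.Homotopic.comp (ContinuousMap.Homotopic.refl f) this))
  right_inv f := homotopic_bool (by
    have := e.left_inv
    exact (ContinuousMap.Homotopic.comp (ContinuousMap.Homotopic.refl f) this))

variable {n : ℕ} {K : Set (Fin n → ℝ)} {v : Fin n → ℤ}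

lemma geom_vertex {x : Fin n → ℝ} (hx : x ∈ geomReal K v) :
    ∃ i, x i < v i ∧ ∃ h : vt v {i} ∈ geomReal K v, ∀ f : C(geomReal K v, Bool),
      f ⟨x, hx⟩ = f ⟨vt v {i}, h⟩ := by
  obtain ⟨g1, g2, J, g3, g4⟩ := mem_geom.1 hx
  have : ∃ i, x i < v i := by
    by_contra hc
    push Not at hc
    have : ht (toR v) ≤ ht x := ht_mono hc
    linarith
  obtain ⟨i, hi⟩ := this
  have hiJ : i ∈ J := by
    by_contra h
    rw [g3 i h] at hi
    exact lt_irrefl _ hi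
  have hseg : ∀ r : unitInterval, (1 - (r : ℝ)) • x + (r : ℝ) • vt v {i} ∈ geomReal K v := by
    intro r
    have r0 := r.2.1
    have r1 := r.2.2
    refine mem_geom.2 ⟨fun k => ?_, ?_, J, fun k hk => ?_, g4⟩
    · have a : x k ≤ v k := g1 k
      have b : vt v {i} k ≤ v k := by rw [vt_apply]; split_ifs <;> simp
      simp only [Pi.add_apply, Pi.smul_apply, smul_eq_mul, toR]
      nlinarith
    · have : ht ((1 - (r : ℝ)) • x + (r : ℝ) • vt v {i}) = (1 - r) * ht x + r * ht (vt v {i}) := by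
        simp [ht, Finset.sum_add_distrib, Finset.mul_sum]
      rw [this, g2, ht_vt]
      simp only [Finset.card_singleton, Nat.cast_one]; ring
    · have hki : k ≠ i := fun e => hk (e ▸ hiJ)
      simp only [Pi.add_apply, Pi.smul_apply, smul_eq_mul]
      rw [vt_apply, g3 k hk]
      simp only [Finset.mem_singleton, hki, if_false]; ring
  refine ⟨i, hi, by simpa using hseg 1, fun f => ?_⟩
  have hc : Continuous fun r : unitInterval => f ⟨_, hseg r⟩ := by
    refine f.continuous.comp (Continuous.subtype_mk ?_ _)
    fun_prop
  have := PreconnectedSpace.constant inferInstance hc (x := 0) (y := 1)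
  simpa using this

lemma finite_bool : Finite C(geomReal K v, Bool) := by
  classical
  refine Finite.of_injective (β := Fin n → Bool)
    (fun f i => if h : vt v {i} ∈ geomReal K v then f ⟨_, h⟩ else true) ?_
  intro f g hfg
  ext ⟨x, hx⟩
  obtain ⟨i, -, hi, hall⟩ := geom_vertex hx
  have := congrFun hfg i
  simp only [hi, dif_pos] at this
  rw [hall f, hall g, this]

lemma bool_ext {S S' : Set (Fin n → ℝ)} {i : Fin n} {a : ℝ} (hsub : S' ⊆ S)
    (h1 : ∀ x ∈ S, (x i = a ∧ x ∈ S') ∨ x i = a - 1) (h2 : ∀ x ∈ S', x i = a)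
    (f : C(S', Bool)) (b : Bool) : ∃ g : C(S, Bool), g.comp ⟨Set.inclusion hsub,
      continuous_inclusion hsub⟩ = f ∧ ∀ x : S, x.1 i = a - 1 → g x = b := by
  classical
  let g : S → Bool := fun x => if h : x.1 ∈ S' then f ⟨x.1, h⟩ else b
  have hi : Continuous fun x : S => x.1 i := (continuous_apply i).comp continuous_subtype_val
  have hn : ∀ x : S, x.1 i = a - 1 → x.1 ∉ S' := by
    intro x hx h
    have := h2 _ h
    linarith
  have hg : Continuous g := by
    have hlf : LocallyFinite fun c : Bool => {x : S | x.1 i = if c then a else a - 1} :=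
      locallyFinite_of_finite _
    refine hlf.continuous ?_ ?_ ?_
    · rw [Set.eq_univ_iff_forall]
      intro x
      rcases h1 x.1 x.2 with h | h
      · exact Set.mem_iUnion.2 ⟨true, by simpa using h.1⟩
      · exact Set.mem_iUnion.2 ⟨false, by simpa using h⟩
    · intro c
      exact isClosed_eq hi continuous_const
    · rintro (_ | _)
      · refine (continuousOn_const (c := b)).congr fun x hx => ?_
        have := hn x (by simpa using hx)
        simp [g, this]
      · have hm : ∀ x : {x : S | x.1 i = if true = true then a else a - 1}, x.1.1 ∈ S' := by
          rintro ⟨x, hx⟩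
          simp only [if_true, Set.mem_ofPred_eq] at hx
          rcases h1 x.1 x.2 with h | h
          · exact h.2
          · linarith
        rw [continuousOn_iff_continuous_domRestrict]
        have : Continuous fun x : {x : S | x.1 i = if true = true then a else a - 1} =>
            f ⟨x.1.1, hm x⟩ := by
          refine f.continuous.comp (Continuous.subtype_mk ?_ _)
          fun_prop
        convert this using 1
        funext x
        simp only [g, Set.domRestrict]
        exact dif_pos (hm x)
  refine ⟨⟨g, hg⟩, ?_, fun x hx => ?_⟩
  · ext x
    simp [g]
  · have := hn x hx
    simp [g, this]

lemma no_equiv {S S' : Set (Fin n → ℝ)} {i : Fin n} {a : ℝ} (hsub : S' ⊆ S)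
    (h1 : ∀ x ∈ S, (x i = a ∧ x ∈ S') ∨ x i = a - 1) (h2 : ∀ x ∈ S', x i = a)
    {p : Fin n → ℝ} (hp : p ∈ S) (hpi : p i = a - 1) (hfin : Finite C(S, Bool))
    (e : ContinuousMap.HomotopyEquiv S S') : False := by
  let res : C(S, Bool) → C(S', Bool) := fun g => g.comp ⟨Set.inclusion hsub,
      continuous_inclusion hsub⟩
  have hsurj : Function.Surjective res := fun f => by
    obtain ⟨g, hg, -⟩ := bool_ext hsub h1 h2 f true
    exact ⟨g, hg⟩
  have hinj : Function.Injective res := by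
    have : Function.Injective (boolEquiv e ∘ res) :=
      Finite.injective_iff_surjective.2 ((boolEquiv e).surjective.comp hsurj)
    exact this.of_comp
  obtain ⟨g, hg, hg'⟩ := bool_ext hsub h1 h2 (ContinuousMap.const _ true) true
  obtain ⟨k, hk, hk'⟩ := bool_ext hsub h1 h2 (ContinuousMap.const _ true) false
  have : g = k := hinj (hg.trans hk.symm)
  have a1 := hg' ⟨p, hp⟩ hpi
  have a2 := hk' ⟨p, hp⟩ hpi
  rw [this, a2] at a1
  exact absurd a1 (by decide)

end DISC

/-! ### Cubes and collapses -/

section CUBES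
variable {n : ℕ} {K : Set (Fin n → ℝ)} {vτ jτ vσ jσ : Fin n → ℤ}

lemma binary_sub_le {j : Fin n → ℤ} (hj : IsBinary j) (v : Fin n → ℤ) : v - j ≤ v := by
  intro i
  rcases hj i with h | h <;> simp [h]

lemma cube_subset {v j v' j' : Fin n → ℤ} (hj : IsBinary j) :
    cube v j ⊆ cube v' j' ↔ v' - j' ≤ v - j ∧ v ≤ v' := by
  unfold cube
  rw [Set.Icc_subset_Icc_iff (toR_le.2 (binary_sub_le hj v)), toR_le, toR_le]

lemma mem_cube_int {v j u : Fin n → ℤ} : toR u ∈ cube v j ↔ v - j ≤ u ∧ u ≤ v := by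
  unfold cube
  rw [Set.mem_Icc, toR_le, toR_le]

lemma cube_zero (v : Fin n → ℤ) : cube v 0 = {toR v} := by
  unfold cube
  rw [sub_zero, Set.Icc_self]

lemma zero_binary : IsBinary (0 : Fin n → ℤ) := fun _ => Or.inl rfl

lemma exists_maximal {γ : Set (Fin n → ℝ)} (hγ : IsElemCube γ) (hγK : γ ⊆ K) :
    ∃ σ, IsMaximalCube K σ ∧ γ ⊆ σ := by
  have key : ∀ m : ℕ, ∀ v j : Fin n → ℤ, IsBinary j → cube v j ⊆ K →
      (∑ i, (1 - j i)).toNat = m → ∃ σ, IsMaximalCube K σ ∧ cube v j ⊆ σ := by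
    intro m
    induction m using Nat.strong_induction_on with
    | _ m ih =>
      intro v j hj hK hm
      by_cases hmax : IsMaximalCube K (cube v j)
      · exact ⟨_, hmax, subset_rfl⟩
      · have : ∃ γ, IsElemCube γ ∧ γ ⊆ K ∧ cube v j ⊆ γ ∧ γ ≠ cube v j := by
          by_contra hc
          push Not at hc
          exact hmax ⟨⟨v, j, hj, rfl⟩, hK, hc⟩
        obtain ⟨_, ⟨v', j', hj', rfl⟩, hK', hsub, hne⟩ := this
        obtain ⟨a, b⟩ := (cube_subset hj).1 hsub
        have hle : ∀ i, j i ≤ j' i := fun i => by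
          have := a i
          have := b i
          simp only [Pi.sub_apply] at *
          omega
        have hlt : ∑ i, (1 - j' i) < ∑ i, (1 - j i) := by
          refine Finset.sum_lt_sum (fun i _ => by have := hle i; omega) ?_
          by_contra hc
          push Not at hc
          have hjj : j = j' := by
            funext i
            have := hc i (Finset.mem_univ _)
            have := hle i
            omega
          subst hjj
          have : v' = v := le_antisymm (by simpa using a) b
          exact hne (by rw [this])
        have h0 : 0 ≤ ∑ i, (1 - j' i) := Finset.sum_nonneg fun i _ => by
          rcases hj' i with h | h <;> simp [h]
        obtain ⟨σ, h1, h2⟩ := ih _ (by omega) v' j' hj' hK' rfl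
        exact ⟨σ, h1, hsub.trans h2⟩
  obtain ⟨v, j, hj, rfl⟩ := hγ
  exact key _ v j hj hγK rfl

lemma sub_sigma {τ σ γ : Set (Fin n → ℝ)} (hf : IsFreeFace K τ σ) (hγ : IsElemCube γ)
    (hγK : γ ⊆ K) (hτ : τ ⊆ γ) : γ ⊆ σ := by
  obtain ⟨σ', h1, h2⟩ := exists_maximal hγ hγK
  rw [← hf.2.2.2 σ' h1 (hτ.trans h2)]
  exact h2

lemma complex_closed (hK : IsComplex K) : CubeClosed K := by
  obtain ⟨C, -, rfl⟩ := hK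
  refine cubeClosed_of fun x hx => ?_
  simp only [Set.mem_iUnion] at hx
  obtain ⟨c, hc, hx⟩ := hx
  exact ⟨c.1, c.2, hx, fun z hz => Set.mem_iUnion₂.2 ⟨c, hc, hz⟩⟩

lemma collapse_closed (τ : Set (Fin n → ℝ)) : CubeClosed (collapse K τ) := by
  refine cubeClosed_of fun x hx => ?_
  obtain ⟨_, ⟨⟨v, j, hj, rfl⟩, h2, h3⟩, hx⟩ := hx
  exact ⟨v, j, hx, fun z hz => ⟨cube v j, ⟨⟨v, j, hj, rfl⟩, h2, h3⟩, hz⟩⟩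

lemma collapse_sub (τ : Set (Fin n → ℝ)) : collapse K τ ⊆ K :=
  Set.sUnion_subset fun _ h => h.2.1

/-- A removed vertex. -/
lemma removed (hjτ : IsBinary jτ) {v : Fin n → ℤ} (hv : toR v ∈ K)
    (hv' : toR v ∉ collapse K (cube vτ jτ)) : cube vτ jτ = {toR v} := by
  have h : cube vτ jτ ⊆ cube v 0 := by
    by_contra hc
    refine hv' ⟨cube v 0, ⟨⟨v, 0, zero_binary, rfl⟩, ?_, hc⟩, ?_⟩
    · rw [cube_zero]; simpa using hv
    · rw [cube_zero]; rfl
  rw [cube_zero] at h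
  refine Set.Subset.antisymm h ?_
  have : toR vτ ∈ cube vτ jτ := mem_cube_int.2 ⟨binary_sub_le hjτ _, le_rfl⟩
  rw [Set.singleton_subset_iff, ← h this]
  exact this

/-- A removed vertex is not the minimum of the collapsed cube. -/
lemma removed_ne (hjτ : IsBinary jτ) (hjσ : IsBinary jσ) (hσK : cube vσ jσ ⊆ K)
    (hfree : IsFreeFace K (cube vτ jτ) (cube vσ jσ))
    (hlpdc : IsLPDCPair K (cube vτ jτ)) {v : Fin n → ℤ} (hv : toR v ∈ K)
    (hv' : toR v ∉ collapse K (cube vτ jτ)) : vσ - jσ ≠ v := by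
  intro hmin
  have hτ := removed hjτ hv hv'
  have hi : ∃ i, jσ i = 1 := by
    by_contra hc
    push Not at hc
    have : jσ = 0 := funext fun i => (hjσ i).resolve_right (hc i)
    subst this
    rw [sub_zero] at hmin
    subst hmin
    have := hfree.2.1
    rw [hτ, cube_zero] at this
    exact (ssubset_irrefl _ this)
  obtain ⟨i, hi⟩ := hi
  set u : Fin n → ℤ := v + Pi.single i 1 with hu
  have hui : u i = v i + 1 := by simp [hu]
  have huk : ∀ k, k ≠ i → u k = v k := fun k hk => by simp [hu, hk]
  have hvσ : ∀ k, v k = vσ k - jσ k := fun k => by rw [← hmin]; rfl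
  have huσ : u ≤ vσ := by
    intro k
    have a := hvσ k
    change u k ≤ vσ k
    by_cases hk : k = i
    · subst hk
      omega
    · have b := huk k hk
      rcases hjσ k with h | h <;> omega
  have hvu : v ≤ u := by
    intro k
    change v k ≤ u k
    by_cases hk : k = i
    · subst hk
      omega
    · rw [huk k hk]
  have huv : vt u {i} = toR v := by
    funext k
    rw [vt_apply]
    by_cases hk : k = i
    · subst hk
      simp [toR, hui]
    · simp [hk, toR, huk k hk]
  -- cubes not containing `v` survive
  have hsurv : ∀ J : Finset (Fin n), i ∉ J → cube u (ind J) ⊆ K →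
      cube u (ind J) ⊆ collapse K (cube vτ jτ) := by
    intro J hJ hK z hz
    refine ⟨cube u (ind J), ⟨⟨u, ind J, ind_binary J, rfl⟩, hK, ?_⟩, hz⟩
    rw [hτ, Set.singleton_subset_iff, mem_cube_int]
    intro h
    have := h.1 i
    simp only [Pi.sub_apply, ind, hJ, if_false] at this
    omega
  have hu' : toR u ∈ collapse K (cube vτ jτ) := by
    refine hsurv ∅ (by simp) ?_ ?_
    · refine Set.Subset.trans ?_ hσK
      rw [cube_subset (ind_binary _)]
      refine ⟨?_, huσ⟩
      rw [hmin]
      intro k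
      simpa [ind] using hvu k
    · exact mem_cube_int.2 ⟨binary_sub_le (ind_binary _) _, le_rfl⟩
  obtain ⟨e⟩ := hlpdc u hu'
  refine no_equiv (i := i) (a := u i) (p := toR v) ?_ ?_ ?_ ?_ ?_ finite_bool e
  · intro x hx
    obtain ⟨g1, g2, J, g3, g4⟩ := mem_geom.1 hx
    exact mem_geom.2 ⟨g1, g2, J, g3, g4.trans (collapse_sub _)⟩
  · intro x hx
    obtain ⟨g1, g2, J, g3, g4⟩ := mem_geom.1 hx
    by_cases hxi : x i = u i
    · left
      refine ⟨hxi, mem_geom.2 ⟨g1, g2, J.erase i, fun k hk => ?_, ?_⟩⟩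
      · by_cases hki : k = i
        · rw [hki, hxi]
        · exact g3 k fun h => hk (Finset.mem_erase.2 ⟨hki, h⟩)
      · exact hsurv _ (by simp) ((cube_ind_mono u (Finset.erase_subset _ _)).trans g4)
    · right
      have hiJ : i ∈ J := by
        by_contra h
        exact hxi (g3 i h)
      have hτJ : cube vτ jτ ⊆ cube u (ind J) := by
        rw [hτ, Set.singleton_subset_iff, mem_cube_ind]
        refine ⟨?_, toR_le.2 hvu⟩
        rw [← huv]
        exact vt_anti u (by simpa using hiJ)
      have hs := sub_sigma hfree ⟨u, ind J, ind_binary J, rfl⟩ g4 hτJ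
      rw [cube_subset (ind_binary _), hmin] at hs
      have hx : ∀ k, k ≠ i → x k = u k := by
        intro k hk
        refine g3 k fun hkJ => ?_
        have := hs.1 k
        simp only [Pi.sub_apply, ind, hkJ, if_true, huk k hk] at this
        omega
      have e1 : ht (toR u) - ht x = u i - x i := by
        simp only [ht]
        rw [← Finset.sum_sub_distrib]
        refine (Finset.sum_eq_single i (fun k _ hk => ?_) (by simp)).trans rfl
        rw [hx k hk]; simp [toR]
      linarith
  · intro x hx
    obtain ⟨g1, g2, J, g3, g4⟩ := mem_geom.1 hx
    refine g3 i fun hiJ => hv' (g4 ?_)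
    rw [mem_cube_ind]
    refine ⟨?_, toR_le.2 hvu⟩
    rw [← huv]
    exact vt_anti u (by simpa using hiJ)
  · refine mem_geom.2 ⟨toR_le.2 hvu, ?_, {i}, fun k hk => ?_, ?_⟩
    · rw [← huv, ht_vt]; simp
    · have : k ≠ i := by simpa using hk
      simp [toR, huk k this]
    · refine Set.Subset.trans ?_ hσK
      rw [cube_subset (ind_binary _), hmin]
      refine ⟨?_, huσ⟩
      have : toR v ≤ toR (u - ind {i}) := huv.ge
      exact toR_le.1 this
  · simp [toR, hui]

lemma removed_contr (hjτ : IsBinary jτ) (hjσ : IsBinary jσ) (hσK : cube vσ jσ ⊆ K)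
    (hfree : IsFreeFace K (cube vτ jτ) (cube vσ jσ))
    (hlpdc : IsLPDCPair K (cube vτ jτ)) {v : Fin n → ℤ} (hv : toR v ∈ K)
    (hv' : toR v ∉ collapse K (cube vτ jτ)) : ContractibleSpace (geomReal K v) := by
  have hne := removed_ne hjτ hjσ hσK hfree hlpdc hv hv'
  have hτ := removed hjτ hv hv'
  have hvσ : vσ - jσ ≤ v ∧ v ≤ vσ := by
    have := hfree.2.1.1
    rw [hτ, Set.singleton_subset_iff, mem_cube_int] at this
    exact this
  have hset : geomReal K v = {x | x ≤ toR v ∧ ht x = ht (toR v) - 1 ∧ toR (vσ - jσ) ≤ x} := by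
    ext x
    rw [mem_geom]
    constructor
    · rintro ⟨g1, g2, J, g3, g4⟩
      refine ⟨g1, g2, le_trans ?_ (geom_vt_le g1 g2 g3)⟩
      have hs := sub_sigma hfree ⟨v, ind J, ind_binary J, rfl⟩ g4 (by
        rw [hτ, Set.singleton_subset_iff, mem_cube_int]
        exact ⟨binary_sub_le (ind_binary _) _, le_rfl⟩)
      rw [cube_subset (ind_binary _)] at hs
      exact toR_le.2 hs.1
    · rintro ⟨g1, g2, g5⟩
      refine ⟨g1, g2, Finset.univ.filter fun i => x i ≠ v i, fun i hi => ?_, ?_⟩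
      · simpa using hi
      · refine Set.Subset.trans ?_ hσK
        rw [cube_subset (ind_binary _)]
        refine ⟨fun i => ?_, hvσ.2⟩
        have a := hvσ.1 i
        by_cases hx : x i = v i
        · simpa [ind, hx] using a
        · have b : x i < v i := lt_of_le_of_ne (g1 i) hx
          have c : (((vσ - jσ) i : ℤ) : ℝ) < v i := (g5 i).trans_lt b
          have d : (vσ - jσ) i < v i := by exact_mod_cast c
          have e : (v - ind (Finset.univ.filter fun i => x i ≠ v i)) i = v i - 1 := by
            simp [ind, hx]
          exact (Int.le_sub_one_of_lt d).trans_eq e.symm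
  rw [hset]
  refine Convex.contractibleSpace ?_ ?_
  · rintro x ⟨x1, x2, x3⟩ y ⟨y1, y2, y3⟩ a b ha hb hab
    refine ⟨fun i => ?_, ?_, fun i => ?_⟩
    · have p := x1 i
      have q := y1 i
      have : toR v i = a * toR v i + b * toR v i := by rw [← add_mul, hab, one_mul]
      rw [this]
      simp only [Pi.add_apply, Pi.smul_apply, smul_eq_mul]
      gcongr
    · have : ht (a • x + b • y) = a * ht x + b * ht y := by
        simp [ht, Finset.sum_add_distrib, Finset.mul_sum]
      rw [this, x2, y2, ← add_mul, hab, one_mul]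
    · have p := x3 i
      have q := y3 i
      have : toR (vσ - jσ) i = a * toR (vσ - jσ) i + b * toR (vσ - jσ) i := by
        rw [← add_mul, hab, one_mul]
      rw [this]
      simp only [Pi.add_apply, Pi.smul_apply, smul_eq_mul]
      gcongr
  · obtain ⟨i, hi⟩ := Function.ne_iff.1 hne
    have hlt : (vσ - jσ) i < v i := lt_of_le_of_ne (hvσ.1 i) hi
    refine ⟨vt v {i}, toR_le.2 (binary_sub_le (ind_binary _) _), by rw [ht_vt]; simp,
      toR_le.2 fun k => ?_⟩
    have := hvσ.1 k
    by_cases hk : k = i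
    · subst hk
      simp only [Pi.sub_apply, ind, Finset.mem_singleton, if_true] at *
      omega
    · simpa [ind, hk] using this

end CUBES


theorem statement17 (n : ℕ) (hn : 0 < n) (K : Set (Fin n → ℝ)) (hK : IsComplex K)
    (w : Fin n → ℤ) (hw : toR w ∈ K) (hmin : ∀ q ∈ K, toR w ≤ q)
    (vτ jτ vσ jσ : Fin n → ℤ) (hjτ : IsBinary jτ) (hjσ : IsBinary jσ)
    (hτK : cube vτ jτ ⊆ K) (hσK : cube vσ jσ ⊆ K)
    (hfree : IsFreeFace K (cube vτ jτ) (cube vσ jσ))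
    (hlpdc : IsLPDCPair K (cube vτ jτ)) :
    (∀ v : Fin n → ℤ, toR v ∈ K →
        ContractibleSpace ↥(DipathSpace K (toR w) (toR v))) ↔
    (∀ k : Fin n → ℤ, toR k ∈ collapse K (cube vτ jτ) →
        ContractibleSpace
          ↥(DipathSpace (collapse K (cube vτ jτ)) (toR w) (toR k))) := by
  have : NeZero n := ⟨hn.ne'⟩
  have hw' : toR w ∈ collapse K (cube vτ jτ) := by
    by_contra hc
    refine removed_ne hjτ hjσ hσK hfree hlpdc hw hc (le_antisymm ?_ ?_)
    · have h := hfree.2.1.1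
      rw [removed hjτ hw hc, Set.singleton_subset_iff, mem_cube_int] at h
      exact h.1
    · exact toR_le.1 (hmin _ (hσK (mem_cube_int.2 ⟨le_rfl, binary_sub_le hjσ _⟩)))
  rw [lemC (complex_closed hK) hw hmin, lemC (collapse_closed _) hw'
    (fun q hq => hmin q (collapse_sub _ hq))]
  constructor
  · intro h k hk hne
    have := h k (collapse_sub _ hk) hne
    obtain ⟨e⟩ := hlpdc k hk
    exact e.symm.contractibleSpace
  · intro h v hv hne
    by_cases hv' : toR v ∈ collapse K (cube vτ jτ)
    · have := h v hv' hne
      obtain ⟨e⟩ := hlpdc v hv'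
      exact e.contractibleSpace
    · exact removed_contr hjτ hjσ hσK hfree hlpdc hv hv'

end DCC
end
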